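/- Let 1 < p < ∞, let Ω ⊆ ℝ^N be a domain, V: Ω → [0,∞), and suppose Q_V(u) > 0 for all u ∈ D(Ω) \ {0}. Suppose there exist q with 1 < q ≤ p, p−1 < q, and a continuous function W: Ω → (0,∞) such that (∫_Ω (|∇u|^q + |u|^q)W dx)^{p/q} ≤ Q_V(u) for all u ∈ D(Ω). In place of the local integrability condition of (A), assume instead that V ∈ L^r_loc(Ω) where 1/r + (p−1)(p−q)/q = 1, and that there exists C > 0 with ∫_Ω V^{q/p}|u|^q dx ≤ C ∫_Ω |∇u|^q dx for all u ∈ D(Ω). Then for every linear functional f on D(Ω) with sup{ f(u) : u ∈ D(Ω), Q_V(u) = 1 } < ∞, there exists a locally integrable function u on Ω with weak gradient v such that ∫_Ω (|u|^q + |v|^q)W dx < ∞, there exist test functions φ_j ∈ D(Ω) with ∫_Ω (|u−φ_j|^q + |v−∇φ_j|^q)W dx → 0, and for every ζ ∈ D(Ω) the integrals below are finite and ∫_Ω |v|^{p−2}v·∇ζ dx − ∫_Ω V|u|^{p−2}u ζ dx = f(ζ). -/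

import Mathlib

open MeasureTheory Real Filter Topology RealInnerProductSpace

noncomputable section

abbrev Euc (d : ℕ) : Type := EuclideanSpace ℝ (Fin d)

/-- `u` is a test function on `U`: smooth with compact support contained in `U`. -/
def IsTestFun {d : ℕ} (U : Set (Euc d)) (u : Euc d → ℝ) : Prop :=
  ContDiff ℝ (⊤ : ℕ∞) u ∧ HasCompactSupport u ∧ tsupport u ⊆ U

/-- `v` is the weak gradient of `u` on `U`. -/
def HasWeakGradOn {d : ℕ} (U : Set (Euc d)) (u : Euc d → ℝ) (v : Euc d → Euc d) : Prop :=
  ∀ ζ : Euc d → ℝ, IsTestFun U ζ → ∀ i : Fin d,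
    (∫ x in U, u x * fderiv ℝ ζ x (EuclideanSpace.single i 1))
      = - ∫ x in U, v x i * ζ x

/-- The vector field `|s|^{p-2} s` (equal to `0` at `s = 0`). -/
def pvec {d : ℕ} (p : ℝ) (s : Euc d) : Euc d := ‖s‖ ^ (p - 2) • s

/-- The scalar function `|s|^{p-2} s` (equal to `0` at `s = 0`). -/
def psc (p : ℝ) (s : ℝ) : ℝ := |s| ^ (p - 2) * s

/-- The form `Q_V(u) = ∫_Ω |∇u|^p - ∫_Ω V |u|^p` (for smooth `u`). -/
def QV {d : ℕ} (p : ℝ) (U : Set (Euc d)) (V : Euc d → ℝ) (u : Euc d → ℝ) : ℝ :=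
  (∫ x in U, ‖gradient u x‖ ^ p) - ∫ x in U, V x * |u x| ^ p

/-! ### Elementary inequalities -/

lemma exists_rpow_le_mul_rpow_add {α β κ : ℝ} (hα : 0 < α) (hαβ : α < β) (hκ : 0 < κ) :
    ∃ C : ℝ, 0 ≤ C ∧ ∀ t : ℝ, 0 ≤ t → t ^ α ≤ κ * t ^ β + C := by
  set L : ℝ := (1 / κ) ^ (1 / (β - α)) with hL
  have hLpos : 0 < L := by positivity
  have hLpow : L ^ (β - α) = 1 / κ := by
    rw [hL, ← rpow_mul (by positivity), one_div_mul_cancel (by linarith), rpow_one]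
  refine ⟨L ^ α, by positivity, fun t ht => ?_⟩
  rcases le_total t L with h | h
  · have := rpow_le_rpow ht h hα.le
    have : 0 ≤ κ * t ^ β := by positivity
    linarith
  · have htp : 0 < t := hLpos.trans_le h
    have h1 : 1 / κ ≤ t ^ (β - α) := hLpow ▸ rpow_le_rpow hLpos.le h (by linarith)
    have h2 : t ^ β = t ^ (β - α) * t ^ α := by rw [← rpow_add htp]; ring_nf
    have h3 : 1 ≤ κ * t ^ (β - α) := by
      have := mul_le_mul_of_nonneg_left h1 hκ.le
      rwa [mul_one_div_cancel hκ.ne'] at this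
    have h4 : 0 < t ^ α := by positivity
    have : 0 ≤ L ^ α := by positivity
    rw [h2]; nlinarith

section PowerMap

variable {E : Type*} [NormedAddCommGroup E] [InnerProductSpace ℝ E]

/-- The map `s ↦ |s|^{p-2} s` on an inner product space. -/
def powerMap (p : ℝ) (s : E) : E := ‖s‖ ^ (p - 2) • s

lemma rpow_sub_two_mul {p t : ℝ} (hp : 1 < p) (ht : 0 ≤ t) : t ^ (p - 2) * t = t ^ (p - 1) := by
  rcases ht.eq_or_lt with rfl | h
  · rw [mul_zero, zero_rpow (by linarith)]
  · rw [← rpow_add_one h.ne']; ring_nf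

lemma rpow_sub_one_mul {p t : ℝ} (hp : 1 < p) (ht : 0 ≤ t) : t ^ (p - 1) * t = t ^ p := by
  rcases ht.eq_or_lt with rfl | h
  · rw [mul_zero, zero_rpow (by linarith)]
  · rw [← rpow_add_one h.ne']; ring_nf

lemma norm_powerMap {p : ℝ} (hp : 1 < p) (s : E) : ‖powerMap p s‖ = ‖s‖ ^ (p - 1) := by
  rw [powerMap, norm_smul, norm_of_nonneg (by positivity), rpow_sub_two_mul hp (norm_nonneg s)]

lemma inner_powerMap_self {p : ℝ} (hp : 1 < p) (s : E) : ⟪powerMap p s, s⟫ = ‖s‖ ^ p := by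
  rw [powerMap, real_inner_smul_left, real_inner_self_eq_norm_mul_norm, ← mul_assoc,
    rpow_sub_two_mul hp (norm_nonneg s), rpow_sub_one_mul hp (norm_nonneg s)]

lemma inner_powerMap_le {p : ℝ} (hp : 1 < p) (a b : E) :
    ⟪powerMap p a, b⟫ ≤ ‖a‖ ^ (p - 1) * ‖b‖ :=
  (real_inner_le_norm _ _).trans_eq (by rw [norm_powerMap hp])

/-- The first order convexity inequality for `‖·‖ ^ p`. -/
lemma norm_rpow_add_inner_powerMap_le {p : ℝ} (hp : 1 < p) (a b : E) :
    ‖a‖ ^ p + p * ⟪powerMap p a, b - a⟫ ≤ ‖b‖ ^ p := by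
  have hpq : (p / (p - 1)).HolderConjugate p := (HolderConjugate.conjExponent hp).symm
  have h := young_inequality_of_nonneg (rpow_nonneg (norm_nonneg a) (p - 1)) (norm_nonneg b) hpq
  rw [← rpow_mul (norm_nonneg a), mul_div_cancel₀ _ (by linarith : p - 1 ≠ 0)] at h
  have h1 := inner_powerMap_le hp a b
  rw [inner_sub_right, inner_powerMap_self hp]
  have h2 : p * (‖a‖ ^ p / (p / (p - 1)) + ‖b‖ ^ p / p) = (p - 1) * ‖a‖ ^ p + ‖b‖ ^ p := by
    have : p - 1 ≠ 0 := by linarith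
    field_simp
  have h3 : p * ⟪powerMap p a, b⟫ ≤ (p - 1) * ‖a‖ ^ p + ‖b‖ ^ p := by
    rw [← h2]; exact mul_le_mul_of_nonneg_left (h1.trans h) (by linarith)
  linarith

lemma continuous_powerMap {p : ℝ} (hp : 1 < p) : Continuous (powerMap p : E → E) := by
  rw [continuous_iff_continuousAt]
  intro s
  by_cases hs : s = 0
  · subst hs
    have h0 : powerMap p (0 : E) = 0 := by simp [powerMap]
    rw [ContinuousAt, h0, tendsto_zero_iff_norm_tendsto_zero]
    simp only [norm_powerMap hp]
    have : ContinuousAt (fun s : E => ‖s‖ ^ (p - 1)) 0 :=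
      continuous_norm.continuousAt.rpow_const (Or.inr (by linarith))
    simpa [ContinuousAt, zero_rpow (by linarith : p - 1 ≠ 0)] using this
  · exact (continuous_norm.continuousAt.rpow_const (Or.inl (norm_ne_zero_iff.2 hs))).smul
      continuousAt_id

lemma inner_powerMap_sub_pos {p : ℝ} (hp : 1 < p) {a b : E} (hab : a ≠ b) :
    0 < ⟪powerMap p a - powerMap p b, a - b⟫ := by
  by_cases hn : ‖a‖ = ‖b‖
  · have hb : 0 < ‖b‖ := by
      rcases (norm_nonneg b).eq_or_lt with h | h
      · exact absurd ((norm_eq_zero.1 (hn.trans h.symm)).trans (norm_eq_zero.1 h.symm).symm) hab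
      · exact h
    have : powerMap p a - powerMap p b = ‖b‖ ^ (p - 2) • (a - b) := by
      rw [powerMap, powerMap, hn, smul_sub]
    rw [this, real_inner_smul_left, real_inner_self_eq_norm_sq]
    have : 0 < ‖a - b‖ := norm_pos_iff.2 (sub_ne_zero.2 hab)
    positivity
  · have h1 := inner_powerMap_le hp a b
    have h2 := inner_powerMap_le hp b a
    have h3 : ⟪powerMap p a - powerMap p b, a - b⟫ =
        ‖a‖ ^ p + ‖b‖ ^ p - ⟪powerMap p a, b⟫ - ⟪powerMap p b, a⟫ := by
      rw [inner_sub_left, inner_sub_right, inner_sub_right, inner_powerMap_self hp,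
        inner_powerMap_self hp]; ring
    have h4 : 0 < (‖a‖ ^ (p - 1) - ‖b‖ ^ (p - 1)) * (‖a‖ - ‖b‖) := by
      rcases lt_or_gt_of_ne hn with h | h
      · exact mul_pos_of_neg_of_neg
          (sub_neg.2 (rpow_lt_rpow (norm_nonneg _) h (by linarith))) (sub_neg.2 h)
      · exact mul_pos (sub_pos.2 (rpow_lt_rpow (norm_nonneg _) h (by linarith))) (sub_pos.2 h)
    have h5 := rpow_sub_one_mul hp (norm_nonneg a)
    have h6 := rpow_sub_one_mul hp (norm_nonneg b)
    rw [h3]; nlinarith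

lemma inner_powerMap_sub_nonneg {p : ℝ} (hp : 1 < p) (a b : E) :
    0 ≤ ⟪powerMap p a - powerMap p b, a - b⟫ := by
  by_cases h : a = b
  · simp [h]
  · exact (inner_powerMap_sub_pos hp h).le

/-- Distances are controlled by the monotonicity gap of the power map, up to small errors. -/
lemma exists_norm_sub_le_monotonicity [FiniteDimensional ℝ E] {p q κ : ℝ} (hp : 1 < p)
    (hq : 1 < q) (hκ : 0 < κ) :
    ∃ C : ℝ, 0 ≤ C ∧ ∀ a b : E, ‖a - b‖ ≤
      κ * (1 + ‖a‖ ^ q + ‖b‖ ^ q) + C * ⟪powerMap p a - powerMap p b, a - b⟫ := by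
  obtain ⟨L, hL0, hL⟩ := exists_rpow_le_mul_rpow_add one_pos hq (half_pos hκ)
  have hκ2 : ∀ t : ℝ, 0 ≤ t → t ≤ κ / 2 * t ^ q + L := fun t ht => by simpa using hL t ht
  obtain ⟨S, hS1, hS⟩ : ∃ S : ℝ, 1 ≤ S ∧ ∀ t, S ≤ t → 2 * L ≤ κ / 2 * t ^ q := by
    have ht : Tendsto (fun t : ℝ => κ / 2 * t ^ q) atTop atTop :=
      (tendsto_rpow_atTop (by linarith)).const_mul_atTop (half_pos hκ)
    obtain ⟨S, hS⟩ := (ht.eventually_ge_atTop (2 * L)).exists_forall_of_atTop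
    exact ⟨max S 1, le_max_right _ _, fun t ht => hS t ((le_max_left _ _).trans ht)⟩
  set K : Set (E × E) := (Metric.closedBall 0 S ×ˢ Metric.closedBall 0 S) ∩
    {z | κ ≤ ‖z.1 - z.2‖}
  have hK : IsCompact K :=
    ((isCompact_closedBall _ _).prod (isCompact_closedBall _ _)).inter_right
      (isClosed_le continuous_const (by fun_prop))
  have hpc := continuous_powerMap (E := E) hp
  have hcont : ContinuousOn
      (fun z : E × E => ‖z.1 - z.2‖ / ⟪powerMap p z.1 - powerMap p z.2, z.1 - z.2⟫) K := by
    refine ContinuousOn.div (by fun_prop) (by fun_prop) fun z hz => ?_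
    refine (inner_powerMap_sub_pos hp fun h => ?_).ne'
    have := hz.2
    simp only [Set.mem_ofPred_eq, h, sub_self, norm_zero] at this
    linarith
  obtain ⟨C, hC⟩ := hK.bddAbove_image hcont
  refine ⟨max C 0, le_max_right _ _, fun a b => ?_⟩
  have hG := inner_powerMap_sub_nonneg hp a b
  have ha : 0 ≤ ‖a‖ ^ q := by positivity
  have hb : 0 ≤ ‖b‖ ^ q := by positivity
  have hCG : 0 ≤ max C 0 * ⟪powerMap p a - powerMap p b, a - b⟫ :=
    mul_nonneg (le_max_right _ _) hG
  have htri : ‖a - b‖ ≤ ‖a‖ + ‖b‖ := norm_sub_le _ _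
  by_cases hbig : S ≤ ‖a‖ ∨ S ≤ ‖b‖
  · have h1 := hκ2 _ (norm_nonneg a)
    have h2 := hκ2 _ (norm_nonneg b)
    have h3 : 2 * L ≤ κ / 2 * (‖a‖ ^ q + ‖b‖ ^ q) := by
      rcases hbig with h | h
      · have := hS _ h; nlinarith
      · have := hS _ h; nlinarith
    nlinarith
  · push Not at hbig
    by_cases hsm : ‖a - b‖ ≤ κ
    · nlinarith
    · have hmem : (a, b) ∈ K := by
        refine ⟨⟨?_, ?_⟩, (not_le.1 hsm).le⟩ <;> simp [hbig.1.le, hbig.2.le]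
      have hle := hC (Set.mem_image_of_mem _ hmem)
      have hne : a ≠ b := by
        rintro rfl; simp at hsm; linarith
      have hpos := inner_powerMap_sub_pos hp hne
      simp only [] at hle
      rw [div_le_iff₀ hpos] at hle
      have : C * ⟪powerMap p a - powerMap p b, a - b⟫ ≤
          max C 0 * ⟪powerMap p a - powerMap p b, a - b⟫ :=
        mul_le_mul_of_nonneg_right (le_max_left _ _) hG
      have : 0 ≤ κ * (1 + ‖a‖ ^ q + ‖b‖ ^ q) := by positivity
      linarith

lemma exists_norm_sub_le_weighted_monotonicity [FiniteDimensional ℝ E] {p q κ : ℝ} (hp : 1 < p)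
    (hq : 1 < q) (hκ : 0 < κ) :
    ∃ C : ℝ, 0 ≤ C ∧ ∀ (a b : E) (θ : ℝ), 0 ≤ θ → θ ≤ 1 → ‖a - b‖ ≤
      κ * (1 + ‖a‖ ^ q + ‖b‖ ^ q) + C * (θ * ⟪powerMap p a - powerMap p b, a - b⟫)
        + C * (1 - θ) := by
  obtain ⟨C₁, h10, h1⟩ := exists_norm_sub_le_monotonicity (E := E) hp hq hκ
  obtain ⟨C₂, h20, h2⟩ := exists_rpow_le_mul_rpow_add one_pos hq hκ
  refine ⟨max C₁ (2 * C₂), le_max_of_le_left h10, fun a b θ hθ hθ1 => ?_⟩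
  have hG := inner_powerMap_sub_nonneg hp a b
  have ha := h2 _ (norm_nonneg a)
  have hb := h2 _ (norm_nonneg b)
  rw [rpow_one] at ha hb
  have e1 := mul_le_mul_of_nonneg_left (h1 a b) hθ
  have e2 : (1 - θ) * ‖a - b‖ ≤ (1 - θ) * (κ * (1 + ‖a‖ ^ q + ‖b‖ ^ q) + 2 * C₂) :=
    mul_le_mul_of_nonneg_left (by linarith [norm_sub_le a b]) (by linarith)
  have e3 : C₁ * (θ * ⟪powerMap p a - powerMap p b, a - b⟫) ≤
      max C₁ (2 * C₂) * (θ * ⟪powerMap p a - powerMap p b, a - b⟫) :=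
    mul_le_mul_of_nonneg_right (le_max_left _ _) (by positivity)
  have e4 : 2 * C₂ * (1 - θ) ≤ max C₁ (2 * C₂) * (1 - θ) :=
    mul_le_mul_of_nonneg_right (le_max_right _ _) (by linarith)
  linarith

end PowerMap

lemma add_rpow_le_two_rpow_mul {q s t : ℝ} (hq : 0 < q) (hs : 0 ≤ s) (ht : 0 ≤ t) :
    (s + t) ^ q ≤ 2 ^ q * (s ^ q + t ^ q) := by
  have h : s + t ≤ 2 * max s t := by linarith [le_max_left s t, le_max_right s t]
  have hm : (max s t) ^ q ≤ s ^ q + t ^ q := by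
    have := rpow_nonneg hs q
    have := rpow_nonneg ht q
    rcases max_cases s t with ⟨h, _⟩ | ⟨h, _⟩ <;> rw [h] <;> linarith
  calc (s + t) ^ q ≤ (2 * max s t) ^ q := rpow_le_rpow (by positivity) h hq.le
    _ = 2 ^ q * (max s t) ^ q := mul_rpow (by norm_num) (le_max_of_le_left hs)
    _ ≤ _ := by gcongr

lemma norm_sub_rpow_le {E : Type*} [SeminormedAddCommGroup E] {q : ℝ} (hq : 0 < q)
    (a b : E) :
    ‖a - b‖ ^ q ≤ 2 ^ q * (‖a‖ ^ q + ‖b‖ ^ q) :=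
  (rpow_le_rpow (norm_nonneg _) (norm_sub_le a b) hq.le).trans
    (add_rpow_le_two_rpow_mul hq (norm_nonneg _) (norm_nonneg _))

lemma norm_add_rpow_le {E : Type*} [SeminormedAddCommGroup E] {q : ℝ} (hq : 0 < q)
    (a b : E) :
    ‖a + b‖ ^ q ≤ 2 ^ q * (‖a‖ ^ q + ‖b‖ ^ q) :=
  (rpow_le_rpow (norm_nonneg _) (norm_add_le a b) hq.le).trans
    (add_rpow_le_two_rpow_mul hq (norm_nonneg _) (norm_nonneg _))

section Deficit

variable {E : Type*} [NormedAddCommGroup E] [NormedSpace ℝ E]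

/-- The midpoint convexity deficit of `‖·‖ ^ q`. -/
def midDeficit (q : ℝ) (a b : E) : ℝ :=
  1 / 2 * ‖a‖ ^ q + 1 / 2 * ‖b‖ ^ q - ‖(1 / 2 : ℝ) • a + (1 / 2 : ℝ) • b‖ ^ q

lemma midDeficit_nonneg {q : ℝ} (hq : 1 < q) (a b : E) : 0 ≤ midDeficit q a b := by
  have h1 : ‖(1 / 2 : ℝ) • a + (1 / 2 : ℝ) • b‖ ≤ 1 / 2 * ‖a‖ + 1 / 2 * ‖b‖ := by
    refine (norm_add_le _ _).trans_eq ?_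
    rw [norm_smul, norm_smul]; norm_num
  have h2 := (convexOn_rpow hq.le).2 (norm_nonneg a) (norm_nonneg b)
    (by norm_num : (0 : ℝ) ≤ 1 / 2) (by norm_num : (0 : ℝ) ≤ 1 / 2) (by norm_num)
  simp only [smul_eq_mul] at h2
  have h3 := rpow_le_rpow (norm_nonneg _) h1 (by linarith : 0 ≤ q)
  rw [midDeficit]; linarith

lemma exists_norm_sub_rpow_le_midDeficit {q : ℝ} (hq : 1 < q) :
    ∃ C : ℝ, 0 ≤ C ∧ ∀ a b : E, ‖a - b‖ ^ q ≤ C * (midDeficit q a b + ‖b‖ ^ q) := by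
  obtain ⟨l, hl1, hl2⟩ : ∃ l : ℝ, 1 < l ∧ (l / 2) ^ q < 1 / 2 := by
    have hc : ContinuousAt (fun l : ℝ => (l / 2) ^ q) 1 :=
      ContinuousAt.rpow_const (by fun_prop) (Or.inr (by linarith))
    have h1 : ((1 : ℝ) / 2) ^ q < 1 / 2 := by
      simpa using rpow_lt_rpow_of_exponent_gt (by norm_num : (0 : ℝ) < 1 / 2) (by norm_num) hq
    have hev := hc.eventually (gt_mem_nhds h1)
    obtain ⟨l, h, hl⟩ := ((hev.filter_mono nhdsWithin_le_nhds).and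
      (self_mem_nhdsWithin : Set.Ioi (1 : ℝ) ∈ 𝓝[>] 1)).exists
    exact ⟨l, hl, h⟩
  set c : ℝ := 1 / 2 - (l / 2) ^ q with hc
  have hcpos : 0 < c := by linarith
  set M : ℝ := (l / (l - 1)) with hM
  have hMpos : 0 < M := div_pos (by linarith) (by linarith)
  have key : ∀ a b : E, c * ‖a‖ ^ q ≤ midDeficit q a b + M ^ q * ‖b‖ ^ q := by
    intro a b
    have hle : ‖(1 / 2 : ℝ) • a + (1 / 2 : ℝ) • b‖ ≤ (‖a‖ + ‖b‖) / 2 := by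
      refine (norm_add_le _ _).trans_eq ?_
      rw [norm_smul, norm_smul]; norm_num; ring
    have hA : 0 ≤ ‖a‖ ^ q := by positivity
    have hB : 0 ≤ ‖b‖ ^ q := by positivity
    have h0 : ‖(1 / 2 : ℝ) • a + (1 / 2 : ℝ) • b‖ ^ q ≤
        (l / 2) ^ q * ‖a‖ ^ q + M ^ q * ‖b‖ ^ q := by
      have hq0 : 0 ≤ q := by linarith
      rcases le_total ‖b‖ ((l - 1) * ‖a‖) with h | h
      · have : ‖(1 / 2 : ℝ) • a + (1 / 2 : ℝ) • b‖ ≤ l / 2 * ‖a‖ := by nlinarith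
        have h' := rpow_le_rpow (norm_nonneg _) this hq0
        rw [mul_rpow (by linarith) (norm_nonneg a)] at h'
        have : 0 ≤ M ^ q * ‖b‖ ^ q := by positivity
        linarith
      · have : ‖(1 / 2 : ℝ) • a + (1 / 2 : ℝ) • b‖ ≤ M * ‖b‖ := by
          have h1 : ‖a‖ + ‖b‖ ≤ M * ‖b‖ := by
            rw [hM, div_mul_eq_mul_div, le_div_iff₀ (by linarith)]; nlinarith
          have := norm_nonneg a
          have := norm_nonneg b
          linarith
        have h' := rpow_le_rpow (norm_nonneg _) this hq0
        rw [mul_rpow hMpos.le (norm_nonneg b)] at h'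
        have : 0 ≤ (l / 2) ^ q * ‖a‖ ^ q := by positivity
        linarith
    rw [midDeficit, hc]; linarith
  have hMq : 0 < M ^ q := by positivity
  refine ⟨2 ^ q * (1 / c * (1 + M ^ q) + 1), by positivity, fun a b => ?_⟩
  have h1 := norm_sub_rpow_le (by linarith : 0 < q) a b
  have hB : 0 ≤ ‖b‖ ^ q := by positivity
  have hD := midDeficit_nonneg hq a b
  have h2 : ‖a‖ ^ q ≤ 1 / c * (midDeficit q a b + M ^ q * ‖b‖ ^ q) := by
    rw [one_div, inv_mul_eq_div, le_div_iff₀ hcpos]; linarith [key a b]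
  have h3 : 1 / c * (midDeficit q a b + M ^ q * ‖b‖ ^ q) ≤
      1 / c * ((1 + M ^ q) * (midDeficit q a b + ‖b‖ ^ q)) := by
    gcongr; nlinarith [mul_nonneg hMq.le hD]
  refine h1.trans ?_
  rw [mul_assoc]
  gcongr
  nlinarith

end Deficit

/-! ### Convergence of integrals -/

section Convergence

variable {α : Type*} [MeasurableSpace α] {μ : Measure α}

/-- Fatou's lemma for nonnegative real functions converging almost everywhere. -/
lemma integrable_and_integral_le_of_tendsto_ae {f : ℕ → α → ℝ} {g : α → ℝ} {e : ℝ}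
    (hf : ∀ n, Integrable (f n) μ) (h0 : ∀ n, ∀ᵐ x ∂μ, 0 ≤ f n x)
    (hle : ∀ᶠ n in atTop, ∫ x, f n x ∂μ ≤ e)
    (hlim : ∀ᵐ x ∂μ, Tendsto (fun n => f n x) atTop (𝓝 (g x))) :
    Integrable g μ ∧ ∫ x, g x ∂μ ≤ e := by
  have hgm : AEStronglyMeasurable g μ :=
    aestronglyMeasurable_of_tendsto_ae atTop (fun n => (hf n).1) hlim
  have hg0 : ∀ᵐ x ∂μ, 0 ≤ g x := by
    filter_upwards [hlim, ae_all_iff.2 h0] with x hx h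
    exact ge_of_tendsto' hx h
  have he : 0 ≤ e := by
    obtain ⟨n, hn⟩ := hle.exists
    exact (integral_nonneg_of_ae (h0 n)).trans hn
  have hfat : ∫⁻ x, ENNReal.ofReal (g x) ∂μ ≤ ENNReal.ofReal e := by
    calc ∫⁻ x, ENNReal.ofReal (g x) ∂μ
        = ∫⁻ x, liminf (fun n => ENNReal.ofReal (f n x)) atTop ∂μ := by
          refine lintegral_congr_ae ?_
          filter_upwards [hlim] with x hx
          exact ((ENNReal.continuous_ofReal.tendsto _).comp hx).liminf_eq.symm
      _ ≤ liminf (fun n => ∫⁻ x, ENNReal.ofReal (f n x) ∂μ) atTop :=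
          lintegral_liminf_le' fun n => (hf n).1.aemeasurable.ennreal_ofReal
      _ ≤ ENNReal.ofReal e := by
          refine liminf_le_of_frequently_le' (Eventually.frequently ?_)
          filter_upwards [hle] with n hn
          rw [← ofReal_integral_eq_lintegral_ofReal (hf n) (h0 n)]
          exact ENNReal.ofReal_le_ofReal hn
  have hgi : Integrable g μ := by
    refine ⟨hgm, ?_⟩
    rw [hasFiniteIntegral_iff_ofReal hg0]
    exact hfat.trans_lt ENNReal.ofReal_lt_top
  refine ⟨hgi, ?_⟩
  rw [← ofReal_integral_eq_lintegral_ofReal hgi hg0] at hfat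
  exact (ENNReal.ofReal_le_ofReal_iff he).1 hfat

/-- Dominated convergence to zero where the dominating functions may carry a part
with small integral. -/
lemma tendsto_integral_zero_of_le_add {d : ℕ → α → ℝ}
    (hd : ∀ n, AEStronglyMeasurable (d n) μ) (h0 : ∀ n, ∀ᵐ x ∂μ, 0 ≤ d n x)
    (hlim : ∀ᵐ x ∂μ, Tendsto (fun n => d n x) atTop (𝓝 0))
    (hdom : ∀ κ : ℝ, 0 < κ → ∃ (H : ℕ → α → ℝ) (G : α → ℝ), (∀ n, Integrable (H n) μ) ∧
      (∀ n, ∀ᵐ x ∂μ, 0 ≤ H n x) ∧ (∀ᶠ n in atTop, ∫ x, H n x ∂μ ≤ κ) ∧ Integrable G μ ∧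
      ∀ n, ∀ᵐ x ∂μ, d n x ≤ H n x + G x) :
    Tendsto (fun n => ∫ x, d n x ∂μ) atTop (𝓝 0) := by
  rw [Metric.tendsto_atTop]
  intro κ hκ
  obtain ⟨H, G, hH, hH0, hHκ, hG, hle⟩ := hdom (κ / 2) (half_pos hκ)
  have hmin : Tendsto (fun n => ∫ x, min (d n x) |G x| ∂μ) atTop (𝓝 (∫ _, (0 : ℝ) ∂μ)) := by
    refine tendsto_integral_of_dominated_convergence (fun x => |G x|)
      (fun n => (hd n).inf hG.abs.1) hG.abs (fun n => ?_) ?_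
    · filter_upwards [h0 n] with x hx
      rw [norm_of_nonneg (le_min hx (abs_nonneg _))]
      exact min_le_right _ _
    · filter_upwards [hlim] with x hx
      simpa using hx.min (tendsto_const_nhds (x := |G x|))
  rw [integral_zero, Metric.tendsto_atTop] at hmin
  obtain ⟨n₁, hn₁⟩ := hmin (κ / 2) (half_pos hκ)
  obtain ⟨n₂, hn₂⟩ := eventually_atTop.1 hHκ
  refine ⟨max n₁ n₂, fun n hn => ?_⟩
  have e1 := hn₁ n ((le_max_left _ _).trans hn)
  have e2 := hn₂ n ((le_max_right _ _).trans hn)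
  rw [dist_zero_right, norm_eq_abs] at e1 ⊢
  have hmi : Integrable (fun x => min (d n x) |G x|) μ := by
    refine hG.abs.mono' ((hd n).inf hG.abs.1) ?_
    filter_upwards [h0 n] with x hx
    rw [norm_of_nonneg (le_min hx (abs_nonneg _))]
    exact min_le_right _ _
  have e3 : ∫ x, d n x ∂μ ≤ ∫ x, (H n x + min (d n x) |G x|) ∂μ := by
    refine integral_mono_of_nonneg (h0 n) ((hH n).add hmi) ?_
    filter_upwards [hle n, hH0 n] with x hx hHx
    change d n x ≤ H n x + min (d n x) |G x|
    rcases min_cases (d n x) |G x| with ⟨h, _⟩ | ⟨h, _⟩ <;> rw [h]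
    · linarith
    · linarith [le_abs_self (G x)]
  rw [integral_add (hH n) hmi] at e3
  rw [abs_of_nonneg (integral_nonneg_of_ae (h0 n))]
  linarith [(abs_lt.1 e1).2]

lemma exists_rpow_mul_le_young {a q κ : ℝ} (ha : 0 < a) (haq : a < q) (hκ : 0 < κ) :
    ∃ C : ℝ, 0 ≤ C ∧ ∀ h g : ℝ, 0 ≤ h → 0 ≤ g →
      h ^ a * g ≤ κ * h ^ q + C * g ^ (q / (q - a)) := by
  have hq : 0 < q := ha.trans haq
  have hqa : 0 < q - a := by linarith
  set l : ℝ := κ ^ (a / q) with hl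
  have hlpos : 0 < l := by positivity
  have hconj : (q / a).HolderConjugate (q / (q - a)) := by
    rw [holderConjugate_iff]
    refine ⟨(one_lt_div ha).2 haq, ?_⟩
    rw [inv_div, inv_div]; field_simp; ring
  refine ⟨(l⁻¹) ^ (q / (q - a)), by positivity, fun h g hh hg => ?_⟩
  have hy := young_inequality_of_nonneg (mul_nonneg hlpos.le (rpow_nonneg hh a))
    (mul_nonneg (inv_nonneg.2 hlpos.le) hg) hconj
  have e1 : (l * h ^ a) ^ (q / a) = κ * h ^ q := by
    rw [mul_rpow hlpos.le (by positivity), hl, ← rpow_mul hκ.le, ← rpow_mul hh]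
    rw [show a / q * (q / a) = 1 by field_simp, show a * (q / a) = q by field_simp, rpow_one]
  have e2 : (l⁻¹ * g) ^ (q / (q - a)) = (l⁻¹) ^ (q / (q - a)) * g ^ (q / (q - a)) :=
    mul_rpow (by positivity) hg
  have e3 : l * h ^ a * (l⁻¹ * g) = h ^ a * g := by field_simp
  rw [e1, e2, e3] at hy
  have h1 : κ * h ^ q / (q / a) ≤ κ * h ^ q := div_le_self (by positivity) hconj.lt.le
  have h2 : (l⁻¹) ^ (q / (q - a)) * g ^ (q / (q - a)) / (q / (q - a)) ≤
      (l⁻¹) ^ (q / (q - a)) * g ^ (q / (q - a)) :=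
    div_le_self (by positivity) hconj.symm.lt.le
  linarith

/-- Convergence of integrals of functions bounded by `h_n ^ a * g`, where `h_n` is bounded
in `L^q` and `g` lies in the conjugate space of `L^{q/a}`. -/
lemma integrable_and_tendsto_integral_of_le_rpow_mul {a q M : ℝ} (ha : 0 < a) (haq : a < q)
    {h : ℕ → α → ℝ} {g : α → ℝ} {c : ℕ → α → ℝ} {c' : α → ℝ}
    (hh0 : ∀ n, ∀ᵐ x ∂μ, 0 ≤ h n x) (hg0 : ∀ᵐ x ∂μ, 0 ≤ g x)
    (hhi : ∀ n, Integrable (fun x => h n x ^ q) μ) (hhM : ∀ n, ∫ x, h n x ^ q ∂μ ≤ M)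
    (hgi : Integrable (fun x => g x ^ (q / (q - a))) μ)
    (hcm : ∀ n, AEStronglyMeasurable (c n) μ)
    (hcle : ∀ n, ∀ᵐ x ∂μ, |c n x| ≤ h n x ^ a * g x)
    (hlim : ∀ᵐ x ∂μ, Tendsto (fun n => c n x) atTop (𝓝 (c' x))) :
    Integrable c' μ ∧ Tendsto (fun n => ∫ x, c n x ∂μ) atTop (𝓝 (∫ x, c' x ∂μ)) := by
  have hbound : ∀ κ : ℝ, 0 < κ → ∃ C : ℝ, 0 ≤ C ∧ ∀ n, ∀ᵐ x ∂μ,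
      |c n x| ≤ κ * h n x ^ q + C * g x ^ (q / (q - a)) := by
    intro κ hκ
    obtain ⟨C, hC0, hC⟩ := exists_rpow_mul_le_young ha haq hκ
    refine ⟨C, hC0, fun n => ?_⟩
    filter_upwards [hh0 n, hg0, hcle n] with x h1 h2 h3
    exact h3.trans (hC _ _ h1 h2)
  obtain ⟨C₁, hC₁0, hC₁⟩ := hbound 1 one_pos
  have hci : ∀ n, Integrable (c n) μ := fun n =>
    Integrable.mono' (((hhi n).const_mul 1).add (hgi.const_mul C₁)) (hcm n)
      (by simpa [norm_eq_abs] using hC₁ n)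
  have hci' : Integrable c' μ := by
    have hm : AEStronglyMeasurable c' μ := aestronglyMeasurable_of_tendsto_ae atTop hcm hlim
    refine (integrable_norm_iff hm).1 (integrable_and_integral_le_of_tendsto_ae
      (f := fun n x => ‖c n x‖) (e := 1 * M + C₁ * ∫ x, g x ^ (q / (q - a)) ∂μ)
      (fun n => (hci n).norm) (fun n => ae_of_all _ fun x => norm_nonneg _)
      (Eventually.of_forall fun n => ?_) ?_).1
    · calc ∫ x, ‖c n x‖ ∂μ ≤ ∫ x, (1 * h n x ^ q + C₁ * g x ^ (q / (q - a))) ∂μ :=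
            integral_mono_ae (hci n).norm (((hhi n).const_mul 1).add (hgi.const_mul C₁))
              (hC₁ n)
        _ = 1 * ∫ x, h n x ^ q ∂μ + C₁ * ∫ x, g x ^ (q / (q - a)) ∂μ := by
            rw [integral_add ((hhi n).const_mul 1) (hgi.const_mul C₁), integral_const_mul,
              integral_const_mul]
        _ ≤ _ := by linarith [hhM n]
    · filter_upwards [hlim] with x hx using hx.norm
  refine ⟨hci', ?_⟩
  have hd : Tendsto (fun n => ∫ x, |c n x - c' x| ∂μ) atTop (𝓝 0) := by
    refine tendsto_integral_zero_of_le_add (fun n => ((hci n).sub hci').abs.1)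
      (fun n => ae_of_all _ fun x => abs_nonneg _) ?_ ?_
    · filter_upwards [hlim] with x hx
      simpa using (hx.sub_const (c' x)).abs
    · intro κ hκ
      have hM1 : 0 < |M| + 1 := by positivity
      obtain ⟨C, hC0, hC⟩ := hbound (κ / (|M| + 1)) (div_pos hκ hM1)
      refine ⟨fun n x => κ / (|M| + 1) * h n x ^ q,
        fun x => C * g x ^ (q / (q - a)) + |c' x|, fun n => (hhi n).const_mul _, fun n => ?_,
        Eventually.of_forall fun n => ?_, (hgi.const_mul C).add hci'.abs, fun n => ?_⟩
      · filter_upwards [hh0 n] with x hx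
        positivity
      · rw [integral_const_mul]
        have h1 : ∫ x, h n x ^ q ∂μ ≤ |M| + 1 := by linarith [hhM n, le_abs_self M]
        calc κ / (|M| + 1) * ∫ x, h n x ^ q ∂μ ≤ κ / (|M| + 1) * (|M| + 1) := by gcongr
          _ = κ := by field_simp
      · filter_upwards [hC n] with x hx
        linarith [abs_sub (c n x) (c' x)]
  rw [tendsto_iff_norm_sub_tendsto_zero]
  refine squeeze_zero (fun n => norm_nonneg _) (fun n => ?_) hd
  rw [← integral_sub (hci n) hci']
  exact norm_integral_le_integral_norm _

end Convergence

/-! ### Test functions -/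

section TestFunctions

variable {d : ℕ} {U : Set (Euc d)} {u w : Euc d → ℝ}

lemma IsTestFun.continuous (hu : IsTestFun U u) : Continuous u := hu.1.continuous

lemma IsTestFun.differentiable (hu : IsTestFun U u) : Differentiable ℝ u :=
  hu.1.differentiable (by simp)

lemma IsTestFun.continuous_gradient (hu : IsTestFun U u) : Continuous (gradient u) :=
  (InnerProductSpace.toDual ℝ (Euc d)).symm.continuous.comp (hu.1.continuous_fderiv (by simp))

lemma IsTestFun.isCompact_tsupport (hu : IsTestFun U u) : IsCompact (tsupport u) := hu.2.1

lemma gradient_eq_zero_of_notMem_tsupport {x : Euc d} (hx : x ∉ tsupport u) :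
    gradient u x = 0 := by
  rw [gradient, fderiv_of_notMem_tsupport ℝ hx, map_zero]

lemma isTestFun_of_subset (hu : ContDiff ℝ (⊤ : ℕ∞) u) {K : Set (Euc d)} (hK : IsCompact K)
    (hKU : K ⊆ U) (h0 : ∀ x, x ∉ K → u x = 0) : IsTestFun U u :=
  have hs : tsupport u ⊆ K :=
    closure_minimal (fun x hx => by by_contra h; exact hx (h0 x h)) hK.isClosed
  ⟨hu, hK.of_isClosed_subset (isClosed_tsupport u) hs, hs.trans hKU⟩

lemma IsTestFun.lincomb (hu : IsTestFun U u) (hw : IsTestFun U w) (a b : ℝ) :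
    IsTestFun U (fun x => a * u x + b * w x) := by
  refine isTestFun_of_subset ((contDiff_const.mul hu.1).add (contDiff_const.mul hw.1))
    (hu.isCompact_tsupport.union hw.isCompact_tsupport) (Set.union_subset hu.2.2 hw.2.2) ?_
  intro x hx
  rw [Set.mem_union, not_or] at hx
  simp [image_eq_zero_of_notMem_tsupport hx.1, image_eq_zero_of_notMem_tsupport hx.2]

lemma gradient_lincomb (hu : Differentiable ℝ u) (hw : Differentiable ℝ w) (a b : ℝ)
    (x : Euc d) : gradient (fun x => a * u x + b * w x) x
      = a • gradient u x + b • gradient w x := by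
  have h : fderiv ℝ (fun x => a * u x + b * w x) x = a • fderiv ℝ u x + b • fderiv ℝ w x := by
    rw [fderiv_fun_add ((hu x).const_mul a) ((hw x).const_mul b), fderiv_const_mul (hu x),
      fderiv_const_mul (hw x)]
  simp only [gradient, h, map_add, map_smul]

lemma IsTestFun.sub (hu : IsTestFun U u) (hw : IsTestFun U w) :
    IsTestFun U (fun x => u x - w x) := by
  simpa [sub_eq_add_neg] using hu.lincomb hw 1 (-1)

lemma gradient_fun_sub (hu : Differentiable ℝ u) (hw : Differentiable ℝ w) (x : Euc d) :
    gradient (fun x => u x - w x) x = gradient u x - gradient w x := by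
  simpa [sub_eq_add_neg] using gradient_lincomb hu hw 1 (-1) x

lemma IsTestFun.const_mul (hu : IsTestFun U u) (a : ℝ) : IsTestFun U (fun x => a * u x) := by
  simpa using hu.lincomb hu a 0

lemma gradient_fun_const_mul (hu : Differentiable ℝ u) (a : ℝ) (x : Euc d) :
    gradient (fun x => a * u x) x = a • gradient u x := by
  simpa using gradient_lincomb hu hu a 0 x

lemma isTestFun_zero : IsTestFun U (fun _ => (0 : ℝ)) :=
  isTestFun_of_subset contDiff_const isCompact_empty (Set.empty_subset U) fun _ _ => rfl

lemma IsTestFun.mul_right (hu : IsTestFun U u) (hw : ContDiff ℝ (⊤ : ℕ∞) w) :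
    IsTestFun U (fun x => u x * w x) :=
  isTestFun_of_subset (hu.1.mul hw) hu.isCompact_tsupport hu.2.2 fun x hx => by
    simp [image_eq_zero_of_notMem_tsupport hx]

lemma gradient_fun_mul (hu : Differentiable ℝ u) (hw : Differentiable ℝ w) (x : Euc d) :
    gradient (fun x => u x * w x) x = u x • gradient w x + w x • gradient u x := by
  simp only [gradient, fderiv_fun_mul (hu x) (hw x), map_add, map_smul]

/-- The bounded truncation `δ arctan (s / δ)`. -/
def softTrunc (δ s : ℝ) : ℝ := δ * arctan (s / δ)

lemma abs_softTrunc_le {δ : ℝ} (hδ : 0 < δ) (s : ℝ) : |softTrunc δ s| ≤ 2 * δ := by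
  rw [softTrunc, abs_mul, abs_of_pos hδ, mul_comm]
  have h1 := arctan_lt_pi_div_two (s / δ)
  have h2 := neg_pi_div_two_lt_arctan (s / δ)
  have : |arctan (s / δ)| ≤ 2 := abs_le.2 ⟨by linarith [pi_le_four], by linarith [pi_le_four]⟩
  gcongr

lemma contDiff_softTrunc (δ : ℝ) {g : Euc d → ℝ} (hg : ContDiff ℝ (⊤ : ℕ∞) g) :
    ContDiff ℝ (⊤ : ℕ∞) (fun x => softTrunc δ (g x)) :=
  contDiff_const.mul (contDiff_arctan.comp (hg.div_const δ))

lemma gradient_softTrunc {δ : ℝ} (hδ : 0 < δ) {g : Euc d → ℝ} (hg : Differentiable ℝ g)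
    (x : Euc d) : gradient (fun x => softTrunc δ (g x)) x
      = (1 / (1 + (g x / δ) ^ 2)) • gradient g x := by
  have h : HasFDerivAt (fun x => softTrunc δ (g x))
      ((1 / (1 + (g x / δ) ^ 2)) • fderiv ℝ g x) x := by
    have h1 : HasDerivAt (softTrunc δ) (δ * (1 / (1 + (g x / δ) ^ 2) * (1 / δ))) (g x) := by
      have := ((hasDerivAt_id (g x)).div_const δ).arctan.const_mul δ
      exact this
    have h2 := h1.comp_hasFDerivAt x (hg x).hasFDerivAt
    have h3 : δ * (1 / (1 + (g x / δ) ^ 2) * (1 / δ)) = 1 / (1 + (g x / δ) ^ 2) := by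
      rw [mul_comm, mul_assoc, one_div_mul_cancel hδ.ne', mul_one]
    rw [h3] at h2
    exact h2
  simp only [gradient, h.fderiv, map_smul]

lemma exists_cutoff (hU : IsOpen U) {K : Set (Euc d)} (hK : IsCompact K) (hKU : K ⊆ U) :
    ∃ χ : Euc d → ℝ, IsTestFun U χ ∧ (∀ x, 0 ≤ χ x) ∧ (∀ x, χ x ≤ 1) ∧ ∀ x ∈ K, χ x = 1 := by
  obtain ⟨L, hL, hKL, hLU⟩ := exists_compact_between hK hU hKU
  obtain ⟨χ, hχ, hr, hs, h1⟩ := exists_contMDiff_support_eq_eq_one_iff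
    (modelWithCornersSelf ℝ (Euc d)) (n := (⊤ : ℕ∞)) isOpen_interior hK.isClosed hKL
  refine ⟨χ, isTestFun_of_subset hχ.contDiff hL hLU fun x hx => ?_,
    fun x => (hr (Set.mem_range_self x)).1, fun x => (hr (Set.mem_range_self x)).2,
    fun x hx => (h1 x).1 hx⟩
  by_contra h
  have : x ∈ Function.support χ := h
  rw [hs] at this
  exact hx (interior_subset this)

lemma integrableOn_of_eq_zero_off (hU : IsOpen U) {K : Set (Euc d)} {E : Type*}
    [NormedAddCommGroup E] {F : Euc d → E} (hF : IntegrableOn F K)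
    (h0 : ∀ x, x ∉ K → F x = 0) : IntegrableOn F U :=
  hF.of_forall_sdiff_eq_zero hU.measurableSet fun x hx => h0 x hx.2

lemma setIntegral_eq_of_eq_zero_off (hU : IsOpen U) {K : Set (Euc d)} (hKU : K ⊆ U)
    {F : Euc d → ℝ} (h0 : ∀ x, x ∉ K → F x = 0) : ∫ x in U, F x = ∫ x in K, F x :=
  setIntegral_eq_of_subset_of_forall_sdiff_eq_zero hU.measurableSet hKU fun x hx => h0 x hx.2

lemma IsTestFun.exists_gradient_bound (hu : IsTestFun U u) :
    ∃ C : ℝ, 0 ≤ C ∧ ∀ x, ‖gradient u x‖ ≤ C := by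
  obtain ⟨C, hC⟩ := hu.isCompact_tsupport.exists_bound_of_continuousOn
    hu.continuous_gradient.continuousOn
  refine ⟨max C 0, le_max_right _ _, fun x => ?_⟩
  by_cases hx : x ∈ tsupport u
  · exact (hC x hx).trans (le_max_left _ _)
  · rw [gradient_eq_zero_of_notMem_tsupport hx, norm_zero]; exact le_max_right _ _

lemma IsTestFun.bddAbove_gradient (hu : IsTestFun U u) :
    BddAbove (Set.range fun x => ‖gradient u x‖) := by
  obtain ⟨C, -, hC⟩ := hu.exists_gradient_bound
  exact ⟨C, by rintro _ ⟨x, rfl⟩; exact hC x⟩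

/-- Integration by parts for two test functions. -/
lemma IsTestFun.integral_mul_fderiv (hu : IsTestFun U u) (hw : IsTestFun U w)
    (v : Euc d) :
    (∫ x in U, u x * fderiv ℝ w x v) = - ∫ x in U, ⟪gradient u x, v⟫ * w x := by
  have e1 : (∫ x in U, u x * fderiv ℝ w x v) = ∫ x, u x * fderiv ℝ w x v :=
    setIntegral_eq_integral_of_forall_compl_eq_zero fun x hx => by
      rw [image_eq_zero_of_notMem_tsupport fun h => hx (hu.2.2 h), zero_mul]
  have e2 : (∫ x in U, ⟪gradient u x, v⟫ * w x) = ∫ x, fderiv ℝ u x v * w x := by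
    simp only [inner_gradient_left]
    exact setIntegral_eq_integral_of_forall_compl_eq_zero fun x hx => by
      rw [image_eq_zero_of_notMem_tsupport fun h => hx (hw.2.2 h), mul_zero]
  rw [e1, e2]
  have hcu : Continuous fun x => fderiv ℝ u x v :=
    (hu.1.continuous_fderiv (by simp)).clm_apply continuous_const
  have hcw : Continuous fun x => fderiv ℝ w x v :=
    (hw.1.continuous_fderiv (by simp)).clm_apply continuous_const
  refine integral_mul_fderiv_eq_neg_fderiv_mul_of_integrable ?_ ?_ ?_
    (fun x _ => hu.differentiable x) (fun x _ => hw.differentiable x)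
  · exact (hcu.mul hw.continuous).integrable_of_hasCompactSupport hw.2.1.mul_left
  · exact (hu.continuous.mul hcw).integrable_of_hasCompactSupport hu.2.1.mul_right
  · exact (hu.continuous.mul hw.continuous).integrable_of_hasCompactSupport hu.2.1.mul_right

end TestFunctions

/-! ### Local compactness in `L^1` -/

section Rellich

lemma exists_subseq_tendsto_of_bounded {ι : Type*} [Countable ι] (a : ℕ → ι → ℝ)
    (ha : ∀ i, ∃ B : ℝ, ∀ n, |a n i| ≤ B) :
    ∃ σ : ℕ → ℕ, StrictMono σ ∧ ∀ i, ∃ l : ℝ, Tendsto (fun n => a (σ n) i) atTop (𝓝 l) := by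
  choose B hB using ha
  have hK : IsCompact (Set.univ.pi fun i => Set.Icc (-B i) (B i)) :=
    isCompact_univ_pi fun i => isCompact_Icc
  obtain ⟨l, -, σ, hσ, hl⟩ := hK.tendsto_subseq (x := a) fun n i _ => abs_le.1 (hB i n)
  exact ⟨σ, hσ, fun i => ⟨l i, (tendsto_pi_nhds.1 hl) i⟩⟩

lemma exists_compact_exhaustion {d : ℕ} {U : Set (Euc d)} (hU : IsOpen U) :
    ∃ K : ℕ → Set (Euc d), (∀ i, IsCompact (K i)) ∧ (∀ i, K i ⊆ U) ∧ Monotone K ∧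
      ∀ L, IsCompact L → L ⊆ U → ∃ i, L ⊆ K i := by
  have : LocallyCompactSpace U := hU.locallyCompactSpace
  let X : CompactExhaustion U := default
  refine ⟨fun i => Subtype.val '' X i, fun i => (X.isCompact i).image continuous_subtype_val,
    fun i => by simp, fun i j hij => Set.image_mono (X.subset hij), fun L hL hLU => ?_⟩
  have hL' : IsCompact (Subtype.val ⁻¹' L : Set U) := by
    rw [Subtype.isCompact_iff]
    rwa [Subtype.image_preimage_coe, Set.inter_eq_right.2 hLU]
  obtain ⟨i, hi⟩ := X.exists_superset_of_isCompact hL'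
  refine ⟨i, fun x hx => ⟨⟨x, hLU hx⟩, hi hx, rfl⟩⟩

variable {d : ℕ}

lemma norm_gradient_eq (g : Euc d → ℝ) (x : Euc d) : ‖gradient g x‖ = ‖fderiv ℝ g x‖ := by
  rw [gradient, LinearIsometryEquiv.norm_map]

lemma lintegral_enorm_sub_translate_le {g : Euc d → ℝ} (hg : ContDiff ℝ (⊤ : ℕ∞) g)
    (h : Euc d) :
    ∫⁻ x, ‖g x - g (x - h)‖ₑ ≤ ‖h‖ₑ * ∫⁻ x, ‖fderiv ℝ g x‖ₑ := by
  have hc : Continuous (fderiv ℝ g) := hg.continuous_fderiv (by simp)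
  have hpt : ∀ x, ‖g x - g (x - h)‖ₑ ≤
      ∫⁻ t in Set.Ioc (0 : ℝ) 1, ‖h‖ₑ * ‖fderiv ℝ g (x - h + t • h)‖ₑ := by
    intro x
    have hder : ∀ t ∈ Set.uIcc (0 : ℝ) 1,
        HasDerivAt (fun t : ℝ => g (x - h + t • h)) (fderiv ℝ g (x - h + t • h) h) t := by
      intro t _
      have h1 : HasDerivAt (fun t : ℝ => x - h + t • h) h t := by
        simpa using ((hasDerivAt_id t).smul_const h).const_add (x - h)
      exact ((hg.differentiable (by simp)) _).hasFDerivAt.comp_hasDerivAt t h1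
    have hcont : Continuous fun t : ℝ => fderiv ℝ g (x - h + t • h) h :=
      (hc.comp (by fun_prop)).clm_apply continuous_const
    have hftc := intervalIntegral.integral_eq_sub_of_hasDerivAt hder
      (hcont.intervalIntegrable 0 1)
    simp only [one_smul, sub_add_cancel, zero_smul, add_zero] at hftc
    rw [← hftc, intervalIntegral.integral_of_le zero_le_one]
    refine (enorm_integral_le_lintegral_enorm _).trans (lintegral_mono fun t => ?_)
    rw [mul_comm]
    exact ContinuousLinearMap.le_opENorm _ _
  have hm : Measurable (Function.uncurry fun (x : Euc d) (t : ℝ) =>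
      ‖h‖ₑ * ‖fderiv ℝ g (x - h + t • h)‖ₑ) :=
    (Continuous.enorm (hc.comp (by fun_prop))).measurable.const_mul _
  calc ∫⁻ x, ‖g x - g (x - h)‖ₑ
      ≤ ∫⁻ x, ∫⁻ t in Set.Ioc (0 : ℝ) 1, ‖h‖ₑ * ‖fderiv ℝ g (x - h + t • h)‖ₑ :=
        lintegral_mono hpt
    _ = ∫⁻ t in Set.Ioc (0 : ℝ) 1, ∫⁻ x, ‖h‖ₑ * ‖fderiv ℝ g (x - h + t • h)‖ₑ :=
        lintegral_lintegral_swap hm.aemeasurable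
    _ = ∫⁻ _ in Set.Ioc (0 : ℝ) 1, ‖h‖ₑ * ∫⁻ x, ‖fderiv ℝ g x‖ₑ := by
        refine lintegral_congr fun t => ?_
        rw [lintegral_const_mul' _ _ enorm_ne_top]
        congr 1
        have := lintegral_add_right_eq_self (μ := (volume : Measure (Euc d)))
          (fun x => ‖fderiv ℝ g x‖ₑ) (-h + t • h)
        simpa [← add_assoc, ← sub_eq_add_neg] using this
    _ = _ := by simp

lemma abs_mollify_sub_le {g ρ : Euc d → ℝ} (hρ : Continuous ρ) (hg : Continuous g)
    (hgc : HasCompactSupport g) {L : ℝ} (hρL : ∀ a b, |ρ a - ρ b| ≤ L * ‖a - b‖)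
    (x x' : Euc d) :
    |(∫ y, ρ (x - y) * g y) - ∫ y, ρ (x' - y) * g y| ≤ L * ‖x - x'‖ * ∫ y, |g y| := by
  have hi : ∀ x, Integrable fun y => ρ (x - y) * g y := fun x =>
    ((hρ.comp (by fun_prop)).mul hg).integrable_of_hasCompactSupport hgc.mul_left
  have hgi : Integrable fun y => |g y| := (hg.integrable_of_hasCompactSupport hgc).norm
  rw [← integral_sub (hi x) (hi x'), ← integral_const_mul]
  refine (norm_integral_le_integral_norm _).trans
    (integral_mono ((hi x).sub (hi x')).norm (hgi.const_mul _) fun y => ?_)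
  have h := hρL (x - y) (x' - y)
  rw [sub_sub_sub_cancel_right] at h
  simp only [Real.norm_eq_abs, Pi.sub_apply]
  rw [← sub_mul, abs_mul]
  gcongr

lemma continuous_mollify {g ρ : Euc d → ℝ} (hρ : Continuous ρ) (hg : Continuous g)
    (hgc : HasCompactSupport g) {L : ℝ} (hρL : ∀ a b, |ρ a - ρ b| ≤ L * ‖a - b‖) :
    Continuous fun x => ∫ y, ρ (x - y) * g y := by
  refine continuous_iff_continuousAt.2 fun x' => tendsto_iff_norm_sub_tendsto_zero.2 ?_
  refine squeeze_zero (fun _ => norm_nonneg _)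
    (fun x => abs_mollify_sub_le hρ hg hgc hρL x x') ?_
  have : Continuous fun x : Euc d => L * ‖x - x'‖ * ∫ y, |g y| := by fun_prop
  simpa using this.tendsto x'

/-- The distance in `L^1` of a function to its mollification. -/
lemma integral_abs_sub_mollify_le {g ρ : Euc d → ℝ} {r : ℝ} (hr : 0 ≤ r)
    (hg : ContDiff ℝ (⊤ : ℕ∞) g) (hgc : HasCompactSupport g) (hρ : Continuous ρ)
    (hρc : HasCompactSupport ρ) (hρ0 : ∀ x, 0 ≤ ρ x) (hρ1 : ∫ x, ρ x = 1)
    (hρr : ∀ x, r < ‖x‖ → ρ x = 0) {L : ℝ} (hρL : ∀ a b, |ρ a - ρ b| ≤ L * ‖a - b‖) :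
    ∫ x, |g x - ∫ y, ρ (x - y) * g y| ≤ r * ∫ x, ‖gradient g x‖ := by
  have hρi : Integrable ρ := hρ.integrable_of_hasCompactSupport hρc
  have hfi : Integrable fun x => ‖gradient g x‖ := by
    simp only [norm_gradient_eq]
    exact ((hg.continuous_fderiv (by simp)).integrable_of_hasCompactSupport
      (hgc.fderiv ℝ)).norm
  have hρl : ∫⁻ x, ‖ρ x‖ₑ = 1 := by
    have : ∫⁻ x, ‖ρ x‖ₑ = ∫⁻ x, ENNReal.ofReal (ρ x) :=
      lintegral_congr fun x => by rw [Real.enorm_eq_ofReal (hρ0 x)]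
    rw [this, ← ofReal_integral_eq_lintegral_ofReal hρi (ae_of_all _ hρ0), hρ1,
      ENNReal.ofReal_one]
  have hpt : ∀ x, ‖g x - ∫ y, ρ (x - y) * g y‖ₑ ≤ ∫⁻ z, ‖ρ z‖ₑ * ‖g x - g (x - z)‖ₑ := by
    intro x
    have e1 : ∫ y, ρ (x - y) * g y = ∫ z, ρ z * g (x - z) := by
      have := integral_sub_left_eq_self (fun z => ρ z * g (x - z))
        (volume : Measure (Euc d)) x
      simpa using this
    have e2 : g x = ∫ z, ρ z * g x := by rw [integral_mul_const, hρ1, one_mul]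
    have i1 : Integrable fun z => ρ z * g x := hρi.mul_const _
    have i2 : Integrable fun z => ρ z * g (x - z) :=
      (hρ.mul (hg.continuous.comp (by fun_prop))).integrable_of_hasCompactSupport hρc.mul_right
    have e3 : g x - ∫ y, ρ (x - y) * g y = ∫ z, ρ z * (g x - g (x - z)) := by
      rw [e1]
      conv_lhs => rw [e2]
      rw [← integral_sub i1 i2]
      simp only [mul_sub]
    rw [e3]
    refine (enorm_integral_le_lintegral_enorm _).trans_eq (lintegral_congr fun z => ?_)
    rw [enorm_mul]
  have hm : Measurable (Function.uncurry fun (x z : Euc d) =>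
      ‖ρ z‖ₑ * ‖g x - g (x - z)‖ₑ) := by
    have := hg.continuous
    have h1 : Measurable fun z : Euc d × Euc d => ‖ρ z.2‖ₑ :=
      (hρ.comp continuous_snd).enorm.measurable
    have h2 : Measurable fun z : Euc d × Euc d => ‖g z.1 - g (z.1 - z.2)‖ₑ :=
      ((this.comp continuous_fst).sub
        (this.comp (continuous_fst.sub continuous_snd))).enorm.measurable
    exact h1.mul h2
  have hmain : ∫⁻ x, ‖g x - ∫ y, ρ (x - y) * g y‖ₑ ≤
      ENNReal.ofReal r * ∫⁻ x, ‖fderiv ℝ g x‖ₑ :=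
    calc ∫⁻ x, ‖g x - ∫ y, ρ (x - y) * g y‖ₑ
        ≤ ∫⁻ x, ∫⁻ z, ‖ρ z‖ₑ * ‖g x - g (x - z)‖ₑ := lintegral_mono hpt
      _ = ∫⁻ z, ∫⁻ x, ‖ρ z‖ₑ * ‖g x - g (x - z)‖ₑ := lintegral_lintegral_swap hm.aemeasurable
      _ ≤ ∫⁻ z, ‖ρ z‖ₑ * (ENNReal.ofReal r * ∫⁻ x, ‖fderiv ℝ g x‖ₑ) := by
          refine lintegral_mono fun z => ?_
          rw [lintegral_const_mul' _ _ enorm_ne_top]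
          by_cases hz : r < ‖z‖
          · simp [hρr z hz]
          · gcongr
            refine (lintegral_enorm_sub_translate_le hg z).trans ?_
            gcongr
            rw [← ofReal_norm]
            exact ENNReal.ofReal_le_ofReal (not_lt.1 hz)
      _ = _ := by rw [lintegral_mul_const _ hρ.enorm.measurable, hρl, one_mul]
  have hfin : ∫⁻ x, ‖fderiv ℝ g x‖ₑ = ENNReal.ofReal (∫ x, ‖gradient g x‖) := by
    rw [ofReal_integral_eq_lintegral_ofReal hfi (ae_of_all _ fun x => norm_nonneg _)]
    exact lintegral_congr fun x => by rw [norm_gradient_eq, ofReal_norm]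
  have h0 : 0 ≤ ∫ x, ‖gradient g x‖ := integral_nonneg fun x => norm_nonneg _
  rw [hfin, ← ENNReal.ofReal_mul hr] at hmain
  have hle := ENNReal.toReal_mono ENNReal.ofReal_ne_top hmain
  rw [ENNReal.toReal_ofReal (mul_nonneg hr h0)] at hle
  refine le_trans ?_ hle
  by_cases hmi : Integrable fun x => g x - ∫ y, ρ (x - y) * g y
  · exact (integral_norm_eq_lintegral_enorm hmi.1).le
  · have : ¬ Integrable fun x => |g x - ∫ y, ρ (x - y) * g y| := by
      intro h
      refine hmi ((integrable_norm_iff ?_).1 h)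
      refine (hg.continuous.sub ?_).aestronglyMeasurable
      exact continuous_mollify hρ hg.continuous hgc hρL
    rw [integral_undef this]
    exact ENNReal.toReal_nonneg

lemma tendsto_integral_abs_mollify_sub {g : ℕ → Euc d → ℝ} {ρ : Euc d → ℝ} {r C L : ℝ}
    {K : Set (Euc d)} (hK : IsCompact K)
    (hg : ∀ n, Continuous (g n)) (hgK : ∀ n x, x ∉ K → g n x = 0)
    (hgC : ∀ n, ∫ x, |g n x| ≤ C) (hρ : Continuous ρ)
    (hρc : HasCompactSupport ρ) (hρr : ∀ x, r < ‖x‖ → ρ x = 0)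
    (hL : 0 ≤ L) (hρL : ∀ a b, |ρ a - ρ b| ≤ L * ‖a - b‖)
    (hconv : ∀ l : ℕ, ∃ c, Tendsto (fun n => ∫ y, ρ (TopologicalSpace.denseSeq (Euc d) l - y) *
      g n y) atTop (𝓝 c)) :
    ∃ m : Euc d → ℝ, (∀ n, Integrable fun x => (∫ y, ρ (x - y) * g n y) - m x) ∧
      Integrable m ∧
      Tendsto (fun n => ∫ x, |(∫ y, ρ (x - y) * g n y) - m x|) atTop (𝓝 0) := by
  have hgc : ∀ n, HasCompactSupport (g n) := fun n => HasCompactSupport.intro hK (hgK n)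
  have hC0 : 0 ≤ C := (integral_nonneg fun x => abs_nonneg (g 0 x)).trans (hgC 0)
  obtain ⟨B, hB⟩ := hρc.exists_bound_of_continuous hρ
  have hB0 : 0 ≤ B := (norm_nonneg _).trans (hB 0)
  have hcau : ∀ x, ∃ c, Tendsto (fun n => ∫ y, ρ (x - y) * g n y) atTop (𝓝 c) := by
    intro x
    refine cauchySeq_tendsto_of_complete (Metric.cauchySeq_iff.2 fun ε hε => ?_)
    have hpos : 0 < ε / (3 * (L * C + 1)) := by positivity
    obtain ⟨_, hl, l, rfl⟩ :=
      Metric.dense_iff.1 (TopologicalSpace.denseRange_denseSeq (Euc d)) x _ hpos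
    set z := TopologicalSpace.denseSeq (Euc d) l
    obtain ⟨c, hc⟩ := hconv l
    obtain ⟨n0, hn0⟩ := Metric.cauchySeq_iff.1 hc.cauchySeq (ε / 3) (by positivity)
    have hnear : ∀ n, |(∫ y, ρ (x - y) * g n y) - ∫ y, ρ (z - y) * g n y| < ε / 3 := by
      intro n
      refine (abs_mollify_sub_le hρ (hg n) (hgc n) hρL x z).trans_lt ?_
      have h1 : ‖x - z‖ < ε / (3 * (L * C + 1)) := by
        rw [← dist_eq_norm, dist_comm]; exact hl
      calc L * ‖x - z‖ * ∫ y, |g n y| ≤ L * ‖x - z‖ * C := by gcongr; exact hgC n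
        _ = (L * C) * ‖x - z‖ := by ring
        _ ≤ (L * C) * (ε / (3 * (L * C + 1))) := by gcongr
        _ < (L * C + 1) * (ε / (3 * (L * C + 1))) := by gcongr; linarith
        _ = ε / 3 := by field_simp
    refine ⟨n0, fun n hn k hk => ?_⟩
    have h1 := abs_lt.1 (hnear n)
    have h2 := abs_lt.1 (hnear k)
    have h3 := hn0 n hn k hk
    rw [Real.dist_eq] at h3 ⊢
    have h3 := abs_lt.1 h3
    exact abs_lt.2 ⟨by linarith, by linarith⟩
  choose m hm using hcau
  have hbd : ∀ n x, |∫ y, ρ (x - y) * g n y| ≤ B * C := by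
    intro n x
    have hgi : Integrable fun y => |g n y| := ((hg n).integrable_of_hasCompactSupport (hgc n)).norm
    rw [← Real.norm_eq_abs]
    refine (norm_integral_le_of_norm_le (hgi.const_mul B) (ae_of_all _ fun y => ?_)).trans ?_
    · rw [norm_mul, Real.norm_eq_abs (g n y)]
      gcongr
      exact hB _
    · rw [integral_const_mul]
      gcongr
      exact hgC n
  have hK' : IsCompact (Metric.cthickening r K) := hK.cthickening
  have hoff : ∀ n x, x ∉ Metric.cthickening r K → ∫ y, ρ (x - y) * g n y = 0 := by
    intro n x hx
    refine integral_eq_zero_of_ae (ae_of_all _ fun y => ?_)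
    by_cases hy : y ∈ K
    · have : r < ‖x - y‖ := by
        by_contra h
        exact hx (Metric.mem_cthickening_of_dist_le x y r K hy (by rw [dist_eq_norm]; exact not_lt.1 h))
      simp [hρr _ this]
    · simp [hgK n y hy]
  have hmm : AEStronglyMeasurable m := aestronglyMeasurable_of_tendsto_ae atTop
    (fun n => (continuous_mollify hρ (hg n) (hgc n) hρL).aestronglyMeasurable) (ae_of_all _ hm)
  have hmeas : ∀ n, AEStronglyMeasurable (fun x => (∫ y, ρ (x - y) * g n y) - m x) := fun n =>
    (continuous_mollify hρ (hg n) (hgc n) hρL).aestronglyMeasurable.sub hmm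
  have hbm : ∀ x, |m x| ≤ B * C := fun x =>
    le_of_tendsto (hm x).abs (Eventually.of_forall fun n => hbd n x)
  have hoffm : ∀ x, x ∉ Metric.cthickening r K → m x = 0 := fun x hx =>
    tendsto_nhds_unique (hm x) (by simp [hoff _ x hx])
  set G : Euc d → ℝ := (Metric.cthickening r K).indicator fun _ => 2 * (B * C)
  have hG : Integrable G :=
    (integrable_indicator_iff hK'.isClosed.measurableSet).2 (integrableOn_const hK'.measure_lt_top.ne)
  have hle : ∀ n x, ‖(∫ y, ρ (x - y) * g n y) - m x‖ ≤ G x := by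
    intro n x
    by_cases hx : x ∈ Metric.cthickening r K
    · simp only [G, Set.indicator_of_mem hx]
      refine (norm_sub_le _ _).trans ?_
      rw [Real.norm_eq_abs, Real.norm_eq_abs]
      linarith [hbd n x, hbm x]
    · simp [G, Set.indicator_of_notMem hx, hoff n x hx, hoffm x hx]
  refine ⟨m, fun n => hG.mono' (hmeas n) (ae_of_all _ (hle n)),
    hG.mono' hmm (ae_of_all _ fun x => ?_), ?_⟩
  · by_cases hx : x ∈ Metric.cthickening r K
    · simp only [G, Set.indicator_of_mem hx]
      rw [Real.norm_eq_abs]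
      linarith [hbm x, mul_nonneg hB0 hC0]
    · simp [G, Set.indicator_of_notMem hx, hoffm x hx]
  have := tendsto_integral_of_dominated_convergence (μ := volume) (f := fun _ => (0:ℝ))
    (F := fun n x => |(∫ y, ρ (x - y) * g n y) - m x|) G (fun n => (hmeas n).norm) hG
    (fun n => ae_of_all _ fun x => by rw [norm_abs_eq_norm]; exact hle n x)
    (ae_of_all _ fun x => by simpa using ((hm x).sub_const (m x)).abs)
  simpa using this

lemma exists_mollifier {r : ℝ} (hr : 0 < r) :
    ∃ (ρ : Euc d → ℝ) (L : ℝ), Continuous ρ ∧ HasCompactSupport ρ ∧ (∀ x, 0 ≤ ρ x) ∧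
      ∫ x, ρ x = 1 ∧ (∀ x, r < ‖x‖ → ρ x = 0) ∧ 0 ≤ L ∧
      ∀ a b, |ρ a - ρ b| ≤ L * ‖a - b‖ := by
  let φ : ContDiffBump (0 : Euc d) := ⟨r / 2, r, by positivity, by linarith⟩
  have hd : ContDiff ℝ (⊤ : ℕ∞) (φ.normed volume) := φ.contDiff_normed
  have hc : HasCompactSupport (φ.normed volume) := φ.hasCompactSupport_normed
  obtain ⟨L, hL⟩ := hd.lipschitzWith_of_hasCompactSupport hc (by simp)
  refine ⟨φ.normed volume, L, hd.continuous, hc, φ.nonneg_normed, φ.integral_normed, ?_, L.2, ?_⟩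
  · intro x hx
    have : x ∉ Function.support (φ.normed volume) := by
      rw [φ.support_normed_eq]
      simp only [Metric.mem_ball, dist_zero_right, not_lt]
      exact hx.le
    simpa using this
  · intro a b
    have := hL.dist_le_mul a b
    rwa [Real.dist_eq, dist_eq_norm] at this

/-- Sequences of test functions bounded in `W^{1,1}_loc` are relatively compact in `L^1_loc`. -/
lemma exists_subseq_cauchy_integral_abs {U : Set (Euc d)} (hU : IsOpen U) {w : ℕ → Euc d → ℝ}
    (hw : ∀ n, IsTestFun U (w n))
    (hb : ∀ K, IsCompact K → K ⊆ U →
      ∃ C : ℝ, ∀ n, ∫ x in K, (|w n x| + ‖gradient (w n) x‖) ≤ C) :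
    ∃ σ : ℕ → ℕ, StrictMono σ ∧ ∀ K, IsCompact K → K ⊆ U → ∀ η > 0, ∃ n0, ∀ n ≥ n0, ∀ k ≥ n0,
      ∫ x in K, |w (σ n) x - w (σ k) x| ≤ η := by
  obtain ⟨K, hKc, hKU, -, hKex⟩ := exists_compact_exhaustion hU
  choose χ hχ hχ0 hχ1 hχK using fun i => exists_cutoff hU (hKc i) (hKU i)
  choose ρ L hρ hρc hρ0 hρ1 hρr hL hρL using
    fun j : ℕ => exists_mollifier (d := d) (r := 1 / ((j : ℝ) + 1)) (by positivity)
  set g : ℕ → ℕ → Euc d → ℝ := fun i n x => χ i x * w n x with hgdef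
  have hg : ∀ i n, IsTestFun U (g i n) := fun i n => (hχ i).mul_right (hw n).1
  have hgoff : ∀ i n x, x ∉ tsupport (χ i) → g i n x = 0 := fun i n x hx => by
    simp [hgdef, image_eq_zero_of_notMem_tsupport hx]
  have hggrad : ∀ i n x, gradient (g i n) x
      = χ i x • gradient (w n) x + w n x • gradient (χ i) x := fun i n x =>
    gradient_fun_mul (hχ i).differentiable (hw n).differentiable x
  have hgb : ∀ i, ∃ C, 0 ≤ C ∧ ∀ n, ∫ x, |g i n x| ≤ C ∧ ∫ x, ‖gradient (g i n) x‖ ≤ C := by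
    intro i
    obtain ⟨C, hC⟩ := hb (tsupport (χ i)) (hχ i).isCompact_tsupport (hχ i).2.2
    obtain ⟨D, hD0, hD⟩ := (hχ i).exists_gradient_bound
    have hint : ∀ n, IntegrableOn (fun x => |w n x| + ‖gradient (w n) x‖) (tsupport (χ i)) :=
      fun n => ((hw n).continuous.abs.add (hw n).continuous_gradient.norm).continuousOn.integrableOn_compact
        (hχ i).isCompact_tsupport
    have hC0 : 0 ≤ C := (integral_nonneg fun x => by positivity).trans (hC 0)
    have key : ∀ n, ∀ F : Euc d → ℝ, Continuous F → (∀ x, x ∉ tsupport (χ i) → F x = 0) →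
        (∀ x, F x ≤ (1 + D) * (|w n x| + ‖gradient (w n) x‖)) → ∫ x, F x ≤ (1 + D) * C := by
      intro n F hF h0 hle
      rw [← setIntegral_eq_integral_of_forall_compl_eq_zero h0]
      refine (setIntegral_mono (hF.continuousOn.integrableOn_compact (hχ i).isCompact_tsupport)
        ((hint n).const_mul (1 + D)) hle).trans ?_
      rw [integral_const_mul]
      gcongr
      exact hC n
    refine ⟨(1 + D) * C, by positivity, fun n => ⟨?_, ?_⟩⟩
    · refine key n _ (hg i n).continuous.abs (fun x hx => by simp [hgoff i n x hx]) fun x => ?_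
      simp only [hgdef, abs_mul, abs_of_nonneg (hχ0 i x)]
      have h1 := mul_le_mul_of_nonneg_right (hχ1 i x) (abs_nonneg (w n x))
      have h2 := mul_nonneg hD0 (abs_nonneg (w n x))
      have h3 := mul_nonneg (add_nonneg zero_le_one hD0) (norm_nonneg (gradient (w n) x))
      linarith
    · refine key n _ (hg i n).continuous_gradient.norm (fun x hx => ?_) fun x => ?_
      · rw [hggrad, image_eq_zero_of_notMem_tsupport hx, gradient_eq_zero_of_notMem_tsupport hx]
        simp
      · rw [hggrad]
        refine (norm_add_le _ _).trans ?_
        rw [norm_smul, norm_smul, Real.norm_eq_abs, Real.norm_eq_abs, abs_of_nonneg (hχ0 i x)]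
        have h1 := mul_le_mul_of_nonneg_right (hχ1 i x) (norm_nonneg (gradient (w n) x))
        have h2 := mul_le_mul_of_nonneg_left (hD x) (abs_nonneg (w n x))
        have h3 := mul_nonneg hD0 (norm_nonneg (gradient (w n) x))
        have h4 := abs_nonneg (w n x)
        linarith
  choose C hC0 hC using hgb
  have hbdd : ∀ t : ℕ × ℕ × ℕ, ∃ B : ℝ, ∀ n,
      |∫ y, ρ t.2.1 (TopologicalSpace.denseSeq (Euc d) t.2.2 - y) * g t.1 n y| ≤ B := by
    rintro ⟨i, j, l⟩
    obtain ⟨B, hB⟩ := (hρc j).exists_bound_of_continuous (hρ j)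
    have hB0 : 0 ≤ B := (norm_nonneg _).trans (hB 0)
    refine ⟨B * C i, fun n => ?_⟩
    have hgi : Integrable fun y => |g i n y| :=
      ((hg i n).continuous.integrable_of_hasCompactSupport (hg i n).2.1).norm
    rw [← Real.norm_eq_abs]
    refine (norm_integral_le_of_norm_le (hgi.const_mul B) (ae_of_all _ fun y => ?_)).trans ?_
    · rw [norm_mul, Real.norm_eq_abs (g i n y)]
      gcongr
      exact hB _
    · rw [integral_const_mul]
      gcongr
      exact (hC i n).1
  obtain ⟨σ, hσ, hlim⟩ := exists_subseq_tendsto_of_bounded _ hbdd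
  refine ⟨σ, hσ, fun A hA hAU η hη => ?_⟩
  obtain ⟨i, hi⟩ := hKex A hA hAU
  obtain ⟨j, hj⟩ : ∃ j : ℕ, 1 / ((j : ℝ) + 1) * C i ≤ η / 4 := by
    obtain ⟨j, hj⟩ := exists_nat_gt (C i / (η / 4))
    refine ⟨j, ?_⟩
    rw [div_lt_iff₀ (by positivity)] at hj
    rw [one_div, inv_mul_le_iff₀ (by positivity)]
    nlinarith
  obtain ⟨m, hmi, hmI, hm⟩ := tendsto_integral_abs_mollify_sub (hχ i).isCompact_tsupport
    (fun n => (hg i (σ n)).continuous) (fun n => hgoff i (σ n)) (fun n => (hC i (σ n)).1) (hρ j)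
    (hρc j) (hρr j) (hL j) (hρL j) (fun l => hlim (i, j, l))
  obtain ⟨n0, hn0⟩ := eventually_atTop.1 (hm.eventually (ge_mem_nhds (show (0:ℝ) < η / 4 by positivity)))
  have hclose : ∀ n ≥ n0, Integrable (fun x => g i (σ n) x - m x) ∧
      ∫ x, |g i (σ n) x - m x| ≤ η / 2 := by
    intro n hn
    have hgi := (hg i (σ n)).continuous.integrable_of_hasCompactSupport (hg i (σ n)).2.1 (μ := volume)
    have hmol := integral_abs_sub_mollify_le (by positivity) (hg i (σ n)).1 (hg i (σ n)).2.1 (hρ j)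
      (hρc j) (hρ0 j) (hρ1 j) (hρr j) (hρL j)
    have hmint : Integrable fun x => g i (σ n) x - ∫ y, ρ j (x - y) * g i (σ n) y := by
      refine ((hgi.sub hmI).sub (hmi n)).congr (ae_of_all _ fun x => ?_)
      simp
    refine ⟨?_, ?_⟩
    · exact (hgi.sub hmI)
    · calc ∫ x, |g i (σ n) x - m x| ≤ ∫ x, (|g i (σ n) x - ∫ y, ρ j (x - y) * g i (σ n) y| +
            |(∫ y, ρ j (x - y) * g i (σ n) y) - m x|) := by
            refine integral_mono_of_nonneg (ae_of_all _ fun x => abs_nonneg _)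
              (hmint.norm.add (hmi n).norm) (ae_of_all _ fun x => abs_sub_le _ _ _)
        _ = _ := integral_add hmint.norm (hmi n).norm
        _ ≤ η / 4 + η / 4 := by
            refine add_le_add (hmol.trans (le_trans ?_ hj)) (hn0 n hn)
            gcongr
            exact (hC i (σ n)).2
        _ = η / 2 := by ring
  refine ⟨n0, fun n hn k hk => ?_⟩
  obtain ⟨i1, h1⟩ := hclose n hn
  obtain ⟨i2, h2⟩ := hclose k hk
  have hAe : ∫ x in A, |w (σ n) x - w (σ k) x| = ∫ x in A, |g i (σ n) x - g i (σ k) x| :=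
    setIntegral_congr_fun hA.isClosed.measurableSet fun x hx => by simp [hgdef, hχK i x (hi hx)]
  have hi12 : Integrable fun x => |g i (σ n) x - g i (σ k) x| := by
    simpa using (i1.sub i2).norm
  rw [hAe]
  calc ∫ x in A, |g i (σ n) x - g i (σ k) x| ≤ ∫ x, |g i (σ n) x - g i (σ k) x| :=
        setIntegral_le_integral hi12 (ae_of_all _ fun x => abs_nonneg _)
    _ ≤ ∫ x, (|g i (σ n) x - m x| + |g i (σ k) x - m x|) := by
        refine integral_mono hi12 (i1.norm.add i2.norm) fun x => ?_
        have := abs_sub_le (g i (σ n) x) (m x) (g i (σ k) x)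
        rwa [abs_sub_comm (m x)] at this
    _ = _ := integral_add i1.norm i2.norm
    _ ≤ η := by linarith

end Rellich

/-! ### The energy functional and its sublevel sets -/

/-- The standing hypotheses on the exponents, the potential, the weight and the functional. -/
structure VariationalSetting {N : ℕ} (p q r : ℝ) (Ω : Set (Euc N)) (V W : Euc N → ℝ)
    (f : (Euc N → ℝ) → ℝ) : Prop where
  one_lt_p : 1 < p
  isOpen : IsOpen Ω
  potential_nonneg : ∀ x ∈ Ω, 0 ≤ V x
  form_pos : ∀ u : Euc N → ℝ, IsTestFun Ω u → u ≠ 0 → 0 < QV p Ω V u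
  one_lt_q : 1 < q
  q_le_p : q ≤ p
  p_sub_one_lt_q : p - 1 < q
  weight_continuousOn : ContinuousOn W Ω
  weight_pos : ∀ x ∈ Ω, 0 < W x
  form_ge : ∀ u : Euc N → ℝ, IsTestFun Ω u →
    (∫ x in Ω, (‖gradient u x‖ ^ q + |u x| ^ q) * W x) ^ (p / q) ≤ QV p Ω V u
  exponent_eq : 1 / r + (p - 1) * (p - q) / q = 1
  potential_rpow : ∀ K : Set (Euc N), IsCompact K → K ⊆ Ω → IntegrableOn (fun x => V x ^ r) K
  hardy : ∃ C : ℝ, 0 < C ∧ ∀ u : Euc N → ℝ, IsTestFun Ω u →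
    (∫ x in Ω, V x ^ (q / p) * |u x| ^ q) ≤ C * ∫ x in Ω, ‖gradient u x‖ ^ q
  linear : ∀ (a b : ℝ) (ζ η : Euc N → ℝ), IsTestFun Ω ζ → IsTestFun Ω η →
    f (fun x => a * ζ x + b * η x) = a * f ζ + b * f η
  bounded : ∃ C : ℝ, ∀ u : Euc N → ℝ, IsTestFun Ω u → QV p Ω V u = 1 → f u ≤ C

/-- The energy whose critical points solve the equation. -/
def energy {N : ℕ} (p : ℝ) (Ω : Set (Euc N)) (V : Euc N → ℝ) (f : (Euc N → ℝ) → ℝ)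
    (w : Euc N → ℝ) : ℝ :=
  QV p Ω V w / p - f w

lemma le_one_add_rpow {t a : ℝ} (ht : 0 ≤ t) (ha : 1 ≤ a) : t ≤ 1 + t ^ a := by
  rcases le_total t 1 with h | h
  · linarith [rpow_nonneg ht a]
  · linarith [self_le_rpow_of_one_le h ha]

namespace VariationalSetting

variable {N : ℕ} {p q r : ℝ} {Ω : Set (Euc N)} {V W : Euc N → ℝ} {f : (Euc N → ℝ) → ℝ}

lemma p_pos (S : VariationalSetting p q r Ω V W f) : 0 < p := one_pos.trans S.one_lt_p

lemma q_pos (S : VariationalSetting p q r Ω V W f) : 0 < q := one_pos.trans S.one_lt_q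

lemma one_div_r (S : VariationalSetting p q r Ω V W f) : 1 / r = p * (q - p + 1) / q := by
  have h := S.exponent_eq
  have hq := S.q_pos.ne'
  have h2 : 1 / r = 1 - (p - 1) * (p - q) / q := by linarith
  rw [h2]
  field_simp
  ring

lemma r_pos (S : VariationalSetting p q r Ω V W f) : 0 < r := by
  have h : 0 < 1 / r := by
    rw [S.one_div_r]
    exact div_pos (mul_pos S.p_pos (by linarith [S.p_sub_one_lt_q])) S.q_pos
  exact one_div_pos.1 h

lemma one_le_r (S : VariationalSetting p q r Ω V W f) : 1 ≤ r := by
  have h : 1 / r ≤ 1 := by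
    have h1 := S.exponent_eq
    have : 0 ≤ (p - 1) * (p - q) / q :=
      div_nonneg (mul_nonneg (by linarith [S.one_lt_p]) (by linarith [S.q_le_p])) S.q_pos.le
    linarith
  rwa [div_le_one S.r_pos] at h

lemma dual_exponent (S : VariationalSetting p q r Ω V W f) :
    1 / p * (q / (q - (p - 1))) = r := by
  have h := S.one_div_r
  have h1 := S.r_pos.ne'
  have h2 := S.p_pos.ne'
  have h3 := S.q_pos.ne'
  have h4 : q - (p - 1) ≠ 0 := by linarith [S.p_sub_one_lt_q]
  have h5 : q - p + 1 ≠ 0 := by linarith [S.p_sub_one_lt_q]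
  field_simp at h ⊢
  linarith

lemma integrableOn_potential_rpow (S : VariationalSetting p q r Ω V W f) {K : Set (Euc N)}
    (hK : IsCompact K) (hKΩ : K ⊆ Ω) {a : ℝ} (ha : 0 < a) (har : a ≤ r) :
    IntegrableOn (fun x => V x ^ a) K := by
  have hr := S.potential_rpow K hK hKΩ
  have hm : AEStronglyMeasurable (fun x => V x ^ a) (volume.restrict K) := by
    have h1 : AEStronglyMeasurable (fun x => (V x ^ r) ^ (a / r)) (volume.restrict K) :=
      (hr.1.aemeasurable.pow_const (a / r)).aestronglyMeasurable
    refine h1.congr ?_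
    filter_upwards [ae_restrict_mem hK.isClosed.measurableSet] with x hx
    rw [← rpow_mul (S.potential_nonneg x (hKΩ hx)), mul_div_cancel₀ _ S.r_pos.ne']
  have hone : IntegrableOn (fun _ : Euc N => (1 : ℝ)) K := integrableOn_const hK.measure_lt_top.ne
  refine (hone.add hr).mono' hm ?_
  filter_upwards [ae_restrict_mem hK.isClosed.measurableSet] with x hx
  have hV := S.potential_nonneg x (hKΩ hx)
  rw [Real.norm_of_nonneg (rpow_nonneg hV a)]
  have h := le_one_add_rpow (rpow_nonneg hV a) ((one_le_div ha).2 har)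
  rwa [← rpow_mul hV, mul_div_cancel₀ _ ha.ne'] at h

lemma integrableOn_potential (S : VariationalSetting p q r Ω V W f) {K : Set (Euc N)}
    (hK : IsCompact K) (hKΩ : K ⊆ Ω) : IntegrableOn V K := by
  simpa using S.integrableOn_potential_rpow hK hKΩ one_pos S.one_le_r

lemma integrableOn_potential_rpow_mul (S : VariationalSetting p q r Ω V W f) {K : Set (Euc N)}
    (hK : IsCompact K) (hKΩ : K ⊆ Ω) {a : ℝ} (ha : 0 < a) (har : a ≤ r) {F : Euc N → ℝ}
    (hF : ContinuousOn F K) : IntegrableOn (fun x => V x ^ a * F x) K :=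
  (S.integrableOn_potential_rpow hK hKΩ ha har).mul_continuousOn hF hK

lemma integrableOn_potential_mul (S : VariationalSetting p q r Ω V W f) {K : Set (Euc N)}
    (hK : IsCompact K) (hKΩ : K ⊆ Ω) {F : Euc N → ℝ}
    (hF : ContinuousOn F K) : IntegrableOn (fun x => V x * F x) K :=
  (S.integrableOn_potential hK hKΩ).mul_continuousOn hF hK

end VariationalSetting

section TestIntegrability

variable {d : ℕ} {U : Set (Euc d)} {u w : Euc d → ℝ}

lemma IsTestFun.continuous_abs_rpow (hu : IsTestFun U u) {a : ℝ} (ha : 0 ≤ a) :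
    Continuous fun x => |u x| ^ a :=
  hu.continuous.abs.rpow_const fun _ => Or.inr ha

lemma IsTestFun.continuous_gradient_rpow (hu : IsTestFun U u) {a : ℝ} (ha : 0 ≤ a) :
    Continuous fun x => ‖gradient u x‖ ^ a :=
  hu.continuous_gradient.norm.rpow_const fun _ => Or.inr ha

lemma IsTestFun.integrableOn_of_continuousOn (hu : IsTestFun U u) (hU : IsOpen U)
    {E : Type*} [NormedAddCommGroup E]
    {F : Euc d → E} (hF : ContinuousOn F U) (h0 : ∀ x, x ∉ tsupport u → F x = 0) :
    IntegrableOn F U :=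
  integrableOn_of_eq_zero_off hU
    ((hF.mono hu.2.2).integrableOn_compact hu.isCompact_tsupport) h0

lemma IsTestFun.integrableOn_gradient_rpow (hu : IsTestFun U u) (hU : IsOpen U) {a : ℝ}
    (ha : 0 < a) : IntegrableOn (fun x => ‖gradient u x‖ ^ a) U :=
  hu.integrableOn_of_continuousOn hU (hu.continuous_gradient_rpow ha.le).continuousOn fun x hx => by
    simp [gradient_eq_zero_of_notMem_tsupport hx, ha.ne']

lemma IsTestFun.integrableOn_abs_add_gradient (hu : IsTestFun U u) (hU : IsOpen U) :
    IntegrableOn (fun x => |u x| + ‖gradient u x‖) U :=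
  hu.integrableOn_of_continuousOn hU
    (hu.continuous.abs.add hu.continuous_gradient.norm).continuousOn fun x hx => by
    simp [gradient_eq_zero_of_notMem_tsupport hx, image_eq_zero_of_notMem_tsupport hx]

end TestIntegrability

namespace VariationalSetting

variable {N : ℕ} {p q r : ℝ} {Ω : Set (Euc N)} {V W : Euc N → ℝ} {f : (Euc N → ℝ) → ℝ}
  {w : Euc N → ℝ}

lemma integrableOn_weighted (S : VariationalSetting p q r Ω V W f) (hw : IsTestFun Ω w) :
    IntegrableOn (fun x => (‖gradient w x‖ ^ q + |w x| ^ q) * W x) Ω :=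
  hw.integrableOn_of_continuousOn S.isOpen
    (((hw.continuous_gradient_rpow S.q_pos.le).add
      (hw.continuous_abs_rpow S.q_pos.le)).continuousOn.mul S.weight_continuousOn) fun x hx => by
    simp [gradient_eq_zero_of_notMem_tsupport hx, image_eq_zero_of_notMem_tsupport hx,
      S.q_pos.ne']

lemma integrableOn_potential_mul_rpow (S : VariationalSetting p q r Ω V W f)
    (hw : IsTestFun Ω w) : IntegrableOn (fun x => V x * |w x| ^ p) Ω :=
  integrableOn_of_eq_zero_off S.isOpen (S.integrableOn_potential_mul hw.isCompact_tsupport hw.2.2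
    (hw.continuous_abs_rpow S.p_pos.le).continuousOn) fun x hx => by
    simp [image_eq_zero_of_notMem_tsupport hx, S.p_pos.ne']

lemma form_const_mul (hw : IsTestFun Ω w) {t : ℝ}
    (ht : 0 ≤ t) : QV p Ω V (fun x => t * w x) = t ^ p * QV p Ω V w := by
  have h1 : ∀ x, ‖gradient (fun x => t * w x) x‖ ^ p = t ^ p * ‖gradient w x‖ ^ p := fun x => by
    rw [gradient_fun_const_mul hw.differentiable, norm_smul, Real.norm_of_nonneg ht,
      mul_rpow ht (norm_nonneg _)]
  have h2 : ∀ x, V x * |t * w x| ^ p = t ^ p * (V x * |w x| ^ p) := fun x => by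
    rw [abs_mul, abs_of_nonneg ht, mul_rpow ht (abs_nonneg _)]
    ring
  simp only [QV, h1, h2, integral_const_mul, mul_sub]

lemma form_nonneg (S : VariationalSetting p q r Ω V W f) (hw : IsTestFun Ω w) :
    0 ≤ QV p Ω V w := by
  by_cases h : w = 0
  · subst h
    have := form_const_mul (p := p) (V := V) (Ω := Ω) (w := fun _ => 0) isTestFun_zero (le_refl (0 : ℝ))
    simp only [mul_zero, zero_rpow S.p_pos.ne', zero_mul] at this
    exact this.ge
  · exact (S.form_pos w hw h).le

lemma map_const_mul (S : VariationalSetting p q r Ω V W f) (hw : IsTestFun Ω w) (t : ℝ) :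
    f (fun x => t * w x) = t * f w := by
  simpa using S.linear t 0 w w hw hw

lemma exists_map_le_form_rpow (S : VariationalSetting p q r Ω V W f) :
    ∃ C : ℝ, 0 ≤ C ∧ ∀ w, IsTestFun Ω w → f w ≤ C * QV p Ω V w ^ (1 / p) := by
  obtain ⟨C, hC⟩ := S.bounded
  refine ⟨max C 0, le_max_right _ _, fun w hw => ?_⟩
  by_cases h : w = 0
  · have h0 : f w = 0 := by
      have := S.map_const_mul hw 0
      rw [h] at this ⊢
      simpa [← Pi.zero_def] using this
    rw [h0]
    exact mul_nonneg (le_max_right _ _) (rpow_nonneg (S.form_nonneg hw) _)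
  · have hQ := S.form_pos w hw h
    set s := QV p Ω V w ^ (1 / p) with hs
    have hs0 : 0 < s := rpow_pos_of_pos hQ _
    have hsp : s ^ p = QV p Ω V w := by
      rw [hs, ← rpow_mul hQ.le, one_div_mul_cancel S.p_pos.ne', rpow_one]
    have h1 : QV p Ω V (fun x => s⁻¹ * w x) = 1 := by
      rw [form_const_mul hw (inv_nonneg.2 hs0.le), inv_rpow hs0.le, hsp, inv_mul_cancel₀ hQ.ne']
    have h2 := hC _ (hw.const_mul s⁻¹) h1
    rw [S.map_const_mul hw, inv_mul_le_iff₀ hs0] at h2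
    refine h2.trans ?_
    rw [mul_comm]
    gcongr
    exact le_max_left _ _

lemma exists_form_le_energy (S : VariationalSetting p q r Ω V W f) :
    ∃ C : ℝ, 0 ≤ C ∧ ∀ w, IsTestFun Ω w → QV p Ω V w ≤ 2 * p * (energy p Ω V f w + C) := by
  obtain ⟨A, hA0, hA⟩ := S.exists_map_le_form_rpow
  have hp := S.p_pos
  obtain ⟨C, hC0, hC⟩ := exists_rpow_le_mul_rpow_add (α := 1) (β := p)
    (κ := 1 / (2 * p * (A + 1))) one_pos S.one_lt_p (by positivity)
  refine ⟨A * C, by positivity, fun w hw => ?_⟩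
  have hQ := S.form_nonneg hw
  have h1 := hA w hw
  have h2 := hC _ (rpow_nonneg hQ (1 / p))
  rw [rpow_one, ← rpow_mul hQ, one_div_mul_cancel hp.ne', rpow_one] at h2
  have h3 : A * QV p Ω V w ^ (1 / p) ≤ QV p Ω V w / (2 * p) + A * C := by
    calc A * QV p Ω V w ^ (1 / p) ≤ A * (1 / (2 * p * (A + 1)) * QV p Ω V w + C) := by gcongr
      _ = A / (A + 1) * (QV p Ω V w / (2 * p)) + A * C := by field_simp
      _ ≤ 1 * (QV p Ω V w / (2 * p)) + A * C := by
          gcongr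
          rw [div_le_one (by positivity)]
          linarith
      _ = _ := by ring
  have h4 : QV p Ω V w / p = 2 * (QV p Ω V w / (2 * p)) := by field_simp
  have h5 : QV p Ω V w / (2 * p) ≤ energy p Ω V f w + A * C := by
    rw [energy, h4]; linarith
  rwa [div_le_iff₀ (by positivity), mul_comm] at h5

lemma energy_bddBelow (S : VariationalSetting p q r Ω V W f) :
    ∃ C : ℝ, ∀ w, IsTestFun Ω w → C ≤ energy p Ω V f w := by
  obtain ⟨C, -, hC⟩ := S.exists_form_le_energy
  refine ⟨-C, fun w hw => ?_⟩
  have h := (S.form_nonneg hw).trans (hC w hw)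
  have hp := S.p_pos
  have := nonneg_of_mul_nonneg_right h (by positivity)
  linarith

lemma exists_weighted_bound_of_energy_le (S : VariationalSetting p q r Ω V W f) (c : ℝ) :
    ∃ M : ℝ, 0 ≤ M ∧ ∀ w, IsTestFun Ω w → energy p Ω V f w ≤ c →
      ∫ x in Ω, (‖gradient w x‖ ^ q + |w x| ^ q) * W x ≤ M := by
  obtain ⟨C, hC0, hC⟩ := S.exists_form_le_energy
  have hp := S.p_pos
  have hq := S.q_pos
  refine ⟨|2 * p * (c + C)| ^ (q / p), by positivity, fun w hw hc => ?_⟩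
  have h0 : 0 ≤ ∫ x in Ω, (‖gradient w x‖ ^ q + |w x| ^ q) * W x :=
    setIntegral_nonneg S.isOpen.measurableSet fun x hx =>
      mul_nonneg (by positivity) (S.weight_pos x hx).le
  have h1 : (∫ x in Ω, (‖gradient w x‖ ^ q + |w x| ^ q) * W x) ^ (p / q)
      ≤ |2 * p * (c + C)| :=
    (S.form_ge w hw).trans (((hC w hw).trans (by gcongr)).trans (le_abs_self _))
  have h2 := rpow_le_rpow (by positivity) h1 (div_nonneg hq.le hp.le)
  rwa [← rpow_mul h0, div_mul_div_cancel₀ hq.ne', div_self hp.ne', rpow_one] at h2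

/-- Local bounds for test functions whose weighted norm is bounded. -/
lemma exists_local_bound (S : VariationalSetting p q r Ω V W f) (M : ℝ) {K : Set (Euc N)}
    (hK : IsCompact K) (hKΩ : K ⊆ Ω) :
    ∃ C : ℝ, 0 ≤ C ∧ ∀ w, IsTestFun Ω w →
      ∫ x in Ω, (‖gradient w x‖ ^ q + |w x| ^ q) * W x ≤ M →
      ∫ x in K, (‖gradient w x‖ ^ q + |w x| ^ q) ≤ C := by
  have hq := S.q_pos
  obtain ⟨B, hB⟩ := hK.exists_bound_of_continuousOn (f := fun x => (W x)⁻¹)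
    ((S.weight_continuousOn.mono hKΩ).inv₀ fun x hx => (S.weight_pos x (hKΩ hx)).ne')
  refine ⟨max B 0 * max M 0, by positivity, fun w hw hM => ?_⟩
  have hi := S.integrableOn_weighted hw
  have hc := ((hw.continuous_gradient_rpow hq.le).add (hw.continuous_abs_rpow hq.le))
  calc ∫ x in K, (‖gradient w x‖ ^ q + |w x| ^ q)
      ≤ ∫ x in K, max B 0 * ((‖gradient w x‖ ^ q + |w x| ^ q) * W x) := by
        refine setIntegral_mono_on (hc.continuousOn.integrableOn_compact hK)
          ((hi.mono_set hKΩ).const_mul _) hK.isClosed.measurableSet fun x hx => ?_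
        have hW := S.weight_pos x (hKΩ hx)
        have h1 : (W x)⁻¹ ≤ max B 0 :=
          ((le_abs_self _).trans (hB x hx)).trans (le_max_left _ _)
        have h2 : 1 ≤ max B 0 * W x := by
          rwa [inv_le_iff_one_le_mul₀ hW] at h1
        have h3 : 0 ≤ ‖gradient w x‖ ^ q + |w x| ^ q := by positivity
        nlinarith
    _ = max B 0 * ∫ x in K, (‖gradient w x‖ ^ q + |w x| ^ q) * W x := integral_const_mul _ _
    _ ≤ max B 0 * max M 0 := by
        gcongr
        refine ((setIntegral_mono_set hi ?_ hKΩ.eventuallyLE).trans hM).trans (le_max_left _ _)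
        filter_upwards [ae_restrict_mem S.isOpen.measurableSet] with x hx
        exact mul_nonneg (by positivity) (S.weight_pos x hx).le

lemma exists_local_hardy_bound (S : VariationalSetting p q r Ω V W f) (M : ℝ) {K : Set (Euc N)}
    (hK : IsCompact K) (hKΩ : K ⊆ Ω) :
    ∃ C : ℝ, 0 ≤ C ∧ ∀ w, IsTestFun Ω w →
      ∫ x in Ω, (‖gradient w x‖ ^ q + |w x| ^ q) * W x ≤ M →
      ∫ x in K, (V x ^ (1 / p) * |w x|) ^ q ≤ C := by
  have hq := S.q_pos
  have hp := S.p_pos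
  obtain ⟨χ, hχ, hχ0, hχ1, hχK⟩ := exists_cutoff S.isOpen hK hKΩ
  obtain ⟨D, hD0, hD⟩ := hχ.exists_gradient_bound
  obtain ⟨A, hA0, hA⟩ := S.hardy
  obtain ⟨C, hC0, hC⟩ := S.exists_local_bound M hχ.isCompact_tsupport hχ.2.2
  refine ⟨A * (2 ^ q * (1 + D ^ q) * C), by positivity, fun w hw hM => ?_⟩
  have hg := hχ.mul_right hw.1
  have hqr : q / p ≤ r := ((div_le_one hp).2 S.q_le_p).trans S.one_le_r
  have hle : ∀ x, ‖gradient (fun x => χ x * w x) x‖ ^ q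
      ≤ 2 ^ q * (1 + D ^ q) * (‖gradient w x‖ ^ q + |w x| ^ q) := by
    intro x
    rw [gradient_fun_mul hχ.differentiable hw.differentiable]
    refine (norm_add_rpow_le hq _ _).trans ?_
    rw [norm_smul, norm_smul, Real.norm_eq_abs, Real.norm_eq_abs, abs_of_nonneg (hχ0 x), mul_assoc]
    gcongr
    have h1 : (χ x * ‖gradient w x‖) ^ q ≤ ‖gradient w x‖ ^ q :=
      rpow_le_rpow (mul_nonneg (hχ0 x) (norm_nonneg _))
        (mul_le_of_le_one_left (norm_nonneg _) (hχ1 x)) hq.le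
    have h2 : (|w x| * ‖gradient χ x‖) ^ q ≤ D ^ q * |w x| ^ q := by
      rw [mul_rpow (abs_nonneg _) (norm_nonneg _), mul_comm]
      gcongr
      exact hD x
    have h3 : 0 ≤ D ^ q * ‖gradient w x‖ ^ q := by positivity
    have h4 : 0 ≤ |w x| ^ q := by positivity
    linarith
  have hgi : IntegrableOn (fun x => V x ^ (q / p) * |χ x * w x| ^ q) Ω :=
    integrableOn_of_eq_zero_off S.isOpen (S.integrableOn_potential_rpow_mul
      hχ.isCompact_tsupport hχ.2.2 (div_pos hq hp) hqr
      (hg.continuous_abs_rpow hq.le).continuousOn) fun x hx => by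
        simp [image_eq_zero_of_notMem_tsupport hx, hq.ne']
  calc ∫ x in K, (V x ^ (1 / p) * |w x|) ^ q
      = ∫ x in K, V x ^ (q / p) * |χ x * w x| ^ q := by
        refine setIntegral_congr_fun hK.isClosed.measurableSet fun x hx => ?_
        have hV := S.potential_nonneg x (hKΩ hx)
        rw [hχK x hx, one_mul, mul_rpow (rpow_nonneg hV _) (abs_nonneg _), ← rpow_mul hV,
          one_div_mul_eq_div]
    _ ≤ ∫ x in Ω, V x ^ (q / p) * |χ x * w x| ^ q := by
        refine setIntegral_mono_set hgi ?_ hKΩ.eventuallyLE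
        filter_upwards [ae_restrict_mem S.isOpen.measurableSet] with x hx
        exact mul_nonneg (rpow_nonneg (S.potential_nonneg x hx) _) (by positivity)
    _ ≤ A * ∫ x in Ω, ‖gradient (fun x => χ x * w x) x‖ ^ q := hA _ hg
    _ = A * ∫ x in tsupport χ, ‖gradient (fun x => χ x * w x) x‖ ^ q := by
        rw [setIntegral_eq_of_eq_zero_off S.isOpen hχ.2.2 fun x hx => ?_]
        rw [gradient_fun_mul hχ.differentiable hw.differentiable,
          image_eq_zero_of_notMem_tsupport hx, gradient_eq_zero_of_notMem_tsupport hx]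
        simp [hq.ne']
    _ ≤ A * ∫ x in tsupport χ, 2 ^ q * (1 + D ^ q) * (‖gradient w x‖ ^ q + |w x| ^ q) := by
        gcongr
        · exact (hg.continuous_gradient_rpow hq.le).continuousOn.integrableOn_compact
            hχ.isCompact_tsupport
        · exact (((hw.continuous_gradient_rpow hq.le).add
            (hw.continuous_abs_rpow hq.le)).continuousOn.integrableOn_compact
            hχ.isCompact_tsupport).const_mul _
        · exact hχ.isCompact_tsupport.isClosed.measurableSet.nullMeasurableSet
        · exact hle _
    _ ≤ A * (2 ^ q * (1 + D ^ q) * C) := by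
        rw [integral_const_mul]
        gcongr
        exact hC w hw hM

lemma exists_local_potential_bound (S : VariationalSetting p q r Ω V W f) (M : ℝ)
    {K : Set (Euc N)} (hK : IsCompact K) (hKΩ : K ⊆ Ω) :
    ∃ C : ℝ, 0 ≤ C ∧ ∀ w, IsTestFun Ω w →
      ∫ x in Ω, (‖gradient w x‖ ^ q + |w x| ^ q) * W x ≤ M →
      ∫ x in K, V x * |w x| ^ (p - 1) ≤ C := by
  have hq := S.q_pos
  have hp := S.p_pos
  have hp1 : 0 < p - 1 := by linarith [S.one_lt_p]
  obtain ⟨A, hA0, hA⟩ := S.exists_local_hardy_bound M hK hKΩ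
  obtain ⟨C, hC0, hC⟩ := exists_rpow_mul_le_young hp1 S.p_sub_one_lt_q one_pos
  have hVr := S.potential_rpow K hK hKΩ
  have hI0 : 0 ≤ ∫ x in K, V x ^ r := setIntegral_nonneg hK.isClosed.measurableSet fun x hx =>
    rpow_nonneg (S.potential_nonneg x (hKΩ hx)) r
  refine ⟨A + C * ∫ x in K, V x ^ r, by positivity, fun w hw hM => ?_⟩
  have hqr : q / p ≤ r := ((div_le_one hp).2 S.q_le_p).trans S.one_le_r
  have hi : IntegrableOn (fun x => (V x ^ (1 / p) * |w x|) ^ q) K := by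
    refine (S.integrableOn_potential_rpow_mul hK hKΩ (div_pos hq hp) hqr
      (hw.continuous_abs_rpow hq.le).continuousOn).congr_fun (fun x hx => ?_)
      hK.isClosed.measurableSet
    have hV := S.potential_nonneg x (hKΩ hx)
    simp only
    rw [mul_rpow (rpow_nonneg hV _) (abs_nonneg _), ← rpow_mul hV, one_div_mul_eq_div]
  calc ∫ x in K, V x * |w x| ^ (p - 1)
      ≤ ∫ x in K, ((V x ^ (1 / p) * |w x|) ^ q + C * V x ^ r) := by
        refine setIntegral_mono_on (S.integrableOn_potential_mul hK hKΩ
          (hw.continuous_abs_rpow hp1.le).continuousOn) (hi.add (hVr.const_mul C))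
          hK.isClosed.measurableSet fun x hx => ?_
        have hV := S.potential_nonneg x (hKΩ hx)
        have h := hC (V x ^ (1 / p) * |w x|) (V x ^ (1 / p))
          (mul_nonneg (rpow_nonneg hV _) (abs_nonneg _)) (rpow_nonneg hV _)
        rw [one_mul, ← rpow_mul hV _ (q / _), S.dual_exponent] at h
        refine le_trans (le_of_eq ?_) h
        rw [mul_rpow (rpow_nonneg hV _) (abs_nonneg _), mul_right_comm,
          rpow_sub_one_mul S.one_lt_p (rpow_nonneg hV _), ← rpow_mul hV,
          one_div_mul_cancel hp.ne', rpow_one]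
    _ = (∫ x in K, (V x ^ (1 / p) * |w x|) ^ q) + C * ∫ x in K, V x ^ r := by
        rw [integral_add hi (hVr.const_mul C), integral_const_mul]
    _ ≤ _ := by
        gcongr
        exact hA w hw hM

lemma exists_local_rpow_bound (S : VariationalSetting p q r Ω V W f) (M : ℝ)
    {K : Set (Euc N)} (hK : IsCompact K) (hKΩ : K ⊆ Ω) {a : ℝ} (ha : 0 < a) (haq : a < q) :
    ∃ C : ℝ, 0 ≤ C ∧ ∀ w, IsTestFun Ω w →
      ∫ x in Ω, (‖gradient w x‖ ^ q + |w x| ^ q) * W x ≤ M →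
      ∫ x in K, (‖gradient w x‖ ^ a + |w x| ^ a) ≤ C := by
  have hq := S.q_pos
  obtain ⟨A, hA0, hA⟩ := S.exists_local_bound M hK hKΩ
  obtain ⟨C, hC0, hC⟩ := exists_rpow_le_mul_rpow_add ha haq one_pos
  have hone : IntegrableOn (fun _ : Euc N => 2 * C) K := integrableOn_const hK.measure_lt_top.ne
  refine ⟨A + ∫ _ in K, 2 * C, add_nonneg hA0 (integral_nonneg fun _ => by positivity),
    fun w hw hM => ?_⟩
  have hc : ∀ b : ℝ, 0 < b → IntegrableOn (fun x => ‖gradient w x‖ ^ b + |w x| ^ b) K := fun b hb =>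
    ((hw.continuous_gradient_rpow (a := b) hb.le).add
      (hw.continuous_abs_rpow (a := b) hb.le)).continuousOn.integrableOn_compact hK
  calc ∫ x in K, (‖gradient w x‖ ^ a + |w x| ^ a)
      ≤ ∫ x in K, ((‖gradient w x‖ ^ q + |w x| ^ q) + 2 * C) := by
        refine setIntegral_mono (hc a ha) ((hc q hq).add hone) fun x => ?_
        have h1 := hC _ (norm_nonneg (gradient w x))
        have h2 := hC _ (abs_nonneg (w x))
        simp only
        linarith
    _ = _ := integral_add (hc q hq) hone
    _ ≤ _ := by
        gcongr
        exact hA w hw hM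

end VariationalSetting

/-! ### Almost critical points -/

/-- A weak form of the variational principle: minimize almost, then compare. -/
lemma exists_almost_minimizer {X : Type*} {P : X → Prop} {J : X → ℝ} {c : ℝ}
    (hc : ∀ z, P z → c ≤ J z) {D : X → X → ℝ} (hD0 : ∀ z w, P z → P w → 0 ≤ D z w)
    (hD : ∀ x y z, P x → P y → P z → D x z ≤ D x y + D y z) {w₀ : X} (hw₀ : P w₀)
    (hself : D w₀ w₀ = 0) {η : ℝ} (hη : 0 < η) :
    ∃ w, P w ∧ J w + D w w₀ ≤ J w₀ ∧ ∀ z, P z → J w - D z w - η ≤ J z := by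
  set A : Set ℝ := J '' {z | P z ∧ J z + D z w₀ ≤ J w₀} with hA
  have hne : A.Nonempty := ⟨J w₀, w₀, ⟨hw₀, by rw [hself, add_zero]⟩, rfl⟩
  have hbdd : BddBelow A := ⟨c, by rintro _ ⟨z, hz, rfl⟩; exact hc z hz.1⟩
  obtain ⟨_, ⟨w, ⟨hw, hw'⟩, rfl⟩, hlt⟩ := Real.lt_sInf_add_pos hne hη
  refine ⟨w, hw, hw', fun z hz => ?_⟩
  by_cases hzA : J z + D z w₀ ≤ J w₀
  · have h1 : sInf A ≤ J z := csInf_le hbdd ⟨z, ⟨hz, hzA⟩, rfl⟩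
    linarith [hD0 z w hz hw]
  · linarith [hD z w w₀ hz hw hw₀]

/-- The derivative of the energy at `w` in direction `φ`. -/
def energyDeriv {N : ℕ} (p : ℝ) (Ω : Set (Euc N)) (V : Euc N → ℝ) (f : (Euc N → ℝ) → ℝ)
    (w φ : Euc N → ℝ) : ℝ :=
  (∫ x in Ω, ⟪pvec p (gradient w x), gradient φ x⟫) - (∫ x in Ω, V x * psc p (w x) * φ x) - f φ

lemma norm_rpow_add_smul_le {E : Type*} [NormedAddCommGroup E] [InnerProductSpace ℝ E] {p : ℝ}
    (hp : 1 < p) (a b : E) (t : ℝ) :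
    ‖a + t • b‖ ^ p ≤ ‖a‖ ^ p + p * (t * ⟪powerMap p (a + t • b), b⟫) := by
  have h := norm_rpow_add_inner_powerMap_le hp (a + t • b) a
  rw [show a - (a + t • b) = -(t • b) by abel, inner_neg_right, inner_smul_right] at h
  linarith

lemma abs_rpow_add_mul_ge {p : ℝ} (hp : 1 < p) (a b t : ℝ) :
    |a| ^ p + p * (t * (psc p a * b)) ≤ |a + t * b| ^ p := by
  have h := norm_rpow_add_inner_powerMap_le hp a (a + t * b)
  rw [add_sub_cancel_left] at h
  have e : ⟪powerMap p a, t * b⟫ = t * (psc p a * b) := by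
    simp only [powerMap, psc, Real.norm_eq_abs, smul_eq_mul, real_inner_eq_re_inner]
    simp
    ring
  rwa [e] at h

lemma continuous_pvec {d : ℕ} {p : ℝ} (hp : 1 < p) : Continuous (pvec p : Euc d → Euc d) :=
  continuous_powerMap hp

lemma continuous_psc {p : ℝ} (hp : 1 < p) : Continuous (psc p) :=
  (continuous_powerMap hp : Continuous (powerMap p : ℝ → ℝ))

lemma abs_psc {p : ℝ} (hp : 1 < p) (s : ℝ) : |psc p s| = |s| ^ (p - 1) := by
  simpa [powerMap, psc] using norm_powerMap hp s

lemma norm_pvec {d : ℕ} {p : ℝ} (hp : 1 < p) (s : Euc d) : ‖pvec p s‖ = ‖s‖ ^ (p - 1) :=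
  norm_powerMap hp s

namespace VariationalSetting

variable {N : ℕ} {p q r : ℝ} {Ω : Set (Euc N)} {V W : Euc N → ℝ} {f : (Euc N → ℝ) → ℝ}
  {w φ : Euc N → ℝ}

lemma integrableOn_inner (S : VariationalSetting p q r Ω V W f) {G : Euc N → Euc N}
    (hG : Continuous G) (hφ : IsTestFun Ω φ) :
    IntegrableOn (fun x => ⟪G x, gradient φ x⟫) Ω :=
  hφ.integrableOn_of_continuousOn S.isOpen (hG.inner hφ.continuous_gradient).continuousOn
    fun x hx => by rw [gradient_eq_zero_of_notMem_tsupport hx, inner_zero_right]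

lemma integrableOn_potential_psc (S : VariationalSetting p q r Ω V W f) (hw : IsTestFun Ω w)
    (hφ : IsTestFun Ω φ) : IntegrableOn (fun x => V x * psc p (w x) * φ x) Ω := by
  simp only [mul_assoc]
  exact integrableOn_of_eq_zero_off S.isOpen (S.integrableOn_potential_mul hφ.isCompact_tsupport
    hφ.2.2 (((continuous_psc S.one_lt_p).comp hw.continuous).mul hφ.continuous).continuousOn)
    fun x hx => by simp [image_eq_zero_of_notMem_tsupport hx]

lemma energy_add_smul_le (S : VariationalSetting p q r Ω V W f) (hw : IsTestFun Ω w)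
    (hφ : IsTestFun Ω φ) (t : ℝ) :
    energy p Ω V f (fun x => 1 * w x + t * φ x) ≤ energy p Ω V f w +
      t * ((∫ x in Ω, ⟪pvec p (gradient w x + t • gradient φ x), gradient φ x⟫)
        - (∫ x in Ω, V x * psc p (w x) * φ x) - f φ) := by
  have hp := S.p_pos
  have hz := hw.lincomb hφ 1 t
  have hgz : ∀ x, gradient (fun x => 1 * w x + t * φ x) x = gradient w x + t • gradient φ x :=
    fun x => by simpa using gradient_lincomb hw.differentiable hφ.differentiable 1 t x
  have hcont : Continuous fun x => pvec p (gradient w x + t • gradient φ x) :=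
    (continuous_pvec S.one_lt_p).comp
      (hw.continuous_gradient.add (hφ.continuous_gradient.const_smul t))
  have i1 := S.integrableOn_inner hcont hφ
  have i2 := hw.integrableOn_gradient_rpow S.isOpen hp
  have i3 := hz.integrableOn_gradient_rpow S.isOpen hp
  have i4 := S.integrableOn_potential_psc hw hφ
  have i5 := S.integrableOn_potential_mul_rpow hw
  have i6 := S.integrableOn_potential_mul_rpow hz
  have h1 : ∫ x in Ω, ‖gradient (fun x => 1 * w x + t * φ x) x‖ ^ p ≤
      (∫ x in Ω, ‖gradient w x‖ ^ p) +
        p * (t * ∫ x in Ω, ⟪pvec p (gradient w x + t • gradient φ x), gradient φ x⟫) := by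
    rw [← integral_const_mul, ← integral_const_mul,
      ← integral_add i2 ((i1.const_mul t).const_mul p)]
    refine setIntegral_mono i3 (i2.add ((i1.const_mul t).const_mul p)) fun x => ?_
    simp only [hgz]
    exact norm_rpow_add_smul_le S.one_lt_p _ _ t
  have h2 : (∫ x in Ω, V x * |w x| ^ p) + p * (t * ∫ x in Ω, V x * psc p (w x) * φ x) ≤
      ∫ x in Ω, V x * |1 * w x + t * φ x| ^ p := by
    rw [← integral_const_mul, ← integral_const_mul,
      ← integral_add i5 ((i4.const_mul t).const_mul p)]
    refine setIntegral_mono_on (i5.add ((i4.const_mul t).const_mul p)) i6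
      S.isOpen.measurableSet fun x hx => ?_
    have := mul_le_mul_of_nonneg_left (abs_rpow_add_mul_ge S.one_lt_p (w x) (φ x) t)
      (S.potential_nonneg x hx)
    rw [one_mul]
    refine le_trans (le_of_eq ?_) this
    ring
  have h3 : f (fun x => 1 * w x + t * φ x) = f w + t * f φ := by
    rw [S.linear 1 t w φ hw hφ, one_mul]
  simp only [energy, QV, h3]
  rw [div_sub' hp.ne', div_le_iff₀ hp]
  have e : ∀ a b c d e g : ℝ, ((a - b) / p - c + t * (d - e - g)) * p
      = a + p * (t * d) - (b + p * (t * e)) - p * (c + t * g) := by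
    intro a b c d e g
    field_simp
    ring
  rw [e]
  linarith

/-- Near an almost minimizer there is an almost critical point with a controlled gradient. -/
lemma exists_almost_critical (S : VariationalSetting p q r Ω V W f) {ε R C : ℝ} (hε : 0 < ε)
    (hε1 : ε ≤ 1) (hR : 1 ≤ R) (hC : 0 ≤ C) {K : Set (Euc N)} (hK : IsCompact K) (hKΩ : K ⊆ Ω)
    {w₀ : Euc N → ℝ} (hw₀ : IsTestFun Ω w₀)
    (hmin : ∀ z, IsTestFun Ω z → energy p Ω V f w₀ ≤ energy p Ω V f z + ε ^ 2)
    (hwR : ∀ x, ‖gradient w₀ x‖ ≤ R) :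
    ∃ w, IsTestFun Ω w ∧ energy p Ω V f w ≤ energy p Ω V f w₀ ∧
      ∫ x in Ω, (|w x - w₀ x| + ‖gradient w x - gradient w₀ x‖) ≤ ε ∧
      (∀ x, ‖gradient w x‖ ≤ 2 * R) ∧
      ∀ φ, IsTestFun Ω φ → (∀ x, x ∉ K → φ x = 0) → (∀ x, ‖gradient φ x‖ ≤ C * R) →
        -(ε * ((∫ x in Ω, (|φ x| + ‖gradient φ x‖)) + C + 1)) ≤ energyDeriv p Ω V f w φ := by
  have hR0 : 0 < R := one_pos.trans_le hR
  obtain ⟨c, hc⟩ := S.energy_bddBelow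
  set κ : ℝ := volume.real K
  have hκ : 0 ≤ κ := measureReal_nonneg
  -- a modulus of continuity of the vector field on a large ball
  have hω : 0 < ε / (2 * (κ * (C * R) + 1)) := by positivity
  obtain ⟨δ, hδ, hAδ⟩ := Metric.uniformContinuousOn_iff.1
    ((isCompact_closedBall (0 : Euc N) ((2 + C) * R)).uniformContinuousOn_of_continuous
      (continuous_pvec (d := N) S.one_lt_p).continuousOn) _ hω
  set t : ℝ := min 1 (δ / (2 * (C * R + 1)))
  have ht0 : 0 < t := by positivity
  have ht1 : t ≤ 1 := min_le_left _ _
  have htδ : t * (C * R) < δ := by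
    calc t * (C * R) ≤ δ / (2 * (C * R + 1)) * (C * R + 1) := by
          gcongr
          · exact min_le_right _ _
          · linarith
      _ = δ / 2 := by field_simp
      _ < δ := by linarith
  set D : (Euc N → ℝ) → (Euc N → ℝ) → ℝ := fun z w =>
    ε * (∫ x in Ω, (|z x - w x| + ‖gradient z x - gradient w x‖))
      + ε / R * ⨆ x, ‖gradient z x - gradient w x‖ with hDdef
  have hint : ∀ z w, IsTestFun Ω z → IsTestFun Ω w →
      IntegrableOn (fun x => |z x - w x| + ‖gradient z x - gradient w x‖) Ω := by
    intro z w hz hw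
    have := (hz.sub hw).integrableOn_abs_add_gradient S.isOpen
    simpa only [gradient_fun_sub hz.differentiable hw.differentiable] using this
  have hbd : ∀ z w, IsTestFun Ω z → IsTestFun Ω w →
      BddAbove (Set.range fun x => ‖gradient z x - gradient w x‖) := by
    intro z w hz hw
    have := (hz.sub hw).bddAbove_gradient
    simpa only [gradient_fun_sub hz.differentiable hw.differentiable] using this
  have hsup0 : ∀ z w : Euc N → ℝ, 0 ≤ ⨆ x, ‖gradient z x - gradient w x‖ := fun z w =>
    Real.iSup_nonneg fun x => norm_nonneg _
  have hint0 : ∀ z w : Euc N → ℝ,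
      0 ≤ ∫ x in Ω, (|z x - w x| + ‖gradient z x - gradient w x‖) := fun z w =>
    integral_nonneg fun x => by positivity
  have hεR : 0 < ε / R := by positivity
  obtain ⟨w, hw, hwmin, hwall⟩ := exists_almost_minimizer (P := IsTestFun Ω)
    (J := energy p Ω V f) hc (D := D)
    (fun z w _ _ => add_nonneg (mul_nonneg hε.le (hint0 z w)) (mul_nonneg hεR.le (hsup0 z w)))
    (fun x y z hx hy hz => by
      have h1 : ∫ a in Ω, (|x a - z a| + ‖gradient x a - gradient z a‖) ≤
          (∫ a in Ω, (|x a - y a| + ‖gradient x a - gradient y a‖)) +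
            ∫ a in Ω, (|y a - z a| + ‖gradient y a - gradient z a‖) := by
        rw [← integral_add (hint x y hx hy) (hint y z hy hz)]
        refine setIntegral_mono (hint x z hx hz) ((hint x y hx hy).add (hint y z hy hz))
          fun a => ?_
        have e1 := abs_sub_le (x a) (y a) (z a)
        have e2 := norm_sub_le_norm_sub_add_norm_sub (gradient x a) (gradient y a) (gradient z a)
        simp only
        linarith
      have h2 : (⨆ a, ‖gradient x a - gradient z a‖) ≤
          (⨆ a, ‖gradient x a - gradient y a‖) + ⨆ a, ‖gradient y a - gradient z a‖ := by
        refine ciSup_le fun a => ?_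
        exact (norm_sub_le_norm_sub_add_norm_sub _ (gradient y a) _).trans
          (add_le_add (le_ciSup (hbd x y hx hy) a) (le_ciSup (hbd y z hy hz) a))
      have h3 := mul_le_mul_of_nonneg_left h1 hε.le
      have h4 := mul_le_mul_of_nonneg_left h2 hεR.le
      simp only [hDdef]
      linarith)
    hw₀ (by simp [hDdef]) (η := t * (ε / 2)) (by positivity)
  have hDle : D w w₀ ≤ ε ^ 2 := by linarith [hmin w hw]
  have hY : ∀ x, ‖gradient w x - gradient w₀ x‖ ≤ R := by
    intro x
    refine (le_ciSup (hbd w w₀ hw hw₀) x).trans ?_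
    have h1 : ε / R * (⨆ x, ‖gradient w x - gradient w₀ x‖) ≤ ε / R * R := by
      have : ε / R * R = ε := by field_simp
      rw [this]
      have h2 := mul_nonneg hε.le (hint0 w w₀)
      have h3 : ε ^ 2 ≤ ε := by nlinarith
      simp only [hDdef] at hDle
      linarith
    exact le_of_mul_le_mul_left h1 hεR
  have hwR' : ∀ x, ‖gradient w x‖ ≤ 2 * R := fun x => by
    have := norm_le_norm_sub_add (gradient w x) (gradient w₀ x)
    linarith [hY x, hwR x]
  refine ⟨w, hw, ?_, ?_, hwR', fun φ hφ hφK hφR => ?_⟩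
  · have : 0 ≤ D w w₀ := add_nonneg (mul_nonneg hε.le (hint0 _ _)) (mul_nonneg hεR.le (hsup0 _ _))
    linarith
  · have h1 : ε * (∫ x in Ω, (|w x - w₀ x| + ‖gradient w x - gradient w₀ x‖)) ≤ ε * ε := by
      have h2 := mul_nonneg hεR.le (hsup0 w w₀)
      simp only [hDdef] at hDle
      nlinarith
    exact le_of_mul_le_mul_left h1 hε
  · have hts : ∀ x, x ∉ K → x ∉ tsupport φ := fun x hx hx' =>
      hx (closure_minimal (fun y hy => by by_contra h; exact hy (hφK y h)) hK.isClosed hx')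
    have hz := hw.lincomb hφ 1 t
    have hgz : ∀ x, gradient (fun x => 1 * w x + t * φ x) x - gradient w x = t • gradient φ x :=
      fun x => by
        rw [gradient_lincomb hw.differentiable hφ.differentiable 1 t x, one_smul,
          add_sub_cancel_left]
    have h1 := hwall _ hz
    have h2 := S.energy_add_smul_le hw hφ t
    have hDz : D (fun x => 1 * w x + t * φ x) w ≤
        t * (ε * (∫ x in Ω, (|φ x| + ‖gradient φ x‖)) + ε * C) := by
      have e1 : ∫ x in Ω, (|1 * w x + t * φ x - w x| +
          ‖gradient (fun x => 1 * w x + t * φ x) x - gradient w x‖)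
          = t * ∫ x in Ω, (|φ x| + ‖gradient φ x‖) := by
        rw [← integral_const_mul]
        congr 1 with x
        rw [hgz, norm_smul, Real.norm_of_nonneg ht0.le, one_mul, add_sub_cancel_left, abs_mul,
          abs_of_pos ht0, mul_add]
      have e2 : (⨆ x, ‖gradient (fun x => 1 * w x + t * φ x) x - gradient w x‖) ≤ t * (C * R) := by
        refine ciSup_le fun x => ?_
        rw [hgz, norm_smul, Real.norm_of_nonneg ht0.le]
        gcongr
        exact hφR x
      simp only [hDdef, e1]
      have e3 := mul_le_mul_of_nonneg_left e2 hεR.le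
      have e4 : ε / R * (t * (C * R)) = t * (ε * C) := by field_simp
      linarith
    have hA : ∫ x in Ω, ⟪pvec p (gradient w x + t • gradient φ x), gradient φ x⟫ ≤
        (∫ x in Ω, ⟪pvec p (gradient w x), gradient φ x⟫) + ε / 2 := by
      have c1 : Continuous fun x => pvec p (gradient w x + t • gradient φ x) :=
        (continuous_pvec S.one_lt_p).comp
          (hw.continuous_gradient.add (hφ.continuous_gradient.const_smul t))
      have c2 : Continuous fun x => pvec p (gradient w x) :=
        (continuous_pvec S.one_lt_p).comp hw.continuous_gradient
      have i1 := S.integrableOn_inner c1 hφ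
      have i2 := S.integrableOn_inner c2 hφ
      rw [← sub_le_iff_le_add', ← integral_sub i1 i2,
        setIntegral_eq_of_eq_zero_off S.isOpen hKΩ fun x hx => by
          simp [gradient_eq_zero_of_notMem_tsupport (hts x hx)]]
      have hb : ∀ x ∈ K, ‖⟪pvec p (gradient w x + t • gradient φ x), gradient φ x⟫
          - ⟪pvec p (gradient w x), gradient φ x⟫‖ ≤ ε / (2 * (κ * (C * R) + 1)) * (C * R) := by
        intro x _
        rw [← inner_sub_left]
        refine (norm_inner_le_norm _ _).trans ?_
        gcongr
        · rw [← dist_eq_norm]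
          have hx1 : ‖t • gradient φ x‖ ≤ t * (C * R) := by
            rw [norm_smul, Real.norm_of_nonneg ht0.le]
            gcongr
            exact hφR x
          have hCR : 0 ≤ C * R := by positivity
          refine (hAδ _ ?_ _ ?_ ?_).le
          · rw [mem_closedBall_zero_iff]
            refine (norm_add_le _ _).trans ?_
            have : t * (C * R) ≤ 1 * (C * R) := by gcongr
            linarith [hwR' x]
          · rw [mem_closedBall_zero_iff]
            linarith [hwR' x]
          · rw [dist_eq_norm, add_sub_cancel_left]
            linarith
        · exact hφR x
      have h := norm_setIntegral_le_of_norm_le_const (μ := volume) hK.measure_lt_top hb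
      refine (le_abs_self _).trans (h.trans ?_)
      have hCR : 0 ≤ C * R := by positivity
      calc ε / (2 * (κ * (C * R) + 1)) * (C * R) * κ
          = ε / 2 * ((κ * (C * R)) / (κ * (C * R) + 1)) := by field_simp
        _ ≤ ε / 2 * 1 := by
            gcongr
            rw [div_le_one (by positivity)]
            linarith
        _ = ε / 2 := mul_one _
    have h3 : t * (-(ε * ((∫ x in Ω, (|φ x| + ‖gradient φ x‖)) + C + 1))) ≤
        t * energyDeriv p Ω V f w φ := by
      have h4 : t * ((∫ x in Ω, ⟪pvec p (gradient w x + t • gradient φ x), gradient φ x⟫)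
          - (∫ x in Ω, V x * psc p (w x) * φ x) - f φ) ≤
          t * (energyDeriv p Ω V f w φ + ε / 2) := by
        gcongr
        simp only [energyDeriv]
        linarith
      have h5 : t * (energyDeriv p Ω V f w φ + ε / 2)
          = t * energyDeriv p Ω V f w φ + t * (ε / 2) := by ring
      have h6 : t * (-(ε * ((∫ x in Ω, (|φ x| + ‖gradient φ x‖)) + C + 1))) =
          -(t * (ε * (∫ x in Ω, (|φ x| + ‖gradient φ x‖)) + ε * C)) - t * (ε / 2) - t * (ε / 2) := by
        ring
      linarith
    exact le_of_mul_le_mul_left h3 ht0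

end VariationalSetting

/-! ### Local comparison of almost minimizers -/

lemma continuous_one_div_one_add_sq {d : ℕ} {g : Euc d → ℝ} (hg : Continuous g) (δ : ℝ) :
    Continuous fun x => 1 / (1 + (g x / δ) ^ 2) :=
  continuous_const.div (by fun_prop) fun x => by positivity

lemma one_sub_one_div_one_add_sq_le {δ : ℝ} (hδ : 0 < δ) (s : ℝ) :
    1 - 1 / (1 + (s / δ) ^ 2) ≤ |s| / δ := by
  have h1 : |s| / δ = |s / δ| := by rw [abs_div, abs_of_pos hδ]
  rw [h1]
  set y := s / δ
  have h2 : 1 - 1 / (1 + y ^ 2) = |y| ^ 2 / (1 + y ^ 2) := by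
    rw [sq_abs]
    field_simp
    ring
  rw [h2, div_le_iff₀ (by positivity), ← sq_abs y]
  have h0 := abs_nonneg y
  nlinarith [mul_nonneg h0 (sq_nonneg (|y| - 1)), mul_nonneg h0 h0]

namespace VariationalSetting

variable {N : ℕ} {p q r : ℝ} {Ω : Set (Euc N)} {V W : Euc N → ℝ} {f : (Euc N → ℝ) → ℝ}
  {a b ψ : Euc N → ℝ}

lemma energyDeriv_neg (S : VariationalSetting p q r Ω V W f) {w φ : Euc N → ℝ}
    (hφ : IsTestFun Ω φ) :
    energyDeriv p Ω V f w (fun x => (-1) * φ x) = -energyDeriv p Ω V f w φ := by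
  have h : ∀ x, V x * psc p (w x) * ((-1) * φ x) = (-1) * (V x * psc p (w x) * φ x) :=
    fun x => by ring
  simp only [energyDeriv, S.map_const_mul hφ, gradient_fun_const_mul hφ.differentiable,
    inner_smul_right, integral_const_mul, h]
  ring

/-- Testing with a truncated difference controls the monotonicity defect. -/
lemma integral_monotonicity_le (S : VariationalSetting p q r Ω V W f) (ha : IsTestFun Ω a)
    (hb : IsTestFun Ω b) (hψ : IsTestFun Ω ψ) (hψ0 : ∀ x, 0 ≤ ψ x) (hψ1 : ∀ x, ψ x ≤ 1)
    {D δ E : ℝ} (hD : ∀ x, ‖gradient ψ x‖ ≤ D) (hδ : 0 < δ)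
    (hE : energyDeriv p Ω V f a (fun x => ψ x * softTrunc δ (a x - b x))
      - energyDeriv p Ω V f b (fun x => ψ x * softTrunc δ (a x - b x)) ≤ E) :
    ∫ x in tsupport ψ, ψ x * (1 / (1 + ((a x - b x) / δ) ^ 2) *
      ⟪pvec p (gradient a x) - pvec p (gradient b x), gradient a x - gradient b x⟫) ≤
    E + (2 * δ * D * ((∫ x in tsupport ψ, ‖gradient a x‖ ^ (p - 1))
        + ∫ x in tsupport ψ, ‖gradient b x‖ ^ (p - 1))
      + 2 * δ * ((∫ x in tsupport ψ, V x * |a x| ^ (p - 1))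
        + ∫ x in tsupport ψ, V x * |b x| ^ (p - 1))) := by
  have hp1 : 0 ≤ p - 1 := by linarith [S.one_lt_p]
  set L := tsupport ψ with hL
  have hLc : IsCompact L := hψ.isCompact_tsupport
  have hLΩ : L ⊆ Ω := hψ.2.2
  have hs := ha.sub hb
  set φ : Euc N → ℝ := fun x => ψ x * softTrunc δ (a x - b x) with hφdef
  have hφ : IsTestFun Ω φ := hψ.mul_right (contDiff_softTrunc δ hs.1)
  have hgφ : ∀ x, gradient φ x = ψ x • (1 / (1 + ((a x - b x) / δ) ^ 2)) •
      (gradient a x - gradient b x) + softTrunc δ (a x - b x) • gradient ψ x := by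
    intro x
    rw [hφdef, gradient_fun_mul hψ.differentiable
      ((contDiff_softTrunc δ hs.1).differentiable (by simp)),
      gradient_softTrunc hδ hs.differentiable, gradient_fun_sub ha.differentiable hb.differentiable]
  have hφ0 : ∀ x, x ∉ L → φ x = 0 := fun x hx => by
    simp [hφdef, image_eq_zero_of_notMem_tsupport hx]
  have hgφ0 : ∀ x, x ∉ L → gradient φ x = 0 := fun x hx => by
    simp [hgφ, image_eq_zero_of_notMem_tsupport hx, gradient_eq_zero_of_notMem_tsupport hx]
  have hca : Continuous fun x => pvec p (gradient a x) :=
    (continuous_pvec S.one_lt_p).comp ha.continuous_gradient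
  have hcb : Continuous fun x => pvec p (gradient b x) :=
    (continuous_pvec S.one_lt_p).comp hb.continuous_gradient
  have i1 := (S.integrableOn_inner hca hφ).mono_set hLΩ
  have i2 := (S.integrableOn_inner hcb hφ).mono_set hLΩ
  have i3 := (S.integrableOn_potential_psc ha hφ).mono_set hLΩ
  have i4 := (S.integrableOn_potential_psc hb hφ).mono_set hLΩ
  have i5 : IntegrableOn (fun x => ‖gradient a x‖ ^ (p - 1)) L :=
    (ha.continuous_gradient_rpow hp1).continuousOn.integrableOn_compact hLc
  have i6 : IntegrableOn (fun x => ‖gradient b x‖ ^ (p - 1)) L :=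
    (hb.continuous_gradient_rpow hp1).continuousOn.integrableOn_compact hLc
  have i7 : IntegrableOn (fun x => V x * |a x| ^ (p - 1)) L :=
    S.integrableOn_potential_mul hLc hLΩ (ha.continuous_abs_rpow hp1).continuousOn
  have i8 : IntegrableOn (fun x => V x * |b x| ^ (p - 1)) L :=
    S.integrableOn_potential_mul hLc hLΩ (hb.continuous_abs_rpow hp1).continuousOn
  have i0 : IntegrableOn (fun x => ψ x * (1 / (1 + ((a x - b x) / δ) ^ 2) *
      ⟪pvec p (gradient a x) - pvec p (gradient b x), gradient a x - gradient b x⟫)) L :=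
    (hψ.continuous.mul ((continuous_one_div_one_add_sq hs.continuous δ).mul
      ((hca.sub hcb).inner (ha.continuous_gradient.sub hb.continuous_gradient)))).continuousOn.integrableOn_compact
      hLc
  have hder : ∀ w, energyDeriv p Ω V f w φ = (∫ x in L, ⟪pvec p (gradient w x), gradient φ x⟫)
      - (∫ x in L, V x * psc p (w x) * φ x) - f φ := fun w => by
    rw [energyDeriv, setIntegral_eq_of_eq_zero_off S.isOpen hLΩ fun x hx => by
      rw [hgφ0 x hx, inner_zero_right], setIntegral_eq_of_eq_zero_off S.isOpen hLΩ fun x hx => by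
      rw [hφ0 x hx, mul_zero]]
  rw [hder, hder] at hE
  refine le_trans ?_ (add_le_add_left hE _)
  have j12 := i1.sub i3
  have j34 := i2.sub i4
  have j56 := (i5.add i6).const_mul (2 * δ * D)
  have j78 := (i7.add i8).const_mul (2 * δ)
  have hsum : ((∫ x in L, ⟪pvec p (gradient a x), gradient φ x⟫)
      - (∫ x in L, V x * psc p (a x) * φ x) - f φ
      - ((∫ x in L, ⟪pvec p (gradient b x), gradient φ x⟫)
      - (∫ x in L, V x * psc p (b x) * φ x) - f φ))
      + (2 * δ * D * ((∫ x in L, ‖gradient a x‖ ^ (p - 1)) + ∫ x in L, ‖gradient b x‖ ^ (p - 1))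
      + 2 * δ * ((∫ x in L, V x * |a x| ^ (p - 1)) + ∫ x in L, V x * |b x| ^ (p - 1)))
      = ∫ x in L, (((⟪pvec p (gradient a x), gradient φ x⟫ - V x * psc p (a x) * φ x)
        - (⟪pvec p (gradient b x), gradient φ x⟫ - V x * psc p (b x) * φ x))
        + (2 * δ * D * (‖gradient a x‖ ^ (p - 1) + ‖gradient b x‖ ^ (p - 1))
        + 2 * δ * (V x * |a x| ^ (p - 1) + V x * |b x| ^ (p - 1)))) := by
    have e1 := integral_add (j12.sub j34) (j56.add j78)
    have e2 := integral_sub j12 j34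
    have e3 := integral_add j56 j78
    simp only [Pi.add_apply, Pi.sub_apply] at e1 e2 e3
    rw [e1, e2, e3, integral_sub i1 i3, integral_sub i2 i4, integral_const_mul,
      integral_const_mul, integral_add i5 i6, integral_add i7 i8]
    ring
  rw [hsum]
  refine setIntegral_mono_on i0 ((j12.sub j34).add (j56.add j78)) hLc.isClosed.measurableSet
    fun x hx => ?_
  have hV := S.potential_nonneg x (hLΩ hx)
  have hT := abs_softTrunc_le hδ (a x - b x)
  have e1 : ⟪pvec p (gradient a x), gradient φ x⟫ - ⟪pvec p (gradient b x), gradient φ x⟫ =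
      ψ x * (1 / (1 + ((a x - b x) / δ) ^ 2) *
      ⟪pvec p (gradient a x) - pvec p (gradient b x), gradient a x - gradient b x⟫)
      + softTrunc δ (a x - b x) *
        ⟪pvec p (gradient a x) - pvec p (gradient b x), gradient ψ x⟫ := by
    rw [← inner_sub_left, hgφ, inner_add_right, inner_smul_right, inner_smul_right,
      inner_smul_right]
  have e2 : |softTrunc δ (a x - b x) *
        ⟪pvec p (gradient a x) - pvec p (gradient b x), gradient ψ x⟫| ≤
      2 * δ * ((‖gradient a x‖ ^ (p - 1) + ‖gradient b x‖ ^ (p - 1)) * D) := by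
    rw [abs_mul]
    gcongr
    refine (abs_real_inner_le_norm _ _).trans ?_
    gcongr
    · refine (norm_sub_le _ _).trans ?_
      rw [norm_pvec S.one_lt_p, norm_pvec S.one_lt_p]
    · exact hD x
  have e3 : |(V x * psc p (a x) - V x * psc p (b x)) * φ x| ≤
      (V x * |a x| ^ (p - 1) + V x * |b x| ^ (p - 1)) * (2 * δ) := by
    rw [abs_mul]
    gcongr
    · refine (abs_sub _ _).trans ?_
      rw [abs_mul, abs_mul, abs_of_nonneg hV, abs_psc S.one_lt_p, abs_psc S.one_lt_p]
    · simp only [hφdef, abs_mul, abs_of_nonneg (hψ0 x)]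
      calc ψ x * |softTrunc δ (a x - b x)| ≤ 1 * (2 * δ) := by gcongr; exact hψ1 x
        _ = 2 * δ := one_mul _
  have e4 := (abs_le.1 e2).1
  have e5 := (abs_le.1 e3).2
  linarith

set_option maxHeartbeats 800000 in
/-- Almost minimizers that are close in `L^1` locally have gradients close in `L^1` locally. -/
lemma exists_local_gradient_comparison (S : VariationalSetting p q r Ω V W f) {K : Set (Euc N)}
    (hK : IsCompact K) (hKΩ : K ⊆ Ω) :
    ∃ L, IsCompact L ∧ L ⊆ Ω ∧ ∀ κ : ℝ, 0 < κ → ∃ A : ℝ, 0 ≤ A ∧ ∀ δ ε ε' : ℝ,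
      0 < δ → δ ≤ 1 → 0 < ε → ε ≤ 1 → 0 < ε' → ε' ≤ 1 → ∀ a b, IsTestFun Ω a → IsTestFun Ω b →
      (∀ z, IsTestFun Ω z → energy p Ω V f a ≤ energy p Ω V f z + ε ^ 2) →
      (∀ z, IsTestFun Ω z → energy p Ω V f b ≤ energy p Ω V f z + ε' ^ 2) →
      ∫ x in K, ‖gradient a x - gradient b x‖ ≤
        κ + A * (δ + ε + ε') + A / δ * ((∫ x in L, |a x - b x|) + ε + ε') := by
  have hq := S.q_pos
  have hp1 : 0 < p - 1 := by linarith [S.one_lt_p]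
  obtain ⟨ψ, hψ, hψ0, hψ1, hψK⟩ := exists_cutoff S.isOpen hK hKΩ
  obtain ⟨D, hD0, hD⟩ := hψ.exists_gradient_bound
  set L := tsupport ψ with hL
  have hLc : IsCompact L := hψ.isCompact_tsupport
  have hLm : MeasurableSet L := hLc.isClosed.measurableSet
  have hLΩ : L ⊆ Ω := hψ.2.2
  have hKL : K ⊆ L := fun x hx => subset_tsupport ψ (by simp [hψK x hx])
  obtain ⟨M, hM0, hM⟩ := S.exists_weighted_bound_of_energy_le
    (energy p Ω V f (fun _ => 0) + 1)
  obtain ⟨Bq, hBq0, hBq⟩ := S.exists_local_bound M hLc hLΩ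
  obtain ⟨B₁, hB₁0, hB₁⟩ := S.exists_local_rpow_bound M hLc hLΩ one_pos S.one_lt_q
  obtain ⟨Bp, hBp0, hBp⟩ := S.exists_local_rpow_bound M hLc hLΩ hp1 S.p_sub_one_lt_q
  obtain ⟨BV, hBV0, hBV⟩ := S.exists_local_potential_bound M hLc hLΩ
  set v : ℝ := volume.real L
  have hv : 0 ≤ v := measureReal_nonneg
  refine ⟨L, hLc, hLΩ, fun κ hκ => ?_⟩
  obtain ⟨Cκ, hCκ0, hCκ⟩ := exists_norm_sub_le_weighted_monotonicity (E := Euc N) (p := p) (q := q)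
    (κ := κ / (v + 2 * Bq + 1)) S.one_lt_p S.one_lt_q (by positivity)
  set B₃ : ℝ := ((2 + 2 * D) * v + 2 * B₁) + (4 + 2 * D) + 1
  have hB₃0 : 0 ≤ B₃ := by positivity
  refine ⟨1 + Cκ + Cκ * (B₃ + 4 * D * Bp + 4 * BV), by positivity,
    fun δ ε ε' hδ hδ1 hε hε1 hε' hε1' a₀ b₀ ha₀ hb₀ hamin hbmin => ?_⟩
  obtain ⟨Ra, -, hRa⟩ := ha₀.exists_gradient_bound
  obtain ⟨Rb, -, hRb⟩ := hb₀.exists_gradient_bound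
  set R : ℝ := max 1 (max Ra Rb)
  have hR1 : 1 ≤ R := le_max_left _ _
  have hCC : 0 ≤ 4 + 2 * D := by positivity
  obtain ⟨a, ha, haJ, haZ, haR, hacrit⟩ := S.exists_almost_critical hε hε1 hR1 hCC hLc hLΩ ha₀ hamin
    fun x => (hRa x).trans ((le_max_left _ _).trans (le_max_right _ _))
  obtain ⟨b, hb, hbJ, hbZ, hbR, hbcrit⟩ := S.exists_almost_critical hε' hε1' hR1 hCC hLc hLΩ hb₀ hbmin
    fun x => (hRb x).trans ((le_max_right _ _).trans (le_max_right _ _))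
  have hMa := hM a ha (by nlinarith [hamin _ isTestFun_zero])
  have hMb := hM b hb (by nlinarith [hbmin _ isTestFun_zero])
  have hs := ha.sub hb
  set φ : Euc N → ℝ := fun x => ψ x * softTrunc δ (a x - b x) with hφdef
  have hφ : IsTestFun Ω φ := hψ.mul_right (contDiff_softTrunc δ hs.1)
  have hθ : ∀ x, 0 ≤ 1 / (1 + ((a x - b x) / δ) ^ 2) ∧ 1 / (1 + ((a x - b x) / δ) ^ 2) ≤ 1 :=
    fun x => ⟨by positivity, by
      rw [div_le_one (by positivity)]
      nlinarith [sq_nonneg ((a x - b x) / δ)]⟩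
  have hgφle : ∀ x, ‖gradient φ x‖ ≤ ‖gradient a x - gradient b x‖ + 2 * D := by
    intro x
    rw [hφdef, gradient_fun_mul hψ.differentiable
      ((contDiff_softTrunc δ hs.1).differentiable (by simp)),
      gradient_softTrunc hδ hs.differentiable, gradient_fun_sub ha.differentiable hb.differentiable]
    refine (norm_add_le _ _).trans ?_
    rw [norm_smul, norm_smul, norm_smul, Real.norm_of_nonneg (hψ0 x), Real.norm_of_nonneg (hθ x).1,
      Real.norm_eq_abs]
    gcongr
    · calc ψ x * (1 / (1 + ((a x - b x) / δ) ^ 2) * ‖gradient a x - gradient b x‖)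
          ≤ 1 * (1 * ‖gradient a x - gradient b x‖) :=
            mul_le_mul (hψ1 x) (mul_le_mul_of_nonneg_right (hθ x).2 (norm_nonneg _))
              (mul_nonneg (hθ x).1 (norm_nonneg _)) zero_le_one
        _ = _ := by ring
    · exact (abs_softTrunc_le hδ _).trans (by linarith)
    · exact hD x
  have hφ0 : ∀ x, x ∉ L → φ x = 0 := fun x hx => by
    simp [hφdef, image_eq_zero_of_notMem_tsupport hx]
  have hts : ∀ x, x ∉ L → x ∉ tsupport φ := fun x hx hx' =>
    hx (closure_minimal (fun y hy => by by_contra h; exact hy (hφ0 y h)) hLc.isClosed hx')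
  have hφR : ∀ x, ‖gradient φ x‖ ≤ (4 + 2 * D) * R := by
    intro x
    have h1 := norm_sub_le (gradient a x) (gradient b x)
    nlinarith [hgφle x, haR x, hbR x]
  have hcont : Continuous fun x => ‖gradient a x‖ ^ (1 : ℝ) + |a x| ^ (1 : ℝ) :=
    (ha.continuous_gradient_rpow zero_le_one).add (ha.continuous_abs_rpow zero_le_one)
  have hcont' : Continuous fun x => ‖gradient b x‖ ^ (1 : ℝ) + |b x| ^ (1 : ℝ) :=
    (hb.continuous_gradient_rpow zero_le_one).add (hb.continuous_abs_rpow zero_le_one)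
  have hZ : ∫ x in Ω, (|φ x| + ‖gradient φ x‖) ≤ (2 + 2 * D) * v + 2 * B₁ := by
    rw [setIntegral_eq_of_eq_zero_off S.isOpen hLΩ fun x hx => by
      rw [hφ0 x hx, gradient_eq_zero_of_notMem_tsupport (hts x hx)]; simp]
    have k1 : IntegrableOn (fun _ : Euc N => 2 + 2 * D) L := integrableOn_const hLc.measure_lt_top.ne
    have k2 := hcont.continuousOn.integrableOn_compact (μ := volume) hLc
    have k3 := hcont'.continuousOn.integrableOn_compact (μ := volume) hLc
    calc ∫ x in L, (|φ x| + ‖gradient φ x‖)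
        ≤ ∫ x in L, ((2 + 2 * D) + ((‖gradient a x‖ ^ (1 : ℝ) + |a x| ^ (1 : ℝ))
            + (‖gradient b x‖ ^ (1 : ℝ) + |b x| ^ (1 : ℝ)))) := by
          refine setIntegral_mono ((hφ.integrableOn_abs_add_gradient S.isOpen).mono_set hLΩ)
            (k1.add (k2.add k3)) fun x => ?_
          have h1 := norm_sub_le (gradient a x) (gradient b x)
          have h2 : |φ x| ≤ 2 := by
            simp only [hφdef, abs_mul, abs_of_nonneg (hψ0 x)]
            have := abs_softTrunc_le hδ (a x - b x)
            nlinarith [hψ1 x, hψ0 x, abs_nonneg (softTrunc δ (a x - b x))]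
          simp only [rpow_one]
          linarith [hgφle x, abs_nonneg (a x), abs_nonneg (b x)]
      _ = (2 + 2 * D) * v + ((∫ x in L, (‖gradient a x‖ ^ (1 : ℝ) + |a x| ^ (1 : ℝ)))
            + ∫ x in L, (‖gradient b x‖ ^ (1 : ℝ) + |b x| ^ (1 : ℝ))) := by
          rw [← integral_add k2 k3]
          refine (integral_add k1 (k2.add k3)).trans ?_
          rw [setIntegral_const, smul_eq_mul, mul_comm (volume.real L)]
          rfl
      _ ≤ _ := by linarith [hB₁ a ha hMa, hB₁ b hb hMb]
  have hE : energyDeriv p Ω V f a φ - energyDeriv p Ω V f b φ ≤ (ε + ε') * B₃ := by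
    have hneg := hφ.const_mul (-1)
    have hgneg : ∀ x, ‖gradient (fun x => (-1) * φ x) x‖ = ‖gradient φ x‖ := fun x => by
      rw [gradient_fun_const_mul hφ.differentiable, norm_smul]; simp
    have h1 := hacrit _ hneg (fun x hx => by simp [hφ0 x hx])
      (fun x => (hgneg x).le.trans (hφR x))
    have h2 := hbcrit _ hφ hφ0 hφR
    simp only [hgneg, S.energyDeriv_neg hφ, abs_mul, abs_neg, abs_one, one_mul] at h1
    have h3 : (∫ x in Ω, (|φ x| + ‖gradient φ x‖)) + (4 + 2 * D) + 1 ≤ B₃ := by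
      simp only [B₃]; linarith
    have h4 := mul_le_mul_of_nonneg_left h3 hε.le
    have h5 := mul_le_mul_of_nonneg_left h3 hε'.le
    linarith
  have hI := S.integral_monotonicity_le ha hb hψ hψ0 hψ1 hD hδ hE
  set I : ℝ := ∫ x in L, ψ x * (1 / (1 + ((a x - b x) / δ) ^ 2) *
      ⟪pvec p (gradient a x) - pvec p (gradient b x), gradient a x - gradient b x⟫) with hIdef
  have hgp : ∀ w, IsTestFun Ω w → ∫ x in Ω, (‖gradient w x‖ ^ q + |w x| ^ q) * W x ≤ M →
      ∫ x in L, ‖gradient w x‖ ^ (p - 1) ≤ Bp := fun w hw hwM => by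
    refine le_trans (setIntegral_mono ((hw.continuous_gradient_rpow
      hp1.le).continuousOn.integrableOn_compact hLc) (((hw.continuous_gradient_rpow hp1.le).add
      (hw.continuous_abs_rpow hp1.le)).continuousOn.integrableOn_compact hLc) fun x => ?_)
      (hBp w hw hwM)
    simp only [Pi.add_apply]
    linarith [rpow_nonneg (abs_nonneg (w x)) (p - 1)]
  have hI' : I ≤ (ε + ε') * B₃ + δ * (4 * D * Bp + 4 * BV) := by
    have h1 := hgp a ha hMa
    have h2 := hgp b hb hMb
    have h3 := hBV a ha hMa
    have h4 := hBV b hb hMb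
    have h5 : 2 * δ * D * ((∫ x in L, ‖gradient a x‖ ^ (p - 1))
        + ∫ x in L, ‖gradient b x‖ ^ (p - 1)) ≤ 2 * δ * D * (Bp + Bp) := by gcongr
    have h6 : 2 * δ * ((∫ x in L, V x * |a x| ^ (p - 1))
        + ∫ x in L, V x * |b x| ^ (p - 1)) ≤ 2 * δ * (BV + BV) := by gcongr
    linarith
  have hdist : ∀ w w₀ (e : ℝ), IsTestFun Ω w → IsTestFun Ω w₀ →
      ∫ x in Ω, (|w x - w₀ x| + ‖gradient w x - gradient w₀ x‖) ≤ e → ∀ T ⊆ Ω,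
      ∫ x in T, |w x - w₀ x| ≤ e ∧ ∫ x in T, ‖gradient w x - gradient w₀ x‖ ≤ e := by
    intro w w₀ e hw hw₀ he T hT
    have hi : IntegrableOn (fun x => |w x - w₀ x| + ‖gradient w x - gradient w₀ x‖) Ω := by
      have := (hw.sub hw₀).integrableOn_abs_add_gradient S.isOpen
      simpa only [gradient_fun_sub hw.differentiable hw₀.differentiable] using this
    have h1 : ∫ x in T, (|w x - w₀ x| + ‖gradient w x - gradient w₀ x‖) ≤ e :=
      (setIntegral_mono_set hi (ae_of_all _ fun x => by positivity) hT.eventuallyLE).trans he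
    have hiT := hi.mono_set hT
    constructor
    · exact (integral_mono_of_nonneg (ae_of_all _ fun x => abs_nonneg _) hiT
        (ae_of_all _ fun x => le_add_of_nonneg_right (norm_nonneg _))).trans h1
    · exact (integral_mono_of_nonneg (ae_of_all _ fun x => norm_nonneg _) hiT
        (ae_of_all _ fun x => le_add_of_nonneg_left (abs_nonneg _))).trans h1
  have hsL : ∫ x in L, |a x - b x| ≤ (∫ x in L, |a₀ x - b₀ x|) + ε + ε' := by
    have h1 := (hdist a a₀ ε ha ha₀ haZ L hLΩ).1
    have h2 := (hdist b b₀ ε' hb hb₀ hbZ L hLΩ).1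
    have k : ∀ u w, IsTestFun Ω u → IsTestFun Ω w → IntegrableOn (fun x => |u x - w x|) L :=
      fun u w hu hw => (hu.sub hw).continuous.abs.continuousOn.integrableOn_compact hLc
    have h3 : ∫ x in L, |a x - b x| ≤
        ∫ x in L, ((|a₀ x - b₀ x| + |a x - a₀ x|) + |b x - b₀ x|) := by
      refine setIntegral_mono (k a b ha hb) (((k a₀ b₀ ha₀ hb₀).add (k a a₀ ha ha₀)).add
        (k b b₀ hb hb₀)) fun x => ?_
      have e1 := abs_sub_le (a x) (a₀ x) (b x)
      have e2 := abs_sub_le (a₀ x) (b₀ x) (b x)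
      rw [abs_sub_comm (b₀ x)] at e2
      simp only
      linarith
    have h4 := integral_add ((k a₀ b₀ ha₀ hb₀).add (k a a₀ ha ha₀)) (k b b₀ hb hb₀)
    have h5 := integral_add (k a₀ b₀ ha₀ hb₀) (k a a₀ ha ha₀)
    simp only [Pi.add_apply] at h4 h5
    linarith
  have hmain : ∫ x in K, ‖gradient a x - gradient b x‖ ≤
      κ + Cκ * I + Cκ / δ * ∫ x in L, |a x - b x| := by
    have kg : Continuous fun x => ‖gradient a x - gradient b x‖ :=
      (ha.continuous_gradient.sub hb.continuous_gradient).norm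
    have k1 : Continuous fun x => ‖gradient a x‖ ^ q + |a x| ^ q :=
      (ha.continuous_gradient_rpow hq.le).add (ha.continuous_abs_rpow hq.le)
    have k2 : Continuous fun x => ‖gradient b x‖ ^ q + |b x| ^ q :=
      (hb.continuous_gradient_rpow hq.le).add (hb.continuous_abs_rpow hq.le)
    have hca : Continuous fun x => pvec p (gradient a x) :=
      (continuous_pvec S.one_lt_p).comp ha.continuous_gradient
    have hcb : Continuous fun x => pvec p (gradient b x) :=
      (continuous_pvec S.one_lt_p).comp hb.continuous_gradient
    have k3 : Continuous fun x => ψ x * (1 / (1 + ((a x - b x) / δ) ^ 2) *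
        ⟪pvec p (gradient a x) - pvec p (gradient b x), gradient a x - gradient b x⟫) :=
      hψ.continuous.mul ((continuous_one_div_one_add_sq hs.continuous δ).mul
        ((hca.sub hcb).inner (ha.continuous_gradient.sub hb.continuous_gradient)))
    have I0 : IntegrableOn (fun _ : Euc N => (1 : ℝ)) L := integrableOn_const hLc.measure_lt_top.ne
    have I1 := k1.continuousOn.integrableOn_compact (μ := volume) hLc
    have I2 := k2.continuousOn.integrableOn_compact (μ := volume) hLc
    have I3 := k3.continuousOn.integrableOn_compact (μ := volume) hLc
    have I4 := hs.continuous.abs.continuousOn.integrableOn_compact (μ := volume) hLc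
    set κ' : ℝ := κ / (v + 2 * Bq + 1)
    have hκ' : 0 < κ' := by positivity
    have J1 := (I0.add (I1.add I2)).const_mul κ'
    have J2 := I3.const_mul Cκ
    have J3 := I4.const_mul (Cκ / δ)
    have hstep : ∫ x in K, ‖gradient a x - gradient b x‖ ≤ ∫ x in L, ψ x * ‖gradient a x - gradient b x‖ := by
      calc ∫ x in K, ‖gradient a x - gradient b x‖
          = ∫ x in K, ψ x * ‖gradient a x - gradient b x‖ :=
            setIntegral_congr_fun hK.isClosed.measurableSet fun x hx => by simp [hψK x hx]
        _ ≤ _ := setIntegral_mono_set ((hψ.continuous.mul kg).continuousOn.integrableOn_compact hLc)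
            (ae_of_all _ fun x => mul_nonneg (hψ0 x) (norm_nonneg _)) hKL.eventuallyLE
    refine hstep.trans ?_
    have hpt : ∫ x in L, ψ x * ‖gradient a x - gradient b x‖ ≤
        ∫ x in L, ((κ' * (1 + ((‖gradient a x‖ ^ q + |a x| ^ q) + (‖gradient b x‖ ^ q + |b x| ^ q)))
          + Cκ * (ψ x * (1 / (1 + ((a x - b x) / δ) ^ 2) *
            ⟪pvec p (gradient a x) - pvec p (gradient b x), gradient a x - gradient b x⟫)))
          + Cκ / δ * |a x - b x|) := by
      refine setIntegral_mono ((hψ.continuous.mul kg).continuousOn.integrableOn_compact hLc)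
        ((J1.add J2).add J3) fun x => ?_
      have h := hCκ (gradient a x) (gradient b x) _ (hθ x).1 (hθ x).2
      have h1 := mul_le_mul_of_nonneg_left h (hψ0 x)
      have h2 := mul_le_mul_of_nonneg_left (one_sub_one_div_one_add_sq_le hδ (a x - b x)) hCκ0
      have h3 : ψ x * (Cκ * (1 - 1 / (1 + ((a x - b x) / δ) ^ 2))) ≤ Cκ * (|a x - b x| / δ) := by
        refine le_trans (mul_le_of_le_one_left (mul_nonneg hCκ0 ?_) (hψ1 x)) h2
        linarith [(hθ x).2]
      have h4 : ψ x * (κ' * (1 + ‖gradient a x‖ ^ q + ‖gradient b x‖ ^ q)) ≤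
          κ' * (1 + ((‖gradient a x‖ ^ q + |a x| ^ q) + (‖gradient b x‖ ^ q + |b x| ^ q))) := by
        refine le_trans (mul_le_of_le_one_left (by positivity) (hψ1 x)) ?_
        refine mul_le_mul_of_nonneg_left ?_ hκ'.le
        linarith [rpow_nonneg (abs_nonneg (a x)) q, rpow_nonneg (abs_nonneg (b x)) q]
      have h5 : Cκ * (|a x - b x| / δ) = Cκ / δ * |a x - b x| := by ring
      have h6 : powerMap p (gradient a x) - powerMap p (gradient b x)
          = pvec p (gradient a x) - pvec p (gradient b x) := rfl
      rw [h6] at h1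
      simp only
      linarith
    refine hpt.trans ?_
    have e1 := integral_add (J1.add J2) J3
    have e2 := integral_add J1 J2
    have e3 := integral_add I0 (I1.add I2)
    have e4 := integral_add I1 I2
    simp only [Pi.add_apply] at e1 e2 e3 e4
    rw [e1, e2, integral_const_mul, integral_const_mul, integral_const_mul, e3, e4, ← hIdef]
    gcongr
    rw [setIntegral_const, smul_eq_mul, mul_one]
    have h1 := hBq a ha hMa
    have h2 := hBq b hb hMb
    calc _ ≤ κ' * (v + (Bq + Bq)) :=
          mul_le_mul_of_nonneg_left (add_le_add le_rfl (add_le_add h1 h2)) hκ'.le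
      _ ≤ κ' * (v + 2 * Bq + 1) := mul_le_mul_of_nonneg_left (by linarith) hκ'.le
      _ = κ := by simp only [κ']; field_simp
  have hfinal : ∫ x in K, ‖gradient a₀ x - gradient b₀ x‖ ≤
      (∫ x in K, ‖gradient a x - gradient b x‖) + ε + ε' := by
    have h1 := (hdist a a₀ ε ha ha₀ haZ K hKΩ).2
    have h2 := (hdist b b₀ ε' hb hb₀ hbZ K hKΩ).2
    have k : ∀ u w, IsTestFun Ω u → IsTestFun Ω w →
        IntegrableOn (fun x => ‖gradient u x - gradient w x‖) K :=
      fun u w hu hw => (hu.continuous_gradient.sub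
        hw.continuous_gradient).norm.continuousOn.integrableOn_compact hK
    have h3 : ∫ x in K, ‖gradient a₀ x - gradient b₀ x‖ ≤
        ∫ x in K, ((‖gradient a x - gradient b x‖ + ‖gradient a x - gradient a₀ x‖)
          + ‖gradient b x - gradient b₀ x‖) := by
      refine setIntegral_mono (k a₀ b₀ ha₀ hb₀) (((k a b ha hb).add (k a a₀ ha ha₀)).add
        (k b b₀ hb hb₀)) fun x => ?_
      have e1 := norm_sub_le_norm_sub_add_norm_sub (gradient a₀ x) (gradient a x) (gradient b₀ x)
      have e2 := norm_sub_le_norm_sub_add_norm_sub (gradient a x) (gradient b x) (gradient b₀ x)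
      rw [norm_sub_rev (gradient a₀ x) (gradient a x)] at e1
      simp only
      linarith
    have h4 := integral_add ((k a b ha hb).add (k a a₀ ha ha₀)) (k b b₀ hb hb₀)
    have h5 := integral_add (k a b ha hb) (k a a₀ ha ha₀)
    simp only [Pi.add_apply] at h4 h5
    linarith
  have hCI := mul_le_mul_of_nonneg_left hI' hCκ0
  have hCs := mul_le_mul_of_nonneg_left hsL (show 0 ≤ Cκ / δ by positivity)
  have hL0 : 0 ≤ (∫ x in L, |a₀ x - b₀ x|) + ε + ε' :=
    add_nonneg (add_nonneg (integral_nonneg fun x => abs_nonneg _) hε.le) hε'.le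
  set P : ℝ := 4 * D * Bp + 4 * BV
  have hP : 0 ≤ P := by positivity
  have hfin1 : Cκ / δ * ((∫ x in L, |a₀ x - b₀ x|) + ε + ε') ≤
      (1 + Cκ + Cκ * (B₃ + 4 * D * Bp + 4 * BV)) / δ * ((∫ x in L, |a₀ x - b₀ x|) + ε + ε') := by
    gcongr
    have : 0 ≤ Cκ * (B₃ + 4 * D * Bp + 4 * BV) := by positivity
    linarith
  have hfin2 : Cκ * ((ε + ε') * B₃ + δ * P) + ε + ε' ≤
      (1 + Cκ + Cκ * (B₃ + 4 * D * Bp + 4 * BV)) * (δ + ε + ε') := by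
    have h1 : B₃ + 4 * D * Bp + 4 * BV = B₃ + P := by simp only [P]; ring
    rw [h1]
    have h2 : (1 + Cκ + Cκ * (B₃ + P)) * (δ + ε + ε') - (Cκ * ((ε + ε') * B₃ + δ * P) + ε + ε')
        = δ + Cκ * (δ + ε + ε') + Cκ * (B₃ * δ + P * (ε + ε')) := by ring
    have h3 : 0 ≤ δ + Cκ * (δ + ε + ε') + Cκ * (B₃ * δ + P * (ε + ε')) := by positivity
    linarith
  linarith

end VariationalSetting

/-! ### Limits of locally Cauchy sequences -/

lemma exists_tendsto_ae_of_cauchy_integral_norm {d : ℕ} {E : Type*} [NormedAddCommGroup E]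
    [CompleteSpace E] {U : Set (Euc d)} (hU : IsOpen U) {w : ℕ → Euc d → E}
    (hw : ∀ n, Continuous (w n))
    (hc : ∀ K, IsCompact K → K ⊆ U → ∀ η : ℝ, 0 < η → ∃ n0, ∀ n ≥ n0, ∀ k ≥ n0,
      ∫ x in K, ‖w n x - w k x‖ ≤ η) :
    ∃ σ : ℕ → ℕ, StrictMono σ ∧ ∃ u : Euc d → E, StronglyMeasurable u ∧
      (∀ᵐ x ∂volume.restrict U, Tendsto (fun n => w (σ n) x) atTop (𝓝 (u x))) ∧
      ∀ K, IsCompact K → K ⊆ U →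
        (∀ n, IntegrableOn (fun x => ‖w (σ n) x - u x‖) K) ∧
        Tendsto (fun n => ∫ x in K, ‖w (σ n) x - u x‖) atTop (𝓝 0) := by
  obtain ⟨K, hKc, hKU, hKm, hKex⟩ := exists_compact_exhaustion hU
  obtain ⟨σ, hσ, hP⟩ := extraction_forall_of_eventually'
    (P := fun j m => ∀ n ≥ m, ∀ k ≥ m, ∫ x in K j, ‖w n x - w k x‖ ≤ (1 / 2) ^ j) fun j => by
      obtain ⟨n0, hn0⟩ := hc (K j) (hKc j) (hKU j) ((1 / 2) ^ j) (by positivity)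
      exact ⟨n0, fun m hm n hn k hk => hn0 n (hm.trans hn) k (hm.trans hk)⟩
  have hint : ∀ L, IsCompact L → ∀ n k, IntegrableOn (fun x => w n x - w k x) L :=
    fun L hL n k => ((hw n).sub (hw k)).continuousOn.integrableOn_compact hL
  have hex : ∀ i, ∀ᵐ x ∂volume.restrict (K i), ∃ l, Tendsto (fun n => w (σ n) x) atTop (𝓝 l) := by
    intro i
    have h := Lp.ae_tendsto_of_cauchy_eLpNorm (μ := volume.restrict (K i)) (p := 1)
      (f := fun n => w (σ (n + i))) (fun n => (hw _).continuousOn.aestronglyMeasurable_of_isCompact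
        (hKc i) (hKc i).isClosed.measurableSet) le_rfl
      (B := fun n => ENNReal.ofReal (2 * (1 / 2) ^ n))
      ((summable_geometric_two.mul_left 2).tsum_ofReal_ne_top) fun m n k hmn hmk => by
        simp only [eLpNorm_one_eq_lintegral_enorm, Pi.sub_apply]
        rw [← ofReal_integral_norm_eq_lintegral_enorm (hint _ (hKc i) _ _),
          ENNReal.ofReal_lt_ofReal_iff (by positivity)]
        calc ∫ x in K i, ‖w (σ (n + i)) x - w (σ (k + i)) x‖
            ≤ ∫ x in K (m + i), ‖w (σ (n + i)) x - w (σ (k + i)) x‖ :=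
              setIntegral_mono_set (hint _ (hKc _) _ _).norm (ae_of_all _ fun x => norm_nonneg _)
                (hKm (by lia)).eventuallyLE
          _ ≤ (1 / 2) ^ (m + i) := hP _ _ (hσ.monotone (by lia)) _ (hσ.monotone (by lia))
          _ ≤ (1 / 2) ^ m := pow_le_pow_of_le_one (by norm_num) (by norm_num) (by lia)
          _ < 2 * (1 / 2) ^ m := by linarith [show (0 : ℝ) < (1 / 2) ^ m by positivity]
    filter_upwards [h] with x ⟨l, hl⟩
    exact ⟨l, (tendsto_add_atTop_iff_nat i).1 hl⟩
  have hUeq : U = ⋃ i, K i := by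
    refine Set.Subset.antisymm (fun x hx => ?_) (Set.iUnion_subset hKU)
    obtain ⟨i, hi⟩ := hKex {x} isCompact_singleton (Set.singleton_subset_iff.2 hx)
    exact Set.mem_iUnion.2 ⟨i, hi rfl⟩
  have hexU : ∀ᵐ x ∂volume.restrict U, ∃ l, Tendsto (fun n => w (σ n) x) atTop (𝓝 l) := by
    rw [hUeq, ae_restrict_iUnion_iff]
    exact hex
  obtain ⟨u, hu, hlim⟩ := exists_stronglyMeasurable_limit_of_tendsto_ae
    (fun n => (hw (σ n)).aestronglyMeasurable) hexU
  refine ⟨σ, hσ, u, hu, hlim, fun L hL hLU => ?_⟩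
  have hlimL := ae_mono (Measure.restrict_mono hLU le_rfl) hlim
  have key : ∀ η : ℝ, ∀ n, (∀ᶠ k in atTop, ∫ x in L, ‖w (σ n) x - w (σ k) x‖ ≤ η) →
      IntegrableOn (fun x => ‖w (σ n) x - u x‖) L ∧ ∫ x in L, ‖w (σ n) x - u x‖ ≤ η := by
    intro η n h
    refine integrable_and_integral_le_of_tendsto_ae (fun k => (hint L hL (σ n) (σ k)).norm)
      (fun k => ae_of_all _ fun x => norm_nonneg _) h ?_
    filter_upwards [hlimL] with x hx
    exact (tendsto_const_nhds.sub hx).norm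
  have hsmall : ∀ η : ℝ, 0 < η → ∃ n0, ∀ n ≥ n0,
      IntegrableOn (fun x => ‖w (σ n) x - u x‖) L ∧ ∫ x in L, ‖w (σ n) x - u x‖ ≤ η := by
    intro η hη
    obtain ⟨n0, hn0⟩ := hc L hL hLU η hη
    refine ⟨n0, fun n hn => key η n ?_⟩
    filter_upwards [eventually_ge_atTop n0] with k hk
    exact hn0 _ (hn.trans hσ.le_apply) _ (hk.trans hσ.le_apply)
  obtain ⟨n1, hn1⟩ := hsmall 1 one_pos
  constructor
  · intro n
    have h1 := (hn1 n1 le_rfl).1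
    have h2 := (hint L hL (σ n) (σ n1)).norm
    refine (h2.add h1).mono' ((hw _).aestronglyMeasurable.sub hu.aestronglyMeasurable).norm
      (ae_of_all _ fun x => ?_)
    rw [norm_norm]
    exact norm_sub_le_norm_sub_add_norm_sub _ _ _
  · rw [Metric.tendsto_atTop]
    intro η hη
    obtain ⟨n0, hn0⟩ := hsmall (η / 2) (half_pos hη)
    refine ⟨n0, fun n hn => ?_⟩
    rw [Real.dist_eq, sub_zero, abs_of_nonneg (integral_nonneg fun x => norm_nonneg _)]
    linarith [(hn0 n hn).2]

lemma exists_subseq_tendsto_ae_of_tendsto_integral {α : Type*} [MeasurableSpace α] {μ : Measure α}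
    {g : ℕ → α → ℝ} (hg : ∀ n, Integrable (g n) μ) (h0 : ∀ n x, 0 ≤ g n x)
    (h : Tendsto (fun n => ∫ x, g n x ∂μ) atTop (𝓝 0)) :
    ∃ σ : ℕ → ℕ, StrictMono σ ∧ ∀ᵐ x ∂μ, Tendsto (fun n => g (σ n) x) atTop (𝓝 0) := by
  refine TendstoInMeasure.exists_seq_tendsto_ae (g := fun _ => (0 : ℝ))
    (tendstoInMeasure_of_tendsto_eLpNorm one_ne_zero (fun n => (hg n).1)
      aestronglyMeasurable_const ?_)
  have h' := ENNReal.tendsto_ofReal h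
  rw [ENNReal.ofReal_zero] at h'
  refine h'.congr fun n => ?_
  rw [eLpNorm_one_eq_lintegral_enorm, ← ofReal_integral_norm_eq_lintegral_enorm]
  · simp [abs_of_nonneg (h0 n _)]
  · exact (hg n).sub (integrable_zero α ℝ μ)

/-! ### A convergent minimizing sequence -/

/-- `w` is a minimizing sequence of test functions with error `ε n ^ 2` converging, together with
its gradients, to `u` and `v` almost everywhere and locally in `L^1`. -/
structure IsMinimizingLimit {N : ℕ} (p : ℝ) (Ω : Set (Euc N)) (V : Euc N → ℝ)
    (f : (Euc N → ℝ) → ℝ) (w : ℕ → Euc N → ℝ) (ε : ℕ → ℝ) (u : Euc N → ℝ)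
    (v : Euc N → Euc N) : Prop where
  isTestFun : ∀ n, IsTestFun Ω (w n)
  error_pos : ∀ n, 0 < ε n
  error_le_one : ∀ n, ε n ≤ 1
  error_tendsto : Tendsto ε atTop (𝓝 0)
  energy_le : ∀ n z, IsTestFun Ω z → energy p Ω V f (w n) ≤ energy p Ω V f z + ε n ^ 2
  stronglyMeasurable : StronglyMeasurable u
  stronglyMeasurable_gradient : StronglyMeasurable v
  tendsto_ae : ∀ᵐ x ∂volume.restrict Ω, Tendsto (fun n => w n x) atTop (𝓝 (u x))
  tendsto_gradient_ae :
    ∀ᵐ x ∂volume.restrict Ω, Tendsto (fun n => gradient (w n) x) atTop (𝓝 (v x))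
  tendsto_integral : ∀ K, IsCompact K → K ⊆ Ω → (∀ n, IntegrableOn (fun x => |w n x - u x|) K) ∧
    Tendsto (fun n => ∫ x in K, |w n x - u x|) atTop (𝓝 0)
  tendsto_integral_gradient : ∀ K, IsCompact K → K ⊆ Ω →
    (∀ n, IntegrableOn (fun x => ‖gradient (w n) x - v x‖) K) ∧
    Tendsto (fun n => ∫ x in K, ‖gradient (w n) x - v x‖) atTop (𝓝 0)

namespace VariationalSetting

variable {N : ℕ} {p q r : ℝ} {Ω : Set (Euc N)} {V W : Euc N → ℝ} {f : (Euc N → ℝ) → ℝ}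

lemma exists_energy_le (S : VariationalSetting p q r Ω V W f) {η : ℝ} (hη : 0 < η) :
    ∃ w, IsTestFun Ω w ∧ ∀ z, IsTestFun Ω z → energy p Ω V f w ≤ energy p Ω V f z + η := by
  obtain ⟨C, hC⟩ := S.energy_bddBelow
  have hne : (energy p Ω V f '' {z | IsTestFun Ω z}).Nonempty :=
    ⟨_, _, isTestFun_zero, rfl⟩
  have hbdd : BddBelow (energy p Ω V f '' {z | IsTestFun Ω z}) :=
    ⟨C, by rintro _ ⟨z, hz, rfl⟩; exact hC z hz⟩
  obtain ⟨_, ⟨w, hw, rfl⟩, hlt⟩ := Real.lt_sInf_add_pos hne hη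
  exact ⟨w, hw, fun z hz => hlt.le.trans (add_le_add_left (csInf_le hbdd ⟨z, hz, rfl⟩) _)⟩

/-- Gradients of an `L^1_loc`-Cauchy minimizing sequence are `L^1_loc`-Cauchy. -/
lemma cauchy_integral_gradient (S : VariationalSetting p q r Ω V W f) {w : ℕ → Euc N → ℝ}
    {ε : ℕ → ℝ} (hw : ∀ n, IsTestFun Ω (w n)) (hε0 : ∀ n, 0 < ε n) (hε1 : ∀ n, ε n ≤ 1)
    (hε : Tendsto ε atTop (𝓝 0))
    (hmin : ∀ n z, IsTestFun Ω z → energy p Ω V f (w n) ≤ energy p Ω V f z + ε n ^ 2)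
    (hc : ∀ K, IsCompact K → K ⊆ Ω → ∀ η : ℝ, 0 < η → ∃ n0, ∀ n ≥ n0, ∀ k ≥ n0,
      ∫ x in K, |w n x - w k x| ≤ η)
    {K : Set (Euc N)} (hK : IsCompact K) (hKΩ : K ⊆ Ω) {η : ℝ} (hη : 0 < η) :
    ∃ n0, ∀ n ≥ n0, ∀ k ≥ n0, ∫ x in K, ‖gradient (w n) x - gradient (w k) x‖ ≤ η := by
  obtain ⟨L, hL, hLΩ, hcomp⟩ := S.exists_local_gradient_comparison hK hKΩ
  obtain ⟨A, hA0, hA⟩ := hcomp (η / 4) (by positivity)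
  set δ : ℝ := min 1 (η / (4 * (A + 1))) with hδdef
  have hδ : 0 < δ := lt_min one_pos (by positivity)
  have hAδ : A * δ ≤ η / 4 := by
    have h1 : δ ≤ η / (4 * (A + 1)) := min_le_right _ _
    rw [le_div_iff₀ (by positivity)] at h1
    nlinarith
  set τ : ℝ := η / (2 * (2 * A + 3 * (A / δ) + 1)) with hτdef
  have hτ : 0 < τ := by positivity
  have hAτ : A * (2 * τ) + A / δ * (3 * τ) ≤ η / 2 := by
    have h1 : τ * (2 * (2 * A + 3 * (A / δ) + 1)) = η := div_mul_cancel₀ _ (by positivity)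
    nlinarith
  obtain ⟨n1, hn1⟩ := hc L hL hLΩ τ hτ
  obtain ⟨n2, hn2⟩ := eventually_atTop.1 (hε.eventually_le_const hτ)
  refine ⟨max n1 n2, fun n hn k hk => ?_⟩
  have h1 := hA δ (ε n) (ε k) hδ (min_le_left _ _) (hε0 n) (hε1 n) (hε0 k) (hε1 k) (w n) (w k)
    (hw n) (hw k) (hmin n) (hmin k)
  have h2 := hn1 n (le_of_max_le_left hn) k (le_of_max_le_left hk)
  have h3 := hn2 n (le_of_max_le_right hn)
  have h4 := hn2 k (le_of_max_le_right hk)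
  have h5 : A / δ * ((∫ x in L, |w n x - w k x|) + ε n + ε k) ≤ A / δ * (3 * τ) :=
    mul_le_mul_of_nonneg_left (by linarith) (by positivity)
  have h6 : A * (δ + ε n + ε k) ≤ A * (δ + 2 * τ) :=
    mul_le_mul_of_nonneg_left (by linarith) hA0
  linarith

lemma exists_isMinimizingLimit (S : VariationalSetting p q r Ω V W f) :
    ∃ w ε u v, IsMinimizingLimit p Ω V f w ε u v := by
  set ε₀ : ℕ → ℝ := fun n => 1 / ((n : ℝ) + 1) with hε₀
  have hε0 : ∀ n, 0 < ε₀ n := fun n => by positivity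
  have hε1 : ∀ n, ε₀ n ≤ 1 := fun n => by
    simp only [hε₀]
    rw [div_le_one (by positivity)]
    linarith [n.cast_nonneg (α := ℝ)]
  have hεlim : Tendsto ε₀ atTop (𝓝 0) := tendsto_one_div_add_atTop_nhds_zero_nat
  choose w₀ hw₀ hmin₀ using fun n => S.exists_energy_le (pow_pos (hε0 n) 2)
  obtain ⟨M, hM0, hM⟩ := S.exists_weighted_bound_of_energy_le (energy p Ω V f (fun _ => 0) + 1)
  have hwM : ∀ n, ∫ x in Ω, (‖gradient (w₀ n) x‖ ^ q + |w₀ n x| ^ q) * W x ≤ M := fun n =>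
    hM _ (hw₀ n) (by nlinarith [hmin₀ n _ isTestFun_zero, hε0 n, hε1 n])
  obtain ⟨σ, hσ, hcau⟩ := exists_subseq_cauchy_integral_abs S.isOpen hw₀ fun K hK hKΩ => by
    obtain ⟨C, -, hC⟩ := S.exists_local_rpow_bound M hK hKΩ one_pos S.one_lt_q
    refine ⟨C, fun n => ?_⟩
    have h := hC _ (hw₀ n) (hwM n)
    simp only [rpow_one] at h
    simpa only [add_comm] using h
  have hgcau : ∀ K, IsCompact K → K ⊆ Ω → ∀ η : ℝ, 0 < η → ∃ n0, ∀ n ≥ n0, ∀ k ≥ n0,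
      ∫ x in K, ‖gradient (w₀ (σ n)) x - gradient (w₀ (σ k)) x‖ ≤ η := fun K hK hKΩ η hη =>
    S.cauchy_integral_gradient (w := fun n => w₀ (σ n)) (ε := fun n => ε₀ (σ n))
      (fun n => hw₀ _) (fun n => hε0 _) (fun n => hε1 _) (hεlim.comp hσ.tendsto_atTop)
      (fun n => hmin₀ _) hcau hK hKΩ hη
  obtain ⟨τ, hτ, g, hg, hglim, hgint⟩ := exists_tendsto_ae_of_cauchy_integral_norm S.isOpen
    (w := fun n x => (w₀ (σ n) x, gradient (w₀ (σ n)) x))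
    (fun n => (hw₀ _).continuous.prodMk (hw₀ _).continuous_gradient) fun K hK hKΩ η hη => by
      obtain ⟨n1, hn1⟩ := hcau K hK hKΩ (η / 2) (half_pos hη)
      obtain ⟨n2, hn2⟩ := hgcau K hK hKΩ (η / 2) (half_pos hη)
      refine ⟨max n1 n2, fun n hn k hk => ?_⟩
      have h1 := hn1 n (le_of_max_le_left hn) k (le_of_max_le_left hk)
      have h2 := hn2 n (le_of_max_le_right hn) k (le_of_max_le_right hk)
      have k1 := ((hw₀ (σ n)).sub (hw₀ (σ k))).continuous.abs.continuousOn.integrableOn_compact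
        (μ := volume) hK
      have k2 := ((hw₀ (σ n)).continuous_gradient.sub
        (hw₀ (σ k)).continuous_gradient).norm.continuousOn.integrableOn_compact (μ := volume) hK
      refine (integral_mono_of_nonneg (ae_of_all _ fun x => norm_nonneg _) (k1.add k2)
        (ae_of_all _ fun x => ?_)).trans ((integral_add k1 k2).trans_le
          ((add_le_add h1 h2).trans (add_halves η).le))
      simp only [Prod.mk_sub_mk, Prod.norm_mk, Real.norm_eq_abs, Pi.add_apply]
      exact max_le_add_of_nonneg (abs_nonneg _) (norm_nonneg _)
  refine ⟨fun n => w₀ (σ (τ n)), fun n => ε₀ (σ (τ n)), fun x => (g x).1, fun x => (g x).2,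
    fun n => hw₀ _, fun n => hε0 _, fun n => hε1 _,
    hεlim.comp (hσ.tendsto_atTop.comp hτ.tendsto_atTop), fun n => hmin₀ _,
    continuous_fst.comp_stronglyMeasurable hg, continuous_snd.comp_stronglyMeasurable hg, ?_, ?_,
    fun K hK hKΩ => ?_, fun K hK hKΩ => ?_⟩
  · filter_upwards [hglim] with x hx using (continuous_fst.tendsto _).comp hx
  · filter_upwards [hglim] with x hx using (continuous_snd.tendsto _).comp hx
  · obtain ⟨h1, h2⟩ := hgint K hK hKΩ
    have hle : ∀ n x, |w₀ (σ (τ n)) x - (g x).1| ≤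
        ‖(w₀ (σ (τ n)) x, gradient (w₀ (σ (τ n))) x) - g x‖ := fun n x =>
      norm_fst_le ((w₀ (σ (τ n)) x, gradient (w₀ (σ (τ n))) x) - g x)
    have hi : ∀ n, IntegrableOn (fun x => |w₀ (σ (τ n)) x - (g x).1|) K := fun n =>
      (h1 n).mono' (((hw₀ _).continuous.aestronglyMeasurable.sub
        (continuous_fst.comp_stronglyMeasurable hg).aestronglyMeasurable).norm)
        (ae_of_all _ fun x => by rw [norm_of_nonneg (abs_nonneg _)]; exact hle n x)
    exact ⟨hi, squeeze_zero (fun n => integral_nonneg fun x => abs_nonneg _)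
      (fun n => integral_mono (hi n) (h1 n) (hle n)) h2⟩
  · obtain ⟨h1, h2⟩ := hgint K hK hKΩ
    have hle : ∀ n x, ‖gradient (w₀ (σ (τ n))) x - (g x).2‖ ≤
        ‖(w₀ (σ (τ n)) x, gradient (w₀ (σ (τ n))) x) - g x‖ := fun n x =>
      norm_snd_le ((w₀ (σ (τ n)) x, gradient (w₀ (σ (τ n))) x) - g x)
    have hi : ∀ n, IntegrableOn (fun x => ‖gradient (w₀ (σ (τ n))) x - (g x).2‖) K := fun n =>
      (h1 n).mono' (((hw₀ _).continuous_gradient.aestronglyMeasurable.sub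
        (continuous_snd.comp_stronglyMeasurable hg).aestronglyMeasurable).norm)
        (ae_of_all _ fun x => by rw [norm_norm]; exact hle n x)
    exact ⟨hi, squeeze_zero (fun n => integral_nonneg fun x => norm_nonneg _)
      (fun n => integral_mono (hi n) (h1 n) (hle n)) h2⟩

end VariationalSetting

/-! ### Regularity of the limit -/

lemma tendsto_integral_mul_of_tendsto_integral_abs_sub {α : Type*} [MeasurableSpace α]
    {μ : Measure α} {g : ℕ → α → ℝ} {g' c : α → ℝ} {B : ℝ} (hg : ∀ n, Integrable (g n) μ)
    (hg' : Integrable g' μ) (hc : AEStronglyMeasurable c μ) (hB : ∀ x, |c x| ≤ B)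
    (h : Tendsto (fun n => ∫ x, |g n x - g' x| ∂μ) atTop (𝓝 0)) :
    Tendsto (fun n => ∫ x, g n x * c x ∂μ) atTop (𝓝 (∫ x, g' x * c x ∂μ)) := by
  have hm : ∀ {k : α → ℝ}, Integrable k μ → Integrable (fun x => k x * c x) μ := fun hk =>
    hk.mul_bdd hc (ae_of_all _ hB)
  rw [tendsto_iff_norm_sub_tendsto_zero]
  refine squeeze_zero (fun n => norm_nonneg _) (fun n => ?_)
    (by simpa using h.mul_const B)
  rw [← integral_sub (hm (hg n)) (hm hg'), ← integral_mul_const]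
  refine norm_integral_le_of_norm_le (((hg n).sub hg').abs.mul_const B) (ae_of_all _ fun x => ?_)
  rw [← sub_mul, norm_mul]
  exact mul_le_mul_of_nonneg_left (hB x) (norm_nonneg _)

namespace IsMinimizingLimit

variable {N : ℕ} {p q r : ℝ} {Ω : Set (Euc N)} {V W : Euc N → ℝ} {f : (Euc N → ℝ) → ℝ}
  {w : ℕ → Euc N → ℝ} {ε : ℕ → ℝ} {u : Euc N → ℝ} {v : Euc N → Euc N}

lemma energy_le_add_one (T : IsMinimizingLimit p Ω V f w ε u v) (n : ℕ) :
    energy p Ω V f (w n) ≤ energy p Ω V f (fun _ => 0) + 1 := by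
  nlinarith [T.energy_le n _ isTestFun_zero, T.error_pos n, T.error_le_one n]

lemma integrableOn (T : IsMinimizingLimit p Ω V f w ε u v) {K : Set (Euc N)} (hK : IsCompact K)
    (hKΩ : K ⊆ Ω) : IntegrableOn u K := by
  have h1 := (T.isTestFun 0).continuous.continuousOn.integrableOn_compact (μ := volume) hK
  refine (h1.abs.add ((T.tendsto_integral K hK hKΩ).1 0)).mono'
    T.stronglyMeasurable.aestronglyMeasurable (ae_of_all _ fun x => ?_)
  have h := abs_sub_abs_le_abs_sub (u x) (w 0 x)
  rw [abs_sub_comm] at h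
  simp only [Pi.add_apply, Real.norm_eq_abs]
  linarith

lemma integrableOn_gradient (T : IsMinimizingLimit p Ω V f w ε u v) {K : Set (Euc N)}
    (hK : IsCompact K) (hKΩ : K ⊆ Ω) : IntegrableOn v K := by
  have h1 := (T.isTestFun 0).continuous_gradient.continuousOn.integrableOn_compact (μ := volume) hK
  refine (h1.norm.add ((T.tendsto_integral_gradient K hK hKΩ).1 0)).mono'
    T.stronglyMeasurable_gradient.aestronglyMeasurable (ae_of_all _ fun x => ?_)
  have h := norm_sub_norm_le (v x) (gradient (w 0) x)
  rw [norm_sub_rev] at h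
  simp only [Pi.add_apply]
  linarith

lemma locallyIntegrableOn (T : IsMinimizingLimit p Ω V f w ε u v) (hΩ : IsOpen Ω) :
    LocallyIntegrableOn u Ω :=
  (locallyIntegrableOn_iff hΩ.isLocallyClosed).2 fun _ hKΩ hK => T.integrableOn hK hKΩ

lemma hasWeakGradOn (T : IsMinimizingLimit p Ω V f w ε u v) (hΩ : IsOpen Ω) :
    HasWeakGradOn Ω u v := by
  intro ζ hζ i
  set e : Euc N := EuclideanSpace.single i 1 with he
  set K := tsupport ζ
  have hK : IsCompact K := hζ.isCompact_tsupport
  have hKΩ : K ⊆ Ω := hζ.2.2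
  obtain ⟨C, hC0, hC⟩ := hζ.exists_gradient_bound
  have hne : ‖e‖ = 1 := by simp [he]
  have hDle : ∀ x, |fderiv ℝ ζ x e| ≤ C := fun x => by
    have h := (fderiv ℝ ζ x).le_opNorm e
    rw [hne, mul_one, ← norm_gradient_eq] at h
    exact h.trans (hC x)
  obtain ⟨B, hB⟩ := hζ.2.1.exists_bound_of_continuous hζ.continuous
  have hDc : Continuous fun x => fderiv ℝ ζ x e :=
    (hζ.1.continuous_fderiv (by simp)).clm_apply continuous_const
  have hgi : ∀ n, IntegrableOn (fun x => gradient (w n) x i) K := fun n =>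
    ((EuclideanSpace.proj (𝕜 := ℝ) i).continuous.comp
      (T.isTestFun n).continuous_gradient).continuousOn.integrableOn_compact hK
  have hvi : IntegrableOn (fun x => v x i) K :=
    (EuclideanSpace.proj (𝕜 := ℝ) i).integrable_comp (T.integrableOn_gradient hK hKΩ)
  have h1 := tendsto_integral_mul_of_tendsto_integral_abs_sub (μ := volume.restrict K)
    (fun n => (T.isTestFun n).continuous.continuousOn.integrableOn_compact hK)
    (T.integrableOn hK hKΩ) hDc.aestronglyMeasurable hDle (T.tendsto_integral K hK hKΩ).2
  have h2 := tendsto_integral_mul_of_tendsto_integral_abs_sub (μ := volume.restrict K)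
    hgi hvi hζ.continuous.aestronglyMeasurable hB
    (squeeze_zero (fun n => integral_nonneg fun x => abs_nonneg _)
      (fun n => integral_mono ((hgi n).sub hvi).abs ((T.tendsto_integral_gradient K hK hKΩ).1 n)
        fun x => PiLp.norm_apply_le (gradient (w n) x - v x) i)
      (T.tendsto_integral_gradient K hK hKΩ).2)
  have e1 : ∀ y : Euc N → ℝ, ∫ x in Ω, y x * fderiv ℝ ζ x e = ∫ x in K, y x * fderiv ℝ ζ x e :=
    fun y => setIntegral_eq_of_eq_zero_off hΩ hKΩ fun x hx => by
      rw [fderiv_of_notMem_tsupport ℝ hx]; simp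
  have e2 : ∀ y : Euc N → ℝ, ∫ x in Ω, y x * ζ x = ∫ x in K, y x * ζ x :=
    fun y => setIntegral_eq_of_eq_zero_off hΩ hKΩ fun x hx => by
      rw [image_eq_zero_of_notMem_tsupport hx, mul_zero]
  rw [e1, e2]
  refine tendsto_nhds_unique h1 (h2.neg.congr fun n => ?_)
  rw [← e1, ← e2, (T.isTestFun n).integral_mul_fderiv hζ e]
  have hin : ∀ x, ⟪gradient (w n) x, e⟫ = gradient (w n) x i := fun x => by
    rw [he, EuclideanSpace.inner_single_right]
    exact one_mul _
  simp only [hin]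

end IsMinimizingLimit

/-! ### Strong approximation of the limit by test functions -/

lemma continuous_midDeficit {E : Type*} [NormedAddCommGroup E] [InnerProductSpace ℝ E] {q : ℝ}
    (hq : 0 ≤ q) (a : E) : Continuous fun b => midDeficit q a b := by
  unfold midDeficit
  exact (continuous_const.add (continuous_const.mul
    (continuous_norm.rpow_const fun _ => Or.inr hq))).sub
    ((continuous_const.add (continuous_id.const_smul _)).norm.rpow_const fun _ => Or.inr hq)

lemma convex_isTestFun_near {d : ℕ} (U : Set (Euc d)) (x : Euc d) (s : ℝ) (e : Euc d) (η : ℝ) :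
    Convex ℝ {z : Euc d → ℝ | IsTestFun U z ∧ z x ∈ Metric.closedBall s η ∧
      gradient z x ∈ Metric.closedBall e η} := by
  rintro y ⟨hy, hys, hye⟩ z ⟨hz, hzs, hze⟩ a b ha hb hab
  refine ⟨hy.lincomb hz a b, convex_closedBall s η hys hzs ha hb hab, ?_⟩
  have h := convex_closedBall e η hye hze ha hb hab
  rwa [← gradient_lincomb hy.differentiable hz.differentiable] at h

lemma convex_isTestFun {d : ℕ} (U : Set (Euc d)) : Convex ℝ {z : Euc d → ℝ | IsTestFun U z} :=
  fun _ hy _ hz a b _ _ _ => hy.lincomb hz a b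

namespace VariationalSetting

variable {N : ℕ} {p q r : ℝ} {Ω : Set (Euc N)} {V W : Euc N → ℝ} {f : (Euc N → ℝ) → ℝ}

/-- The weighted midpoint deficit of two test functions. -/
lemma integral_midDeficit (S : VariationalSetting p q r Ω V W f) {y z : Euc N → ℝ}
    (hy : IsTestFun Ω y) (hz : IsTestFun Ω z) :
    IntegrableOn (fun x => (midDeficit q (gradient y x) (gradient z x)
      + midDeficit q (y x) (z x)) * W x) Ω ∧
    ∫ x in Ω, (midDeficit q (gradient y x) (gradient z x) + midDeficit q (y x) (z x)) * W x =
      1 / 2 * (∫ x in Ω, (‖gradient y x‖ ^ q + |y x| ^ q) * W x)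
      + 1 / 2 * (∫ x in Ω, (‖gradient z x‖ ^ q + |z x| ^ q) * W x)
      - ∫ x in Ω, (‖gradient (fun x => 1 / 2 * y x + 1 / 2 * z x) x‖ ^ q
          + |1 / 2 * y x + 1 / 2 * z x| ^ q) * W x := by
  have i1 := (S.integrableOn_weighted hy).const_mul (1 / 2)
  have i2 := (S.integrableOn_weighted hz).const_mul (1 / 2)
  have i3 := S.integrableOn_weighted (hy.lincomb hz (1 / 2) (1 / 2))
  have heq : (fun x => (midDeficit q (gradient y x) (gradient z x)
      + midDeficit q (y x) (z x)) * W x) =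
      fun x => (1 / 2 * ((‖gradient y x‖ ^ q + |y x| ^ q) * W x)
        + 1 / 2 * ((‖gradient z x‖ ^ q + |z x| ^ q) * W x))
        - (‖gradient (fun x => 1 / 2 * y x + 1 / 2 * z x) x‖ ^ q
          + |1 / 2 * y x + 1 / 2 * z x| ^ q) * W x := by
    funext x
    rw [gradient_lincomb hy.differentiable hz.differentiable]
    simp only [midDeficit, smul_eq_mul, Real.norm_eq_abs]
    ring
  rw [heq]
  refine ⟨(i1.add i2).sub i3, ?_⟩
  rw [← integral_const_mul, ← integral_const_mul, ← integral_add i1 i2]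
  exact integral_sub (i1.add i2) i3

/-- Nested convex families admit almost minimal elements of the weighted norm whose mutual
midpoint deficits are uniformly small. -/
lemma exists_small_midDeficit (S : VariationalSetting p q r Ω V W f) {C : ℕ → Set (Euc N → ℝ)}
    (hC : ∀ n, Convex ℝ (C n)) (hCt : ∀ n, ∀ z ∈ C n, IsTestFun Ω z) (hCa : Antitone C) {M : ℝ}
    (hM : ∀ n, ∃ z ∈ C n, ∫ x in Ω, (‖gradient z x‖ ^ q + |z x| ^ q) * W x ≤ M) :
    ∃ (z : ℕ → Euc N → ℝ) (e : ℕ → ℝ), (∀ n, z n ∈ C n) ∧ Tendsto e atTop (𝓝 0) ∧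
      ∀ n, ∀ k ≥ n, ∫ x in Ω, (midDeficit q (gradient (z n) x) (gradient (z k) x)
        + midDeficit q (z n x) (z k x)) * W x ≤ e n := by
  set F : (Euc N → ℝ) → ℝ := fun z => ∫ x in Ω, (‖gradient z x‖ ^ q + |z x| ^ q) * W x with hF
  have hF0 : ∀ z, 0 ≤ F z := fun z => setIntegral_nonneg S.isOpen.measurableSet fun x hx =>
    mul_nonneg (by positivity) (S.weight_pos x hx).le
  set m : ℕ → ℝ := fun n => sInf (F '' C n) with hm
  have hbdd : ∀ n, BddBelow (F '' C n) := fun n => ⟨0, by rintro _ ⟨z, -, rfl⟩; exact hF0 z⟩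
  have hne : ∀ n, (F '' C n).Nonempty := fun n => by
    obtain ⟨z, hz, -⟩ := hM n
    exact ⟨_, z, hz, rfl⟩
  have hmle : ∀ n, ∀ z ∈ C n, m n ≤ F z := fun n z hz => csInf_le (hbdd n) ⟨z, hz, rfl⟩
  have hmM : BddAbove (Set.range m) := ⟨M, by
    rintro _ ⟨n, rfl⟩
    obtain ⟨z, hz, hzM⟩ := hM n
    exact (hmle n z hz).trans hzM⟩
  have hmono : Monotone m := fun n k hnk =>
    csInf_le_csInf (hbdd n) (hne k) (Set.image_mono (hCa hnk))
  have hmlim := tendsto_atTop_ciSup hmono hmM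
  have hex : ∀ n : ℕ, ∃ z ∈ C n, F z ≤ m n + 1 / ((n : ℝ) + 1) := fun n => by
    obtain ⟨_, ⟨z, hz, rfl⟩, hlt⟩ := Real.lt_sInf_add_pos (hne n)
      (show 0 < 1 / ((n : ℝ) + 1) by positivity)
    exact ⟨z, hz, hlt.le⟩
  choose z hz hzF using hex
  refine ⟨z, fun n => 1 / ((n : ℝ) + 1) + 1 / 2 * ((⨆ i, m i) - m n), hz, ?_, fun n k hk => ?_⟩
  · simpa only [sub_self, mul_zero, add_zero] using (tendsto_one_div_add_atTop_nhds_zero_nat (𝕜 := ℝ)).add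
      (((tendsto_const_nhds (x := ⨆ i, m i)).sub hmlim).const_mul (1 / 2))
  · rw [(S.integral_midDeficit (hCt n _ (hz n)) (hCt k _ (hz k))).2]
    have h1 := hzF n
    have h2 := hzF k
    have h3 := hmle n _ (hC n (hz n) (hCa hk (hz k)) (by norm_num : (0 : ℝ) ≤ 1 / 2)
      (by norm_num : (0 : ℝ) ≤ 1 / 2) (by norm_num))
    have h4 : m k ≤ ⨆ i, m i := le_ciSup hmM k
    have h5 : 1 / ((k : ℝ) + 1) ≤ 1 / ((n : ℝ) + 1) := by gcongr
    have h6 : m n ≤ ∫ x in Ω, (‖gradient (fun x => 1 / 2 * z n x + 1 / 2 * z k x) x‖ ^ q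
          + |1 / 2 * z n x + 1 / 2 * z k x| ^ q) * W x := h3
    simp only [hF] at h1 h2
    linarith

end VariationalSetting

namespace IsMinimizingLimit

variable {N : ℕ} {p q r : ℝ} {Ω : Set (Euc N)} {V W : Euc N → ℝ} {f : (Euc N → ℝ) → ℝ}
  {w : ℕ → Euc N → ℝ} {ε : ℕ → ℝ} {u : Euc N → ℝ} {v : Euc N → Euc N}

lemma exists_weighted_bound (T : IsMinimizingLimit p Ω V f w ε u v)
    (S : VariationalSetting p q r Ω V W f) :
    ∃ M : ℝ, ∀ n, ∫ x in Ω, (‖gradient (w n) x‖ ^ q + |w n x| ^ q) * W x ≤ M := by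
  obtain ⟨M, -, hM⟩ := S.exists_weighted_bound_of_energy_le (energy p Ω V f (fun _ => 0) + 1)
  exact ⟨M, fun n => hM _ (T.isTestFun n) (T.energy_le_add_one n)⟩

lemma integrableOn_weighted (T : IsMinimizingLimit p Ω V f w ε u v)
    (S : VariationalSetting p q r Ω V W f) :
    IntegrableOn (fun x => (‖v x‖ ^ q + |u x| ^ q) * W x) Ω := by
  obtain ⟨M, hM⟩ := T.exists_weighted_bound S
  refine (integrable_and_integral_le_of_tendsto_ae
    (fun n => S.integrableOn_weighted (T.isTestFun n)) (fun n => ?_)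
    (Eventually.of_forall hM) ?_).1
  · filter_upwards [ae_restrict_mem S.isOpen.measurableSet] with x hx
    exact mul_nonneg (by positivity) (S.weight_pos x hx).le
  · filter_upwards [T.tendsto_ae, T.tendsto_gradient_ae] with x h1 h2
    exact ((h2.norm.rpow_const (Or.inr S.q_pos.le)).add
      (h1.abs.rpow_const (Or.inr S.q_pos.le))).mul_const _

lemma exists_tendsto_weighted (T : IsMinimizingLimit p Ω V f w ε u v)
    (S : VariationalSetting p q r Ω V W f) :
    ∃ φ : ℕ → Euc N → ℝ, (∀ j, IsTestFun Ω (φ j)) ∧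
      Tendsto (fun j => ∫ x in Ω,
        (|u x - φ j x| ^ q + ‖v x - gradient (φ j) x‖ ^ q) * W x) atTop (𝓝 0) := by
  have hq := S.q_pos
  obtain ⟨M, hM⟩ := T.exists_weighted_bound S
  set C : ℕ → Set (Euc N → ℝ) := fun n => convexHull ℝ (w '' Set.Ici n)
  have hCt : ∀ n, ∀ z ∈ C n, IsTestFun Ω z := fun n => convexHull_min
    (by rintro _ ⟨k, -, rfl⟩; exact T.isTestFun k) (convex_isTestFun Ω)
  obtain ⟨z, e, hz, he, hze⟩ := S.exists_small_midDeficit (C := C) (M := M)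
    (fun n => convex_convexHull ℝ _) hCt
    (fun n k hnk => convexHull_mono (Set.image_mono (Set.Ici_subset_Ici.2 hnk)))
    fun n => ⟨w n, subset_convexHull ℝ _ ⟨n, Set.mem_Ici.2 le_rfl, rfl⟩, hM n⟩
  have hzt : ∀ n, IsTestFun Ω (z n) := fun n => hCt n _ (hz n)
  have hpos := ae_restrict_mem (μ := volume) S.isOpen.measurableSet
  have hzlim : ∀ᵐ x ∂volume.restrict Ω, Tendsto (fun n => z n x) atTop (𝓝 (u x)) ∧
      Tendsto (fun n => gradient (z n) x) atTop (𝓝 (v x)) := by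
    filter_upwards [T.tendsto_ae, T.tendsto_gradient_ae] with x h1 h2
    have key : ∀ η : ℝ, 0 < η → ∃ n0, ∀ n ≥ n0, z n x ∈ Metric.closedBall (u x) η ∧
        gradient (z n) x ∈ Metric.closedBall (v x) η := by
      intro η hη
      obtain ⟨n0, hn0⟩ := eventually_atTop.1
        ((h1.eventually (Metric.closedBall_mem_nhds _ hη)).and
          (h2.eventually (Metric.closedBall_mem_nhds _ hη)))
      refine ⟨n0, fun n hn => ?_⟩
      refine (convexHull_min ?_ (convex_isTestFun_near Ω x (u x) (v x) η) (hz n)).2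
      rintro _ ⟨k, hk, rfl⟩
      exact ⟨T.isTestFun k, hn0 k (hn.trans hk)⟩
    constructor
    · refine Metric.tendsto_atTop'.2 fun η hη => ?_
      obtain ⟨n0, hn0⟩ := key (η / 2) (half_pos hη)
      exact ⟨n0, fun n hn => (Metric.mem_closedBall.1 (hn0 n hn.le).1).trans_lt (by linarith)⟩
    · refine Metric.tendsto_atTop'.2 fun η hη => ?_
      obtain ⟨n0, hn0⟩ := key (η / 2) (half_pos hη)
      exact ⟨n0, fun n hn => (Metric.mem_closedBall.1 (hn0 n hn.le).2).trans_lt (by linarith)⟩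
  have hdef : ∀ n, IntegrableOn (fun x => (midDeficit q (gradient (z n) x) (v x)
        + midDeficit q (z n x) (u x)) * W x) Ω ∧
      ∫ x in Ω, (midDeficit q (gradient (z n) x) (v x) + midDeficit q (z n x) (u x)) * W x
        ≤ e n := by
    intro n
    refine integrable_and_integral_le_of_tendsto_ae
      (fun k => (S.integral_midDeficit (hzt n) (hzt k)).1) (fun k => ?_)
      (eventually_atTop.2 ⟨n, hze n⟩) ?_
    · filter_upwards [hpos] with x hx
      exact mul_nonneg (add_nonneg (midDeficit_nonneg S.one_lt_q _ _)
        (midDeficit_nonneg S.one_lt_q _ _)) (S.weight_pos x hx).le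
    · filter_upwards [hzlim] with x hx
      exact ((((continuous_midDeficit hq.le _).tendsto _).comp hx.2).add
        (((continuous_midDeficit hq.le _).tendsto _).comp hx.1)).mul_const _
  obtain ⟨C₁, hC₁0, hC₁⟩ := exists_norm_sub_rpow_le_midDeficit (E := Euc N) S.one_lt_q
  obtain ⟨C₂, hC₂0, hC₂⟩ := exists_norm_sub_rpow_le_midDeficit (E := ℝ) S.one_lt_q
  refine ⟨z, hzt, tendsto_integral_zero_of_le_add (fun n => ?_) (fun n => ?_) ?_ fun κ hκ =>
    ⟨fun n x => (C₁ + C₂) * ((midDeficit q (gradient (z n) x) (v x)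
        + midDeficit q (z n x) (u x)) * W x),
      fun x => (C₁ + C₂) * ((‖v x‖ ^ q + |u x| ^ q) * W x), fun n => (hdef n).1.const_mul _,
      fun n => ?_, ?_, (T.integrableOn_weighted S).const_mul _, fun n => ?_⟩⟩
  · refine AEStronglyMeasurable.mul (AEStronglyMeasurable.add ?_ ?_)
      (S.weight_continuousOn.aestronglyMeasurable S.isOpen.measurableSet)
    · exact ((continuous_id.rpow_const fun _ => Or.inr hq.le).comp_aestronglyMeasurable
        (T.stronglyMeasurable.aestronglyMeasurable.sub
          (hzt n).continuous.aestronglyMeasurable).norm)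
    · exact ((continuous_id.rpow_const fun _ => Or.inr hq.le).comp_aestronglyMeasurable
        (T.stronglyMeasurable_gradient.aestronglyMeasurable.sub
          (hzt n).continuous_gradient.aestronglyMeasurable).norm)
  · filter_upwards [hpos] with x hx
    exact mul_nonneg (by positivity) (S.weight_pos x hx).le
  · filter_upwards [hzlim] with x hx
    have h1 := ((tendsto_const_nhds (x := u x)).sub hx.1).abs.rpow_const (p := q) (Or.inr hq.le)
    have h2 := ((tendsto_const_nhds (x := v x)).sub hx.2).norm.rpow_const (p := q) (Or.inr hq.le)
    simpa [zero_rpow hq.ne'] using (h1.add h2).mul_const (W x)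
  · filter_upwards [hpos] with x hx
    exact mul_nonneg (by positivity) (mul_nonneg (add_nonneg (midDeficit_nonneg S.one_lt_q _ _)
        (midDeficit_nonneg S.one_lt_q _ _)) (S.weight_pos x hx).le)
  · have h : Tendsto (fun n => (C₁ + C₂) * e n) atTop (𝓝 0) := by simpa using he.const_mul (C₁ + C₂)
    filter_upwards [h.eventually_le_const hκ] with n hn
    rw [integral_const_mul]
    exact (mul_le_mul_of_nonneg_left (hdef n).2 (by positivity)).trans hn
  · filter_upwards [hpos] with x hx
    have h1 := hC₁ (gradient (z n) x) (v x)
    have h2 := hC₂ (z n x) (u x)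
    have h3 : 0 ≤ C₂ * (midDeficit q (gradient (z n) x) (v x) + ‖v x‖ ^ q) :=
      mul_nonneg hC₂0 (add_nonneg (midDeficit_nonneg S.one_lt_q _ _) (by positivity))
    have h4 : 0 ≤ C₁ * (midDeficit q (z n x) (u x) + |u x| ^ q) :=
      mul_nonneg hC₁0 (add_nonneg (midDeficit_nonneg S.one_lt_q _ _) (by positivity))
    rw [Real.norm_eq_abs, Real.norm_eq_abs, abs_sub_comm] at h2
    rw [norm_sub_rev] at h1
    have h5 : |u x - z n x| ^ q + ‖v x - gradient (z n) x‖ ^ q ≤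
        (C₁ + C₂) * (midDeficit q (gradient (z n) x) (v x) + midDeficit q (z n x) (u x)
          + (‖v x‖ ^ q + |u x| ^ q)) := by linarith
    have h6 := mul_le_mul_of_nonneg_right h5 (S.weight_pos x hx).le
    linarith

end IsMinimizingLimit

/-! ### The equation -/

namespace VariationalSetting

variable {N : ℕ} {p q r : ℝ} {Ω : Set (Euc N)} {V W : Euc N → ℝ} {f : (Euc N → ℝ) → ℝ}
  {φ : ℕ → Euc N → ℝ} {ζ u : Euc N → ℝ} {v : Euc N → Euc N} {M : ℝ}

lemma tendsto_integral_inner_pvec (S : VariationalSetting p q r Ω V W f)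
    (hφ : ∀ n, IsTestFun Ω (φ n))
    (hM : ∀ n, ∫ x in Ω, (‖gradient (φ n) x‖ ^ q + |φ n x| ^ q) * W x ≤ M)
    (hlim : ∀ᵐ x ∂volume.restrict Ω, Tendsto (fun n => gradient (φ n) x) atTop (𝓝 (v x)))
    (hζ : IsTestFun Ω ζ) :
    IntegrableOn (fun x => ⟪pvec p (v x), gradient ζ x⟫) Ω ∧
      Tendsto (fun n => ∫ x in Ω, ⟪pvec p (gradient (φ n) x), gradient ζ x⟫) atTop
        (𝓝 (∫ x in Ω, ⟪pvec p (v x), gradient ζ x⟫)) := by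
  have hK := hζ.isCompact_tsupport
  have hq := S.q_pos
  have h0 : ∀ G : Euc N → Euc N, ∀ x, x ∉ tsupport ζ → ⟪G x, gradient ζ x⟫ = 0 :=
    fun G x hx => by rw [gradient_eq_zero_of_notMem_tsupport hx, inner_zero_right]
  have hcont : ∀ n, Continuous fun x => pvec p (gradient (φ n) x) := fun n =>
    (continuous_pvec S.one_lt_p).comp (hφ n).continuous_gradient
  obtain ⟨C, -, hC⟩ := S.exists_local_bound M hK hζ.2.2
  have hg : ∀ n, IntegrableOn (fun x => ‖gradient (φ n) x‖ ^ q) (tsupport ζ) := fun n =>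
    ((hφ n).continuous_gradient_rpow hq.le).continuousOn.integrableOn_compact hK
  have ha : ∀ n, IntegrableOn (fun x => |φ n x| ^ q) (tsupport ζ) := fun n =>
    ((hφ n).continuous_abs_rpow hq.le).continuousOn.integrableOn_compact hK
  have key := integrable_and_tendsto_integral_of_le_rpow_mul (μ := volume.restrict (tsupport ζ))
    (M := C) (sub_pos.2 S.one_lt_p) S.p_sub_one_lt_q
    (h := fun n x => ‖gradient (φ n) x‖) (g := fun x => ‖gradient ζ x‖)
    (c := fun n x => ⟪pvec p (gradient (φ n) x), gradient ζ x⟫)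
    (c' := fun x => ⟪pvec p (v x), gradient ζ x⟫)
    (fun n => ae_of_all _ fun x => norm_nonneg _) (ae_of_all _ fun x => norm_nonneg _)
    hg
    (fun n => (integral_mono (hg n) ((hg n).add (ha n)) fun x =>
      le_add_of_nonneg_right (by positivity)).trans (hC _ (hφ n) (hM n)))
    ((hζ.continuous_gradient_rpow
      (div_nonneg hq.le (sub_pos.2 S.p_sub_one_lt_q).le)).continuousOn.integrableOn_compact hK)
    (fun n => ((hcont n).inner hζ.continuous_gradient).aestronglyMeasurable)
    (fun n => ae_of_all _ fun x => by
      rw [← norm_pvec S.one_lt_p]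
      exact abs_real_inner_le_norm _ _)
    (by
      filter_upwards [ae_restrict_of_ae_restrict_of_subset hζ.2.2 hlim] with x hx
      exact (((continuous_pvec S.one_lt_p).tendsto _).comp hx).inner tendsto_const_nhds)
  refine ⟨integrableOn_of_eq_zero_off S.isOpen key.1 (h0 _), ?_⟩
  rw [setIntegral_eq_of_eq_zero_off S.isOpen hζ.2.2 (h0 _)]
  refine key.2.congr fun n => ?_
  rw [setIntegral_eq_of_eq_zero_off S.isOpen hζ.2.2 (h0 _)]

lemma tendsto_integral_potential_psc (S : VariationalSetting p q r Ω V W f)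
    (hφ : ∀ n, IsTestFun Ω (φ n))
    (hM : ∀ n, ∫ x in Ω, (‖gradient (φ n) x‖ ^ q + |φ n x| ^ q) * W x ≤ M)
    (hlim : ∀ᵐ x ∂volume.restrict Ω, Tendsto (fun n => φ n x) atTop (𝓝 (u x)))
    (hζ : IsTestFun Ω ζ) :
    IntegrableOn (fun x => V x * psc p (u x) * ζ x) Ω ∧
      Tendsto (fun n => ∫ x in Ω, V x * psc p (φ n x) * ζ x) atTop
        (𝓝 (∫ x in Ω, V x * psc p (u x) * ζ x)) := by
  have hK := hζ.isCompact_tsupport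
  have hq := S.q_pos
  have hp := S.p_pos
  have hqr : q / p ≤ r := ((div_le_one hp).2 S.q_le_p).trans S.one_le_r
  have h0 : ∀ y : Euc N → ℝ, ∀ x, x ∉ tsupport ζ → V x * psc p (y x) * ζ x = 0 :=
    fun y x hx => by rw [image_eq_zero_of_notMem_tsupport hx, mul_zero]
  obtain ⟨C, -, hC⟩ := S.exists_local_hardy_bound M hK hζ.2.2
  have hmeas := hK.isClosed.measurableSet
  have hae : ∀ᵐ x ∂volume.restrict (tsupport ζ), 0 ≤ V x := by
    filter_upwards [ae_restrict_mem hmeas] with x hx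
    exact S.potential_nonneg x (hζ.2.2 hx)
  have key := integrable_and_tendsto_integral_of_le_rpow_mul (μ := volume.restrict (tsupport ζ))
    (M := C) (sub_pos.2 S.one_lt_p) S.p_sub_one_lt_q
    (h := fun n x => V x ^ (1 / p) * |φ n x|) (g := fun x => V x ^ (1 / p) * |ζ x|)
    (c := fun n x => V x * psc p (φ n x) * ζ x) (c' := fun x => V x * psc p (u x) * ζ x)
    (fun n => hae.mono fun x hx => mul_nonneg (rpow_nonneg hx _) (abs_nonneg _))
    (hae.mono fun x hx => mul_nonneg (rpow_nonneg hx _) (abs_nonneg _))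
    (fun n => by
      refine (S.integrableOn_potential_rpow_mul hK hζ.2.2 (div_pos hq hp) hqr
        ((hφ n).continuous_abs_rpow hq.le).continuousOn).congr (hae.mono fun x hx => ?_)
      simp only
      rw [mul_rpow (rpow_nonneg hx _) (abs_nonneg _), ← rpow_mul hx, one_div_mul_eq_div])
    (fun n => hC _ (hφ n) (hM n))
    (by
      refine (S.integrableOn_potential_rpow_mul hK hζ.2.2 S.r_pos le_rfl
        (hζ.continuous_abs_rpow
          (div_nonneg hq.le (sub_pos.2 S.p_sub_one_lt_q).le)).continuousOn).congr
        (hae.mono fun x hx => ?_)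
      simp only
      rw [mul_rpow (rpow_nonneg hx _) (abs_nonneg _), ← rpow_mul hx, S.dual_exponent])
    (fun n => ((S.integrableOn_potential_psc (hφ n) hζ).mono_set hζ.2.2).aestronglyMeasurable)
    (fun n => hae.mono fun x hx => by
      refine le_of_eq ?_
      rw [abs_mul, abs_mul, abs_psc S.one_lt_p, abs_of_nonneg hx,
        mul_rpow (rpow_nonneg hx _) (abs_nonneg _), mul_mul_mul_comm,
        rpow_sub_one_mul S.one_lt_p (rpow_nonneg hx _), ← rpow_mul hx,
        one_div_mul_cancel hp.ne', rpow_one, mul_assoc])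
    (by
      filter_upwards [ae_restrict_of_ae_restrict_of_subset hζ.2.2 hlim] with x hx
      exact ((((continuous_psc S.one_lt_p).tendsto _).comp hx).const_mul _).mul_const _)
  refine ⟨integrableOn_of_eq_zero_off S.isOpen key.1 (h0 _), ?_⟩
  rw [setIntegral_eq_of_eq_zero_off S.isOpen hζ.2.2 (h0 _)]
  refine key.2.congr fun n => ?_
  rw [setIntegral_eq_of_eq_zero_off S.isOpen hζ.2.2 (h0 _)]

end VariationalSetting

namespace IsMinimizingLimit

variable {N : ℕ} {p q r : ℝ} {Ω : Set (Euc N)} {V W : Euc N → ℝ} {f : (Euc N → ℝ) → ℝ}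
  {w : ℕ → Euc N → ℝ} {ε : ℕ → ℝ} {u ζ : Euc N → ℝ} {v : Euc N → Euc N}

/-- A minimizing limit is approximated by test functions that are almost critical for the energy
in a prescribed direction. -/
lemma exists_almost_critical_seq (T : IsMinimizingLimit p Ω V f w ε u v)
    (S : VariationalSetting p q r Ω V W f) (hζ : IsTestFun Ω ζ) :
    ∃ φ : ℕ → Euc N → ℝ, (∀ n, IsTestFun Ω (φ n)) ∧
      (∃ M, ∀ n, ∫ x in Ω, (‖gradient (φ n) x‖ ^ q + |φ n x| ^ q) * W x ≤ M) ∧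
      (∀ᵐ x ∂volume.restrict Ω, Tendsto (fun n => φ n x) atTop (𝓝 (u x))) ∧
      (∀ᵐ x ∂volume.restrict Ω, Tendsto (fun n => gradient (φ n) x) atTop (𝓝 (v x))) ∧
      Tendsto (fun n => energyDeriv p Ω V f (φ n) ζ) atTop (𝓝 0) := by
  obtain ⟨C, hC0, hC⟩ := hζ.exists_gradient_bound
  have hζ' := hζ.const_mul (-1)
  have hgneg : ∀ x, gradient (fun x => (-1) * ζ x) x = (-1 : ℝ) • gradient ζ x := fun x => by
    rw [gradient_fun_const_mul hζ.differentiable]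
  have hex : ∀ n, ∃ y, IsTestFun Ω y ∧ energy p Ω V f y ≤ energy p Ω V f (w n) ∧
      ∫ x in Ω, (|y x - w n x| + ‖gradient y x - gradient (w n) x‖) ≤ ε n ∧
      |energyDeriv p Ω V f y ζ| ≤ ε n * ((∫ x in Ω, (|ζ x| + ‖gradient ζ x‖)) + C + 1) := by
    intro n
    obtain ⟨R, hR0, hR⟩ := (T.isTestFun n).exists_gradient_bound
    have hbound : ∀ x, ‖gradient ζ x‖ ≤ C * (R + 1) := fun x =>
      (hC x).trans (le_mul_of_one_le_right hC0 (by linarith))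
    obtain ⟨y, hy, hye, hyw, -, hcrit⟩ := S.exists_almost_critical (T.error_pos n)
      (T.error_le_one n) (le_add_of_nonneg_left hR0) hC0 hζ.isCompact_tsupport hζ.2.2
      (T.isTestFun n) (T.energy_le n) fun x => (hR x).trans (le_add_of_nonneg_right zero_le_one)
    have h1 := hcrit ζ hζ (fun x hx => image_eq_zero_of_notMem_tsupport hx) hbound
    have h2 := hcrit _ hζ' (fun x hx => by rw [image_eq_zero_of_notMem_tsupport hx, mul_zero])
      fun x => by rw [hgneg, norm_smul, norm_neg, norm_one, one_mul]; exact hbound x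
    simp only [hgneg, S.energyDeriv_neg hζ, abs_mul, abs_neg, abs_one, one_mul, norm_smul,
      norm_neg, norm_one] at h2
    exact ⟨y, hy, hye, hyw, abs_le.2 ⟨h1, by linarith⟩⟩
  choose y hy hye hyw hyd using hex
  obtain ⟨M, -, hM⟩ := S.exists_weighted_bound_of_energy_le (energy p Ω V f (fun _ => 0) + 1)
  have hi : ∀ n, IntegrableOn
      (fun x => |y n x - w n x| + ‖gradient (y n) x - gradient (w n) x‖) Ω := fun n => by
    simpa only [gradient_fun_sub (hy n).differentiable (T.isTestFun n).differentiable] using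
      ((hy n).sub (T.isTestFun n)).integrableOn_abs_add_gradient S.isOpen
  obtain ⟨σ, hσ, hlim⟩ := exists_subseq_tendsto_ae_of_tendsto_integral hi
    (fun n x => by positivity)
    (squeeze_zero (fun n => integral_nonneg fun x => by positivity) hyw T.error_tendsto)
  have hσ' := hσ.tendsto_atTop
  refine ⟨fun n => y (σ n), fun n => hy _,
    ⟨M, fun n => hM _ (hy _) ((hye _).trans (T.energy_le_add_one _))⟩, ?_, ?_, ?_⟩
  · filter_upwards [hlim, T.tendsto_ae] with x h1 h2
    have h3 : Tendsto (fun n => y (σ n) x - w (σ n) x) atTop (𝓝 0) :=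
      squeeze_zero_norm (fun n => le_add_of_nonneg_right (norm_nonneg _)) h1
    simpa using h3.add (h2.comp hσ')
  · filter_upwards [hlim, T.tendsto_gradient_ae] with x h1 h2
    have h3 : Tendsto (fun n => gradient (y (σ n)) x - gradient (w (σ n)) x) atTop (𝓝 0) :=
      squeeze_zero_norm (fun n => le_add_of_nonneg_left (abs_nonneg _)) h1
    simpa using h3.add (h2.comp hσ')
  · refine squeeze_zero_norm (fun n => hyd (σ n)) ?_
    simpa using (T.error_tendsto.comp hσ').mul_const
      ((∫ x in Ω, (|ζ x| + ‖gradient ζ x‖)) + C + 1)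

lemma equation (T : IsMinimizingLimit p Ω V f w ε u v) (S : VariationalSetting p q r Ω V W f)
    (hζ : IsTestFun Ω ζ) :
    IntegrableOn (fun x => ⟪pvec p (v x), gradient ζ x⟫) Ω ∧
      IntegrableOn (fun x => V x * psc p (u x) * ζ x) Ω ∧
      (∫ x in Ω, ⟪pvec p (v x), gradient ζ x⟫)
        - (∫ x in Ω, V x * psc p (u x) * ζ x) = f ζ := by
  obtain ⟨φ, hφ, ⟨M, hM⟩, hlim, hlim', hd⟩ := T.exists_almost_critical_seq S hζ
  obtain ⟨h1, h2⟩ := S.tendsto_integral_inner_pvec hφ hM hlim' hζ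
  obtain ⟨h3, h4⟩ := S.tendsto_integral_potential_psc hφ hM hlim hζ
  exact ⟨h1, h3, sub_eq_zero.1 (tendsto_nhds_unique ((h2.sub h4).sub_const (f ζ)) hd)⟩

end IsMinimizingLimit

/-- Theorem 4.6, variant of the main result: the conclusion of the main
theorem remains valid when the local integrability condition on `V` is replaced by
`V ∈ L^r_loc(Ω)` with `1/r + (p-1)(p-q)/q = 1` together with the Hardy-type inequality
`∫ V^{q/p} |u|^q ≤ C ∫ |∇u|^q`. -/
theorem stmt8 (N : ℕ) (p q r : ℝ) (hp : 1 < p)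
    (Ω : Set (Euc N)) (hΩo : IsOpen Ω) (hΩc : IsConnected Ω)
    (V : Euc N → ℝ) (hV0 : ∀ x ∈ Ω, 0 ≤ V x)
    (hQpos : ∀ u : Euc N → ℝ, IsTestFun Ω u → u ≠ 0 → 0 < QV p Ω V u)
    (hq1 : 1 < q) (hqp : q ≤ p) (hpq : p - 1 < q)
    (W : Euc N → ℝ) (hWc : ContinuousOn W Ω) (hWpos : ∀ x ∈ Ω, 0 < W x)
    (hA : ∀ u : Euc N → ℝ, IsTestFun Ω u →
      (∫ x in Ω, (‖gradient u x‖ ^ q + |u x| ^ q) * W x) ^ (p / q) ≤ QV p Ω V u)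
    (hr : 1 / r + (p - 1) * (p - q) / q = 1)
    (hVr : ∀ K : Set (Euc N), IsCompact K → K ⊆ Ω → IntegrableOn (fun x => V x ^ r) K)
    (hHardy : ∃ C : ℝ, 0 < C ∧ ∀ u : Euc N → ℝ, IsTestFun Ω u →
      (∫ x in Ω, V x ^ (q / p) * |u x| ^ q) ≤ C * ∫ x in Ω, ‖gradient u x‖ ^ q)
    (f : (Euc N → ℝ) → ℝ)
    (hflin : ∀ (a b : ℝ) (ζ η : Euc N → ℝ), IsTestFun Ω ζ → IsTestFun Ω η →
      f (fun x => a * ζ x + b * η x) = a * f ζ + b * f η)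
    (hfin : ∃ C : ℝ, ∀ u : Euc N → ℝ, IsTestFun Ω u → QV p Ω V u = 1 → f u ≤ C) :
    ∃ (u : Euc N → ℝ) (v : Euc N → Euc N),
      LocallyIntegrableOn u Ω ∧ HasWeakGradOn Ω u v ∧
      IntegrableOn (fun x => (|u x| ^ q + ‖v x‖ ^ q) * W x) Ω ∧
      (∃ φ : ℕ → Euc N → ℝ, (∀ j, IsTestFun Ω (φ j)) ∧
        Tendsto (fun j => ∫ x in Ω,
            (|u x - φ j x| ^ q + ‖v x - gradient (φ j) x‖ ^ q) * W x) atTop (𝓝 0)) ∧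
      (∀ ζ : Euc N → ℝ, IsTestFun Ω ζ →
        IntegrableOn (fun x => ⟪pvec p (v x), gradient ζ x⟫) Ω ∧
        IntegrableOn (fun x => V x * psc p (u x) * ζ x) Ω ∧
        (∫ x in Ω, ⟪pvec p (v x), gradient ζ x⟫)
          - (∫ x in Ω, V x * psc p (u x) * ζ x) = f ζ) := by
  have S : VariationalSetting p q r Ω V W f :=
    ⟨hp, hΩo, hV0, hQpos, hq1, hqp, hpq, hWc, hWpos, hA, hr, hVr, hHardy, hflin, hfin⟩
  obtain ⟨w, ε, u, v, T⟩ := S.exists_isMinimizingLimit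
  exact ⟨u, v, T.locallyIntegrableOn hΩo, T.hasWeakGradOn hΩo,
    by simpa only [add_comm] using T.integrableOn_weighted S, T.exists_tendsto_weighted S,
    fun ζ hζ => T.equation S hζ⟩
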